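/- arXiv:1105.0140 — 2 statements merged into one kernel-verified Lean document; each statement's English description precedes it below -/
import Mathlib

section
/- Let a countably infinite amenable group G act continuously on a compact metrizable space X, and let Σ be a sofic approximation sequence for G (every countable amenable group is sofic). Then mdim_Σ(X) = mdim(X), the Gromov–Lindenstrauss–Weiss mean topological dimension of the action. -/
open Filter Topology TopologicalSpace
open scoped ENat
open scoped Classical Pointwise

namespace SoficMD

/-- A sofic approximation sequence for a group `G`. -/
structure SoficApprox (G : Type*) [Group G] where
  d : ℕ → ℕ
  σ : ∀ i, G → Equiv.Perm (Fin (d i))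
  approx_mul : ∀ s t : G, Tendsto
    (fun i => ((Finset.univ.filter fun a : Fin (d i) => σ i s (σ i t a) = σ i (s * t) a).card : ℝ) / (d i : ℝ))
    atTop (𝓝 1)
  approx_sep : ∀ s t : G, s ≠ t → Tendsto
    (fun i => ((Finset.univ.filter fun a : Fin (d i) => σ i s a = σ i t a).card : ℝ) / (d i : ℝ))
    atTop (𝓝 0)
  d_tendsto : Tendsto d atTop atTop

/-- A continuous pseudometric on a topological space. -/
structure ContPseudoMetric (X : Type*) [TopologicalSpace X] where
  d : X → X → ℝ
  continuous' : Continuous fun p : X × X => d p.1 p.2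
  nonneg : ∀ x y, 0 ≤ d x y
  symm : ∀ x y, d x y = d y x
  refl : ∀ x, d x x = 0
  triangle : ∀ x y z, d x z ≤ d x y + d y z

/-- A continuous pseudometric on a compact Hausdorff space is a compatible metric iff it
separates points. -/
def ContPseudoMetric.IsCompatMetric {X : Type*} [TopologicalSpace X]
    (ρ : ContPseudoMetric X) : Prop :=
  ∀ x y : X, ρ.d x y = 0 → x = y

/-- A continuous pseudometric is dynamically generating if translates separate points. -/
def DynGenerating (G : Type*) {X : Type*} [Group G] [TopologicalSpace X] [MulAction G X]
    (ρ : ContPseudoMetric X) : Prop :=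
  ∀ x y : X, x ≠ y → ∃ s : G, 0 < ρ.d (s • x) (s • y)

/-- Equivariance of a map between two `G`-spaces. -/
def Equivariant (G : Type*) {A B : Type*} [SMul G A] [SMul G B] (f : A → B) : Prop :=
  ∀ (s : G) (a : A), f (s • a) = s • f a

/-- The normalized ℓ² pseudometric on maps `[d] → X`. -/
noncomputable def rho2 {X : Type*} [TopologicalSpace X] (ρ : ContPseudoMetric X) {d : ℕ}
    (φ ψ : Fin d → X) : ℝ :=
  Real.sqrt ((1 / (d : ℝ)) * ∑ a, (ρ.d (φ a) (ψ a)) ^ 2)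

/-- The ℓ^∞ pseudometric on maps `[d] → X`. -/
noncomputable def rhoInfty {X : Type*} [TopologicalSpace X] (ρ : ContPseudoMetric X) {d : ℕ}
    (φ ψ : Fin d → X) : ℝ :=
  ⨆ a : Fin d, ρ.d (φ a) (ψ a)

/-- The space of `(ρ, F, δ)`-approximately equivariant maps `[d] → X` relative to `σ`. -/
def MapSpace {G X : Type*} [Group G] [TopologicalSpace X] [MulAction G X]
    (ρ : ContPseudoMetric X) (F : Finset G) (δ : ℝ) {d : ℕ}
    (σ : G → Equiv.Perm (Fin d)) : Set (Fin d → X) :=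
  {φ | ∀ s ∈ F, rho2 ρ (fun a => φ (σ s a)) (fun a => s • φ a) ≤ δ}

/-- A finite open cover. -/
def IsFinOpenCover {Y : Type*} [TopologicalSpace Y] (𝒰 : Finset (Set Y)) : Prop :=
  (∀ U ∈ 𝒰, IsOpen U) ∧ (⋃ U ∈ 𝒰, U) = Set.univ

/-- `𝒱` refines `𝒰`. -/
def Refines {Y : Type*} (𝒱 𝒰 : Finset (Set Y)) : Prop :=
  ∀ V ∈ 𝒱, ∃ U ∈ 𝒰, V ⊆ U

/-- `ord` of a finite family of sets: the maximal multiplicity minus one. -/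
noncomputable def coverOrd {Y : Type*} (𝒰 : Finset (Set Y)) : EReal :=
  (⨆ y : Y, (((𝒰.filter fun U => y ∈ U).card : ℝ) : EReal)) - 1

/-- `D(𝒰)`: the infimum of `ord 𝒱` over finite open covers `𝒱` refining `𝒰`. -/
noncomputable def coverD {Y : Type*} [TopologicalSpace Y] (𝒰 : Finset (Set Y)) : EReal :=
  ⨅ 𝒱 ∈ {𝒱 : Finset (Set Y) | IsFinOpenCover 𝒱 ∧ Refines 𝒱 𝒰}, coverOrd 𝒱

/-- the product cover `𝒰^d` of `Y^[d]`. -/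
noncomputable def prodCover {Y : Type*} (𝒰 : Finset (Set Y)) (d : ℕ) :
    Finset (Set (Fin d → Y)) :=
  (Fintype.piFinset fun _ : Fin d => 𝒰).image fun U => {φ | ∀ a, φ a ∈ U a}

/-- restriction of a cover to a subset, viewed as a cover of the subtype. -/
noncomputable def restrictCover {Y : Type*} (𝒰 : Finset (Set Y)) (Z : Set Y) :
    Finset (Set Z) :=
  𝒰.image fun U => (Subtype.val ⁻¹' U : Set Z)

/-- `D(𝒰, ρ, F, δ, σ)`. -/
noncomputable def coverDMap {G X : Type*} [Group G] [TopologicalSpace X] [MulAction G X]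
    (𝒰 : Finset (Set X)) (ρ : ContPseudoMetric X) (F : Finset G) (δ : ℝ) {d : ℕ}
    (σ : G → Equiv.Perm (Fin d)) : EReal :=
  coverD (restrictCover (prodCover 𝒰 d) (MapSpace ρ F δ σ))

/-- `D_Σ(𝒰, ρ, F, δ)`. -/
noncomputable def DSigmaFdel {G X : Type*} [Group G] [TopologicalSpace X] [MulAction G X]
    (Sap : SoficApprox G) (𝒰 : Finset (Set X)) (ρ : ContPseudoMetric X)
    (F : Finset G) (δ : ℝ) : EReal :=
  limsup (fun i => coverDMap 𝒰 ρ F δ (Sap.σ i) * ((Sap.d i : ℝ)⁻¹ : EReal)) atTop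

/-- `D_Σ(𝒰, ρ, F)`. -/
noncomputable def DSigmaF {G X : Type*} [Group G] [TopologicalSpace X] [MulAction G X]
    (Sap : SoficApprox G) (𝒰 : Finset (Set X)) (ρ : ContPseudoMetric X)
    (F : Finset G) : EReal :=
  ⨅ δ : {δ : ℝ // 0 < δ}, DSigmaFdel Sap 𝒰 ρ F δ.1

/-- `D_Σ(𝒰, ρ)`. -/
noncomputable def DSigmaU {G X : Type*} [Group G] [TopologicalSpace X] [MulAction G X]
    (Sap : SoficApprox G) (𝒰 : Finset (Set X)) (ρ : ContPseudoMetric X) : EReal :=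
  ⨅ F : {F : Finset G // F.Nonempty}, DSigmaF Sap 𝒰 ρ F.1

/-- the sofic mean topological dimension `mdim_Σ(X, ρ)`. -/
noncomputable def mdimSigma {G X : Type*} [Group G] [TopologicalSpace X] [MulAction G X]
    (Sap : SoficApprox G) (ρ : ContPseudoMetric X) : EReal :=
  ⨆ 𝒰 ∈ {𝒰 : Finset (Set X) | IsFinOpenCover 𝒰}, DSigmaU Sap 𝒰 ρ

/-- `N_ε(Y, ρ)`: the maximal cardinality of `ε`-separated subsets. -/
noncomputable def sepNum {Y : Type*} (ρ : Y → Y → ℝ) (ε : ℝ) : ℕ∞ :=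
  ⨆ E ∈ {E : Set Y | ∀ x ∈ E, ∀ y ∈ E, x ≠ y → ε ≤ ρ x y}, E.encard

/-- The extended-real logarithm of an extended natural number. -/
noncomputable def elog (n : ℕ∞) : EReal :=
  if n = ⊤ then ⊤ else if n = 0 then ⊥ else ((Real.log n.toNat : ℝ) : EReal)

/-- `log N_ε(Map(ρ,F,δ,σ), ρ_∞)`. -/
noncomputable def hCnt {G X : Type*} [Group G] [TopologicalSpace X] [MulAction G X]
    (ρ : ContPseudoMetric X) (F : Finset G) (δ : ℝ) {d : ℕ}
    (σ : G → Equiv.Perm (Fin d)) (ε : ℝ) : EReal :=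
  elog (sepNum (fun φ ψ : MapSpace ρ F δ σ => rhoInfty ρ φ.1 ψ.1) ε)

/-- `h^ε_{Σ,∞}(ρ, F, δ)`. -/
noncomputable def hEpsFdel {G X : Type*} [Group G] [TopologicalSpace X] [MulAction G X]
    (Sap : SoficApprox G) (ρ : ContPseudoMetric X) (ε : ℝ) (F : Finset G) (δ : ℝ) : EReal :=
  limsup (fun i => hCnt ρ F δ (Sap.σ i) ε * ((Sap.d i : ℝ)⁻¹ : EReal)) atTop

/-- `h^ε_{Σ,∞}(ρ)`. -/
noncomputable def hEps {G X : Type*} [Group G] [TopologicalSpace X] [MulAction G X]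
    (Sap : SoficApprox G) (ρ : ContPseudoMetric X) (ε : ℝ) : EReal :=
  ⨅ F : {F : Finset G // F.Nonempty}, ⨅ δ : {δ : ℝ // 0 < δ}, hEpsFdel Sap ρ ε F.1 δ.1

/-- The sofic mean metric dimension `mdim_{Σ,M}(X, ρ)`. -/
noncomputable def mdimSigmaM {G X : Type*} [Group G] [TopologicalSpace X] [MulAction G X]
    (Sap : SoficApprox G) (ρ : ContPseudoMetric X) : EReal :=
  liminf (fun ε : ℝ => hEps Sap ρ ε * ((|Real.log ε|⁻¹ : ℝ) : EReal)) (𝓝[>] (0 : ℝ))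

/-- The sofic mean metric dimension `mdim_{Σ,M}(X)`. -/
noncomputable def mdimSigmaMFull {G : Type*} [Group G] (Sap : SoficApprox G)
    (X : Type*) [TopologicalSpace X] [MulAction G X] : EReal :=
  ⨅ ρ : {ρ : ContPseudoMetric X // ρ.IsCompatMetric}, mdimSigmaM Sap ρ.1

/-- Følner-type characterization of amenability of a discrete group. -/
def AmenableF (G : Type*) [Group G] : Prop :=
  ∀ (K : Finset G) (ε : ℝ), 0 < ε →
    ∃ F : Finset G, F.Nonempty ∧ (((K * F) \ F).card : ℝ) < ε * F.card

/-- The set of `(K, ε)`-invariant nonempty finite subsets of `G`. -/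
noncomputable def FolnerSets {G : Type*} [Group G] (K : Finset G) (ε : ℝ) :
    Set (Finset G) :=
  {F | F.Nonempty ∧ (((K * F) \ F).card : ℝ) < ε * F.card}

/-- The cover `𝒰^F = ⋁_{s ∈ F} s⁻¹ 𝒰`. -/
noncomputable def coverJoin {G X : Type*} [Group G] [TopologicalSpace X] [MulAction G X]
    (𝒰 : Finset (Set X)) (F : Finset G) : Finset (Set X) :=
  (F.pi fun _ => 𝒰).image fun f => ⋂ s, ⋂ (h : s ∈ F), (fun x : X => s • x) ⁻¹' f s h

/-- `mdim(𝒰)` as an inf-sup over more and more invariant sets. -/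
noncomputable def mdimCoverIS {G X : Type*} [Group G] [TopologicalSpace X] [MulAction G X]
    (𝒰 : Finset (Set X)) : EReal :=
  ⨅ K : Finset G, ⨅ ε : {ε : ℝ // 0 < ε},
    ⨆ F ∈ FolnerSets K ε.1, coverD (coverJoin 𝒰 F) * ((F.card : ℝ)⁻¹ : EReal)

/-- `mdim(𝒰)` as a sup-inf over more and more invariant sets. -/
noncomputable def mdimCoverSI {G X : Type*} [Group G] [TopologicalSpace X] [MulAction G X]
    (𝒰 : Finset (Set X)) : EReal :=
  ⨆ K : Finset G, ⨆ ε : {ε : ℝ // 0 < ε},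
    ⨅ F ∈ FolnerSets K ε.1, coverD (coverJoin 𝒰 F) * ((F.card : ℝ)⁻¹ : EReal)

/-- mean topological dimension, inf-sup form. -/
noncomputable def mdimIS (G X : Type*) [Group G] [TopologicalSpace X] [MulAction G X] :
    EReal :=
  ⨆ 𝒰 ∈ {𝒰 : Finset (Set X) | IsFinOpenCover 𝒰}, mdimCoverIS (G := G) 𝒰

/-- mean topological dimension, sup-inf form. -/
noncomputable def mdimSI (G X : Type*) [Group G] [TopologicalSpace X] [MulAction G X] :
    EReal :=
  ⨆ 𝒰 ∈ {𝒰 : Finset (Set X) | IsFinOpenCover 𝒰}, mdimCoverSI (G := G) 𝒰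

/-- the pseudometric `ρ_F(x,y) = max_{s ∈ F} ρ(sx, sy)`. -/
noncomputable def rhoF {G X : Type*} [Group G] [TopologicalSpace X] [MulAction G X]
    (ρ : ContPseudoMetric X) (F : Finset G) (x y : X) : ℝ :=
  ⨆ s : F, ρ.d ((s : G) • x) ((s : G) • y)

/-- diameter of a set w.r.t. a pseudometric given as a function. -/
noncomputable def diamP {Y : Type*} (ρ : Y → Y → ℝ) (U : Set Y) : ℝ :=
  ⨆ x : U, ⨆ y : U, ρ x y

/-- mesh of a finite cover w.r.t. a pseudometric given as a function. -/
noncomputable def meshP {Y : Type*} (ρ : Y → Y → ℝ) (𝒰 : Finset (Set Y)) : ℝ :=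
  ⨆ U : 𝒰, diamP ρ U.1

/-- minimal cardinality of a finite open cover of mesh `< ε`. -/
noncomputable def minCoverCard {Y : Type*} [TopologicalSpace Y] (ρ : Y → Y → ℝ) (ε : ℝ) : ℕ :=
  sInf {n : ℕ | ∃ 𝒰 : Finset (Set Y), IsFinOpenCover 𝒰 ∧ meshP ρ 𝒰 < ε ∧ 𝒰.card = n}

/-- `S(X, ε, ρ)` in inf-sup form. -/
noncomputable def SamenIS {G X : Type*} [Group G] [TopologicalSpace X] [MulAction G X]
    (ρ : ContPseudoMetric X) (ε : ℝ) : EReal :=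
  ⨅ K : Finset G, ⨅ δ : {δ : ℝ // 0 < δ},
    ⨆ F ∈ FolnerSets K δ.1,
      ((Real.log (minCoverCard (rhoF ρ F) ε) / F.card : ℝ) : EReal)

/-- `S(X, ε, ρ)` in sup-inf form. -/
noncomputable def SamenSI {G X : Type*} [Group G] [TopologicalSpace X] [MulAction G X]
    (ρ : ContPseudoMetric X) (ε : ℝ) : EReal :=
  ⨆ K : Finset G, ⨆ δ : {δ : ℝ // 0 < δ},
    ⨅ F ∈ FolnerSets K δ.1,
      ((Real.log (minCoverCard (rhoF ρ F) ε) / F.card : ℝ) : EReal)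

/-- mean metric dimension `mdim_M(X, ρ)`, inf-sup form. -/
noncomputable def mdimMIS {G X : Type*} [Group G] [TopologicalSpace X] [MulAction G X]
    (ρ : ContPseudoMetric X) : EReal :=
  liminf (fun ε : ℝ => SamenIS (G := G) ρ ε * ((|Real.log ε|⁻¹ : ℝ) : EReal)) (𝓝[>] (0 : ℝ))

/-- mean metric dimension `mdim_M(X, ρ)`, sup-inf form. -/
noncomputable def mdimMSI {G X : Type*} [Group G] [TopologicalSpace X] [MulAction G X]
    (ρ : ContPseudoMetric X) : EReal :=
  liminf (fun ε : ℝ => SamenSI (G := G) ρ ε * ((|Real.log ε|⁻¹ : ℝ) : EReal)) (𝓝[>] (0 : ℝ))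

/-- The covering dimension of a topological space, as an extended natural number. -/
noncomputable def covDim (Y : Type*) [TopologicalSpace Y] : ℕ∞ :=
  sInf {n : ℕ∞ | ∀ 𝒰 : Finset (Set Y), IsFinOpenCover 𝒰 →
    ∃ 𝒱 : Finset (Set Y), IsFinOpenCover 𝒱 ∧ Refines 𝒱 𝒰 ∧
      ∀ y : Y, (((𝒱.filter fun V => y ∈ V).card : ℕ∞)) ≤ n + 1}

/-- conversion of extended naturals into extended reals. -/
noncomputable def enatToEReal (n : ℕ∞) : EReal :=
  if n = ⊤ then ⊤ else ((n.toNat : ℝ) : EReal)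

/-- The action of `G` on a `G`-invariant subset. -/
def invariantSubMulAction {G X : Type*} [Group G] [MulAction G X] (Y : Set X)
    (h : ∀ (s : G), ∀ x ∈ Y, s • x ∈ Y) : MulAction G Y where
  smul s y := ⟨s • (y : X), h s y y.2⟩
  one_smul y := Subtype.ext (one_smul G (y : X))
  mul_smul s t y := Subtype.ext (mul_smul s t (y : X))

end SoficMD


open Filter Topology TopologicalSpace
open scoped ENat
open scoped Classical Pointwise

namespace SoficMD

/-! ### The dimension of a cover -/

theorem coverOrd_le_natCast_iff {Y : Type*} (𝒱 : Finset (Set Y)) (n : ℕ) :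
    coverOrd 𝒱 ≤ (n : EReal) ↔ ∀ y, (𝒱.filter fun V => y ∈ V).card ≤ n + 1 := by
  have h1 : (1 : EReal) ≠ ⊥ := EReal.coe_ne_bot 1
  have h2 : (1 : EReal) ≠ ⊤ := EReal.coe_ne_top 1
  unfold coverOrd
  rw [EReal.sub_le_iff_le_add (Or.inl h1) (Or.inl h2), iSup_le_iff]
  refine forall_congr' fun y => ?_
  rw [show ((n : EReal) + 1) = (((n + 1 : ℕ) : ℝ) : EReal) by push_cast; rfl, EReal.coe_le_coe_iff,
    Nat.cast_le]

theorem natCast_le_coverOrd {Y : Type*} {𝒱 : Finset (Set Y)} {n : ℕ} {y : Y}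
    (h : n + 1 ≤ (𝒱.filter fun V => y ∈ V).card) : (n : EReal) ≤ coverOrd 𝒱 := by
  have h1 : (1 : EReal) ≠ ⊥ := EReal.coe_ne_bot 1
  have h2 : (1 : EReal) ≠ ⊤ := EReal.coe_ne_top 1
  unfold coverOrd
  rw [EReal.le_sub_iff_add_le (Or.inl h1) (Or.inl h2)]
  refine le_trans ?_ (le_iSup _ y)
  rw [show ((n : EReal) + 1) = (((n + 1 : ℕ) : ℝ) : EReal) by push_cast; rfl, EReal.coe_le_coe_iff,
    Nat.cast_le]
  exact h

theorem coverD_le_natCast_iff {Y : Type*} [TopologicalSpace Y] (𝒰 : Finset (Set Y)) (n : ℕ) :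
    coverD 𝒰 ≤ (n : EReal) ↔ ∃ 𝒱 : Finset (Set Y), IsFinOpenCover 𝒱 ∧ Refines 𝒱 𝒰 ∧
      ∀ y, (𝒱.filter fun V => y ∈ V).card ≤ n + 1 := by
  constructor
  · intro h
    have h' : coverD 𝒰 < ((n + 1 : ℕ) : EReal) :=
      lt_of_le_of_lt h (by exact_mod_cast Nat.lt_succ_self n)
    unfold coverD at h'
    simp only [iInf_lt_iff, Set.mem_ofPred_eq] at h'
    obtain ⟨𝒱, ⟨hc, hr⟩, hlt⟩ := h'
    refine ⟨𝒱, hc, hr, fun y => ?_⟩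
    by_contra hy
    exact absurd hlt (not_lt.2 (natCast_le_coverOrd (y := y) (by omega)))
  · rintro ⟨𝒱, hc, hr, h⟩
    exact le_trans (iInf₂_le 𝒱 ⟨hc, hr⟩) ((coverOrd_le_natCast_iff 𝒱 n).2 h)

theorem refines_rfl {Y : Type*} (𝒰 : Finset (Set Y)) : Refines 𝒰 𝒰 :=
  fun V hV => ⟨V, hV, subset_rfl⟩

theorem coverD_eq_natCast {Y : Type*} [TopologicalSpace Y] [Nonempty Y] {𝒰 : Finset (Set Y)}
    (h𝒰 : IsFinOpenCover 𝒰) : ∃ n : ℕ, coverD 𝒰 = n := by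
  have hex : ∃ n : ℕ, coverD 𝒰 ≤ (n : EReal) :=
    ⟨𝒰.card, (coverD_le_natCast_iff 𝒰 _).2 ⟨𝒰, h𝒰, refines_rfl 𝒰, fun y =>
      (Finset.card_filter_le _ _).trans (Nat.le_succ _)⟩⟩
  refine ⟨Nat.find hex, le_antisymm (Nat.find_spec hex) ?_⟩
  refine le_iInf₂ fun 𝒱 h𝒱 => ?_
  rcases hn : Nat.find hex with _ | m
  · obtain ⟨y⟩ := ‹Nonempty Y›
    refine natCast_le_coverOrd (y := y) ?_
    have : y ∈ ⋃ U ∈ 𝒱, U := by rw [h𝒱.1.2]; trivial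
    simp only [Set.mem_iUnion] at this
    obtain ⟨U, hU, hy⟩ := this
    exact Finset.card_pos.2 ⟨U, by simp [hU, hy]⟩
  · have := Nat.find_min hex (m := m) (by omega)
    rw [coverD_le_natCast_iff] at this
    push Not at this
    obtain ⟨y, hy⟩ := this 𝒱 h𝒱.1 h𝒱.2
    exact natCast_le_coverOrd (y := y) (by omega)

theorem coverD_eq_bot {Y : Type*} [TopologicalSpace Y] [IsEmpty Y] (𝒰 : Finset (Set Y)) :
    coverD 𝒰 = ⊥ := by
  refine le_bot_iff.1 ((iInf₂_le ∅ ⟨⟨by simp, Set.eq_univ_of_forall fun y => isEmptyElim y⟩,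
    by simp [Refines]⟩).trans ?_)
  simp [coverOrd]

/-! ### Colorings of covers -/

/-- For every color `i`, the sets `W i u` are open, pairwise disjoint, and `W i u ⊆ R u`. -/
structure IsColoring {Y ι : Type*} [TopologicalSpace Y] (R : ι → Set Y) (W : ℕ → ι → Set Y) :
    Prop where
  isOpen : ∀ i u, IsOpen (W i u)
  subset : ∀ i u, W i u ⊆ R u
  eq_of_mem : ∀ i u v y, y ∈ W i u → y ∈ W i v → u = v

/-- The number of colors below `k` which do not cover `y`. -/
noncomputable def miss {Y ι : Type*} (W : ℕ → ι → Set Y) (k : ℕ) (y : Y) : ℕ :=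
  ((Finset.range k).filter fun i => ∀ u, y ∉ W i u).card

/-- For any number of colors there is a coloring of `R` in which every point is covered by all but
at most `n` colors. -/
def Colorable {Y ι : Type*} [TopologicalSpace Y] (R : ι → Set Y) (n : ℕ) : Prop :=
  ∀ k, ∃ W : ℕ → ι → Set Y, IsColoring R W ∧ ∀ y, miss W k y ≤ n

theorem IsColoring.comap {Y Z ι : Type*} [TopologicalSpace Y] [TopologicalSpace Z]
    {R : ι → Set Y} {W : ℕ → ι → Set Y} (h : IsColoring R W) {f : Z → Y} (hf : Continuous f) :
    IsColoring (fun u => f ⁻¹' R u) (fun i u => f ⁻¹' W i u) where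
  isOpen i u := (h.isOpen i u).preimage hf
  subset i u := Set.preimage_mono (h.subset i u)
  eq_of_mem i u v y hu hv := h.eq_of_mem i u v (f y) hu hv

theorem IsColoring.pi {Y J : Type*} [TopologicalSpace Y] [Finite J] {ι : J → Type*}
    {R : ∀ j, ι j → Set Y} {W : ∀ j, ℕ → ι j → Set Y} (h : ∀ j, IsColoring (R j) (W j)) :
    IsColoring (fun u : ∀ j, ι j => ⋂ j, R j (u j)) (fun i u => ⋂ j, W j i (u j)) where
  isOpen i u := isOpen_iInter_of_finite fun j => (h j).isOpen i (u j)
  subset i u := Set.iInter_mono fun j => (h j).subset i (u j)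
  eq_of_mem i u v y hu hv := by
    rw [Set.mem_iInter] at hu hv
    exact funext fun j => (h j).eq_of_mem i _ _ y (hu j) (hv j)

theorem miss_pi_le {Y J : Type*} [Fintype J] {ι : J → Type*}
    (W : ∀ j, ℕ → ι j → Set Y) (k : ℕ) (y : Y) :
    miss (fun i (u : ∀ j, ι j) => ⋂ j, W j i (u j)) k y ≤ ∑ j, miss (W j) k y := by
  unfold miss
  refine le_trans (Finset.card_le_card ?_) Finset.card_biUnion_le
  intro i hi
  simp only [Finset.mem_filter, Set.mem_iInter, Finset.mem_biUnion, Finset.mem_univ,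
    true_and] at hi ⊢
  by_contra hcon
  push Not at hcon
  choose u hu using fun j => hcon j hi.1
  exact hi.2 u hu

theorem IsColoring.prod {Y ι κ : Type*} [TopologicalSpace Y] {R : ι → Set Y}
    {W : ℕ → ι → Set Y} {R' : κ → Set Y} {W' : ℕ → κ → Set Y} (h : IsColoring R W)
    (h' : IsColoring R' W') :
    IsColoring (fun u : ι × κ => R u.1 ∩ R' u.2) (fun i u => W i u.1 ∩ W' i u.2) where
  isOpen i u := (h.isOpen i u.1).inter (h'.isOpen i u.2)
  subset i u := Set.inter_subset_inter (h.subset i u.1) (h'.subset i u.2)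
  eq_of_mem i _ _ y hu hv :=
    Prod.ext (h.eq_of_mem i _ _ y hu.1 hv.1) (h'.eq_of_mem i _ _ y hu.2 hv.2)

theorem miss_prod_le {Y ι κ : Type*} (W : ℕ → ι → Set Y) (W' : ℕ → κ → Set Y) (k : ℕ) (y : Y) :
    miss (fun i (u : ι × κ) => W i u.1 ∩ W' i u.2) k y ≤ miss W k y + miss W' k y := by
  unfold miss
  refine le_trans (Finset.card_le_card ?_) (Finset.card_union_le _ _)
  intro i hi
  simp only [Finset.mem_filter, Finset.mem_union] at hi ⊢
  by_contra hcon
  push Not at hcon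
  obtain ⟨u, hu⟩ := hcon.1 hi.1
  obtain ⟨v, hv⟩ := hcon.2 hi.1
  exact hi.2 (u, v) ⟨hu, hv⟩

/-- A coloring with `n + 1` colors which covers everything bounds the dimension of a cover. -/
theorem coverD_le_of_isColoring {Y ι : Type*} [TopologicalSpace Y] {R : ι → Set Y}
    {W : ℕ → ι → Set Y} (h : IsColoring R W) {n : ℕ} (hmiss : ∀ y, miss W (n + 1) y ≤ n)
    {𝒰 : Finset (Set Y)} (hR : ∀ u, (R u).Nonempty → ∃ U ∈ 𝒰, R u ⊆ U) :
    coverD 𝒰 ≤ (n : EReal) := by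
  rw [coverD_le_natCast_iff]
  choose! g hg hgR using hR
  set V : ℕ × Set Y → Set Y := fun p => ⋃ u, ⋃ (_ : g u = p.2), W p.1 u with hV
  have memV : ∀ p y, y ∈ V p ↔ ∃ u, g u = p.2 ∧ y ∈ W p.1 u := by simp [hV]
  refine ⟨(Finset.range (n + 1) ×ˢ 𝒰).image V, ⟨?_, ?_⟩, ?_, fun y => ?_⟩
  · intro U hU
    obtain ⟨p, -, rfl⟩ := Finset.mem_image.1 hU
    exact isOpen_iUnion fun u => isOpen_iUnion fun _ => h.isOpen _ _
  · refine Set.eq_univ_of_forall fun y => ?_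
    have : ∃ i < n + 1, ∃ u, y ∈ W i u := by
      by_contra hcon
      push Not at hcon
      have h1 := hmiss y
      unfold miss at h1
      rw [Finset.filter_true_of_mem fun i hi => hcon i (Finset.mem_range.1 hi)] at h1
      simp at h1
    obtain ⟨i, hi, u, hu⟩ := this
    refine Set.mem_iUnion₂.2 ⟨V (i, g u), Finset.mem_image_of_mem V ?_, (memV _ _).2 ⟨u, rfl, hu⟩⟩
    exact Finset.mem_product.2 ⟨Finset.mem_range.2 hi, hg u ⟨y, h.subset _ _ hu⟩⟩
  · intro U hU
    obtain ⟨p, hp, rfl⟩ := Finset.mem_image.1 hU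
    refine ⟨p.2, (Finset.mem_product.1 hp).2, fun y hy => ?_⟩
    obtain ⟨u, hu, hy⟩ := (memV _ _).1 hy
    exact hu ▸ hgR u ⟨y, h.subset _ _ hy⟩ (h.subset _ _ hy)
  · have hsub : ((Finset.range (n + 1) ×ˢ 𝒰).image V).filter (fun U => y ∈ U) ⊆
        ((Finset.range (n + 1) ×ˢ 𝒰).filter fun p => y ∈ V p).image V := by
      intro U hU
      simp only [Finset.mem_filter, Finset.mem_image] at hU ⊢
      obtain ⟨⟨p, hp, rfl⟩, hy⟩ := hU
      exact ⟨p, ⟨hp, hy⟩, rfl⟩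
    refine (Finset.card_le_card hsub).trans (Finset.card_image_le.trans ?_)
    have : ((Finset.range (n + 1) ×ˢ 𝒰).filter fun p => y ∈ V p).card ≤
        (Finset.range (n + 1)).card := by
      refine Finset.card_le_card_of_injOn Prod.fst (fun p hp => ?_) fun p hp q hq hpq => ?_
      · simp only [Finset.coe_filter, Finset.mem_product, Set.mem_ofPred_eq] at hp
        exact hp.1.1
      · simp only [Finset.coe_filter, Set.mem_ofPred_eq, memV] at hp hq
        obtain ⟨-, u, hu, hyu⟩ := hp
        obtain ⟨-, v, hv, hyv⟩ := hq
        have huv : u = v := h.eq_of_mem p.1 u v y hyu (hpq ▸ hyv)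
        exact Prod.ext hpq (by rw [← hu, ← hv, huv])
    simpa using this

theorem isColoring_empty {Y ι : Type*} [TopologicalSpace Y] (R : ι → Set Y) :
    IsColoring R (fun _ _ => ∅) :=
  ⟨fun _ _ => isOpen_empty, fun _ _ => Set.empty_subset _, fun _ _ _ _ h => h.elim⟩

theorem miss_le {Y ι : Type*} (W : ℕ → ι → Set Y) (k : ℕ) (y : Y) : miss W k y ≤ k :=
  (Finset.card_filter_le _ _).trans (by simp)

theorem miss_le_of_mem {Y ι : Type*} {W : ℕ → ι → Set Y} {n i : ℕ} (hi : i < n + 1) {y : Y} {u : ι}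
    (hy : y ∈ W i u) : miss W (n + 1) y ≤ n := by
  refine Nat.le_of_lt_succ (lt_of_lt_of_eq (Finset.card_lt_card ?_) (Finset.card_range (n + 1)))
  exact Finset.filter_ssubset.2 ⟨i, Finset.mem_range.2 hi, fun hall => hall u hy⟩

theorem miss_succ {Y ι : Type*} (W : ℕ → ι → Set Y) (k : ℕ) (y : Y) :
    miss W (k + 1) y = miss W k y + if ∀ u, y ∉ W k u then 1 else 0 := by
  unfold miss
  rw [Finset.range_add_one, Finset.filter_insert]
  split_ifs with h
  · rw [Finset.card_insert_of_notMem (by simp)]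
  · simp

theorem miss_congr {Y ι : Type*} {W W' : ℕ → ι → Set Y} {k : ℕ} (h : ∀ i < k, W i = W' i)
    (y : Y) : miss W k y = miss W' k y := by
  unfold miss
  congr 1
  refine Finset.filter_congr fun i hi => ?_
  rw [h i (Finset.mem_range.1 hi)]

/-- Finitely many pairwise disjoint closed sets in a normal space have pairwise disjoint open
neighborhoods. -/
theorem exists_disjoint_open_neighborhoods {Y I : Type*} [TopologicalSpace Y] [NormalSpace Y]
    [Finite I] (C : I → Set Y) (hC : ∀ a, IsClosed (C a)) (hd : ∀ a b, a ≠ b → Disjoint (C a) (C b)) :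
    ∃ O : I → Set Y, (∀ a, IsOpen (O a)) ∧ (∀ a, C a ⊆ O a) ∧
      ∀ a b y, y ∈ O a → y ∈ O b → a = b := by
  have hsep : ∀ a, SeparatedNhds (C a) (⋃ b : {b // b ≠ a}, C b) := fun a =>
    normal_separation (hC a) (isClosed_iUnion_of_finite fun b => hC b)
      (Set.disjoint_iUnion_right.2 fun b => hd a b b.2.symm)
  choose A B hA hB hCA hCB hAB using hsep
  refine ⟨fun a => A a ∩ ⋂ b : {b // b ≠ a}, B b,
    fun a => (hA a).inter (isOpen_iInter_of_finite fun b => hB b),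
    fun a => Set.subset_inter (hCA a) (Set.subset_iInter fun b => ?_), fun a b y ha hb => ?_⟩
  · exact (Set.subset_iUnion (fun c : {c // c ≠ b.1} => C c) ⟨a, b.2.symm⟩).trans (hCB b)
  · by_contra hne
    exact Set.disjoint_left.1 (hAB a) ha.1 (Set.mem_iInter.1 hb.2 ⟨a, hne⟩)

/-- One more color can be added to a coloring without increasing the number of missed colors. -/
theorem IsColoring.exists_succ {Y ι : Type*} [TopologicalSpace Y] [NormalSpace Y]
    {R : ι → Set Y} {W : ℕ → ι → Set Y} (h : IsColoring R W) {n k : ℕ} (hnk : n < k)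
    (hmiss : ∀ y, miss W k y ≤ n) :
    ∃ W' : ℕ → ι → Set Y, IsColoring R W' ∧ ∀ y, miss W' (k + 1) y ≤ n := by
  let C : {I // I ∈ (Finset.range k).powersetCard n} → Set Y :=
    fun I => ⋂ i ∈ I.1, ⋂ u, (W i u)ᶜ
  have memC : ∀ I y, y ∈ C I ↔ ∀ i ∈ I.1, ∀ u, y ∉ W i u := by simp [C]
  have hCeq : ∀ I y, y ∈ C I → I.1 = (Finset.range k).filter fun i => ∀ u, y ∉ W i u := by
    intro I y hy
    rw [memC] at hy
    have hI := Finset.mem_powersetCard.1 I.2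
    refine Finset.eq_of_subset_of_card_le (fun i hi => ?_)
      ((hmiss y).trans hI.2.ge)
    exact Finset.mem_filter.2 ⟨hI.1 hi, hy i hi⟩
  obtain ⟨O, hO, hCO, hOd⟩ := exists_disjoint_open_neighborhoods C
    (fun I => isClosed_biInter fun i _ => isClosed_iInter fun u => (h.isOpen i u).isClosed_compl)
    (fun I J hIJ => Set.disjoint_left.2 fun y hy hy' =>
      hIJ (Subtype.ext ((hCeq I y hy).trans (hCeq J y hy').symm)))
  have hex : ∀ I : {I // I ∈ (Finset.range k).powersetCard n}, ∃ i ∈ Finset.range k, i ∉ I.1 := by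
    intro I
    have hI := Finset.mem_powersetCard.1 I.2
    by_contra hcon
    push Not at hcon
    have := Finset.card_le_card (show Finset.range k ⊆ I.1 from hcon)
    rw [hI.2, Finset.card_range] at this
    omega
  choose c hck hcI using hex
  let N : ι → Set Y := fun u => ⋃ I, O I ∩ W (c I) u
  refine ⟨Function.update W k N, ⟨fun i u => ?_, fun i u => ?_, fun i u v y hu hv => ?_⟩,
    fun y => ?_⟩
  · rcases eq_or_ne i k with rfl | hi
    · simpa using isOpen_iUnion fun I => (hO I).inter (h.isOpen _ u)
    · simpa [hi] using h.isOpen i u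
  · rcases eq_or_ne i k with rfl | hi
    · rw [Function.update_self]
      exact Set.iUnion_subset fun I => Set.inter_subset_right.trans (h.subset _ u)
    · simpa [hi] using h.subset i u
  · rcases eq_or_ne i k with rfl | hi
    · simp only [Function.update_self, N, Set.mem_iUnion] at hu hv
      obtain ⟨I, hI, hu⟩ := hu
      obtain ⟨J, hJ, hv⟩ := hv
      obtain rfl := hOd I J y hI hJ
      exact h.eq_of_mem _ _ _ y hu hv
    · simp only [Function.update_of_ne hi] at hu hv
      exact h.eq_of_mem _ _ _ y hu hv
  · rw [miss_succ, miss_congr (W' := W) (fun i hi => Function.update_of_ne hi.ne _ _),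
      Function.update_self]
    rcases (hmiss y).lt_or_eq with hlt | heq
    · split_ifs <;> omega
    · let I : {I // I ∈ (Finset.range k).powersetCard n} :=
        ⟨(Finset.range k).filter fun i => ∀ u, y ∉ W i u,
          Finset.mem_powersetCard.2 ⟨Finset.filter_subset _ _, heq⟩⟩
      have hyI : y ∈ C I := (memC I y).2 fun i hi => (Finset.mem_filter.1 hi).2
      have hcov : ∃ u, y ∈ W (c I) u := by
        by_contra hcon
        push Not at hcon
        exact hcI I (Finset.mem_filter.2 ⟨hck I, hcon⟩)
      obtain ⟨u, hu⟩ := hcov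
      rw [if_neg fun hall => hall u (Set.mem_iUnion.2 ⟨I, hCO I hyI, hu⟩)]
      exact hmiss y

theorem IsColoring.colorable {Y ι : Type*} [TopologicalSpace Y] [NormalSpace Y]
    {R : ι → Set Y} {W : ℕ → ι → Set Y} (h : IsColoring R W) {n : ℕ}
    (hmiss : ∀ y, miss W (n + 1) y ≤ n) : Colorable R n := by
  intro k
  rcases le_or_gt k n with hk | hk
  · exact ⟨_, isColoring_empty R, fun y => (miss_le _ _ _).trans hk⟩
  · induction k, hk using Nat.le_induction with
    | base => exact ⟨W, h, hmiss⟩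
    | succ k hk ih =>
      obtain ⟨W', h', hm⟩ := ih
      exact h'.exists_succ hk hm

/-- A cover of dimension at most `n` in a normal space is `n`-colorable. -/
theorem colorable_of_coverD_le {Y : Type*} [TopologicalSpace Y] [NormalSpace Y]
    {𝒰 : Finset (Set Y)} {n : ℕ} (h : coverD 𝒰 ≤ (n : EReal)) :
    Colorable (fun u : {U // U ∈ 𝒰} => u.1) n := by
  obtain ⟨𝒱, ⟨hopen, hcover⟩, href, hcard⟩ := (coverD_le_natCast_iff 𝒰 n).1 h
  choose r hr𝒰 hr using href
  obtain ⟨f, hf⟩ := PartitionOfUnity.exists_isSubordinate_of_locallyFinite (s := (Set.univ : Set Y)) isClosed_univ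
    (fun V : {V // V ∈ 𝒱} => V.1) (fun V => hopen V.1 V.2) (locallyFinite_of_finite _)
    (by
      intro y _
      have : y ∈ ⋃ U ∈ 𝒱, U := by rw [hcover]; trivial
      simpa using this)
  have hpos : ∀ V y, 0 < f V y → y ∈ V.1 := fun V y hy =>
    hf V (subset_tsupport _ (Function.mem_support.2 hy.ne'))
  let Z : Finset {V // V ∈ 𝒱} → Set Y :=
    fun A => {y | ∀ v ∈ A, 0 < f v y ∧ ∀ w ∉ A, f w y < f v y}
  have hZopen : ∀ A, IsOpen (Z A) := by
    intro A
    have : Z A = ⋂ v ∈ A, ({y | 0 < f v y} ∩ ⋂ w : {w // w ∉ A}, {y | f w y < f v y}) := by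
      ext y; simp [Z]
    rw [this]
    exact isOpen_biInter_finset fun v _ => (isOpen_lt continuous_const (f v).continuous).inter
      (isOpen_iInter_of_finite fun w => isOpen_lt (f w).continuous (f v).continuous)
  have hZeq : ∀ A B y, A.card = B.card → y ∈ Z A → y ∈ Z B → A = B := by
    intro A B y hAB hA hB
    by_contra hne
    have h1 : ¬ A ⊆ B := fun hs => hne (Finset.eq_of_subset_of_card_le hs hAB.ge)
    have h2 : ¬ B ⊆ A := fun hs => hne (Finset.eq_of_subset_of_card_le hs hAB.le).symm
    obtain ⟨v, hvA, hvB⟩ := Finset.not_subset.1 h1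
    obtain ⟨w, hwB, hwA⟩ := Finset.not_subset.1 h2
    exact lt_asymm ((hA v hvA).2 w hwA) ((hB w hwB).2 v hvB)
  choose p hp using fun A : {A : Finset {V // V ∈ 𝒱} // A.Nonempty} => A.2
  let W : ℕ → {U // U ∈ 𝒰} → Set Y := fun i u =>
    ⋃ A : {A : Finset {V // V ∈ 𝒱} // A.Nonempty},
      ⋃ (_ : A.1.card = i + 1 ∧ r (p A).1 (p A).2 = u.1), Z A.1
  have memW : ∀ i u y, y ∈ W i u ↔ ∃ A : {A : Finset {V // V ∈ 𝒱} // A.Nonempty},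
      (A.1.card = i + 1 ∧ r (p A).1 (p A).2 = u.1) ∧ y ∈ Z A.1 := by
    simp only [W, Set.mem_iUnion, exists_prop, implies_true]
  refine IsColoring.colorable (W := W) ⟨fun i u => isOpen_iUnion fun A => isOpen_iUnion fun _ =>
    hZopen _, fun i u y hy => ?_, fun i u v y hu hv => ?_⟩ fun y => ?_
  · obtain ⟨A, ⟨-, hu⟩, hy⟩ := (memW _ _ _).1 hy
    exact hu ▸ hr _ _ (hpos _ y (hy _ (hp A)).1)
  · obtain ⟨A, ⟨hA, hu⟩, hyA⟩ := (memW _ _ _).1 hu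
    obtain ⟨B, ⟨hB, hv⟩, hyB⟩ := (memW _ _ _).1 hv
    obtain rfl : A = B := Subtype.ext (hZeq _ _ y (hA.trans hB.symm) hyA hyB)
    exact Subtype.ext (hu.symm.trans hv)
  · let A : Finset {V // V ∈ 𝒱} := Finset.univ.filter fun v => 0 < f v y
    have hA : A.Nonempty := by
      obtain ⟨v, hv⟩ := f.exists_pos (Set.mem_univ y)
      exact ⟨v, by simpa [A] using hv⟩
    have hAcard : A.card ≤ n + 1 := by
      refine le_trans ?_ (hcard y)
      rw [← Finset.card_image_of_injective A Subtype.val_injective]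
      refine Finset.card_le_card fun V hV => ?_
      obtain ⟨v, hv, rfl⟩ := Finset.mem_image.1 hV
      exact Finset.mem_filter.2 ⟨v.2, hpos v y (Finset.mem_filter.1 hv).2⟩
    have hyA : y ∈ Z A := fun v hv => by
      have hv' := (Finset.mem_filter.1 hv).2
      refine ⟨hv', fun w hw => lt_of_le_of_lt ?_ hv'⟩
      simpa [A] using hw
    obtain ⟨i, hi⟩ : ∃ i, A.card = i + 1 := Nat.exists_eq_succ_of_ne_zero hA.card_pos.ne'
    have hcov : y ∈ W i ⟨r (p ⟨A, hA⟩).1 (p ⟨A, hA⟩).2, hr𝒰 _ _⟩ :=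
      (memW _ _ _).2 ⟨⟨A, hA⟩, ⟨hi, rfl⟩, hyA⟩
    refine miss_le_of_mem (i := i) (by omega) hcov

/-- In a coloring obtained from `W` by allowing the additional label `none` where `h < θ`, the points
with `h < θ / 2` are covered by all colors. -/
theorem IsColoring.exists_option {Y ι : Type*} [TopologicalSpace Y] {R : ι → Set Y}
    {W : ℕ → ι → Set Y} (hW : IsColoring R W) {h : Y → ℝ} (hh : Continuous h) {θ : ℝ}
    (hθ : 0 < θ) :
    ∃ W' : ℕ → Option ι → Set Y, IsColoring (fun u => u.elim {y | h y < θ} R) W' ∧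
      ∀ k y, miss W' k y ≤ miss W k y + 1 ∧ (h y < θ / 2 → miss W' k y = 0) := by
  set t : ℕ → ℝ := fun i => θ / 2 + θ / (2 * (i + 2)) with ht
  have htlow : ∀ i, θ / 2 < t i := fun i => by
    have : 0 < θ / (2 * ((i : ℝ) + 2)) := by positivity
    simp only [ht]; linarith
  have hthigh : ∀ i, t i < θ := fun i => by
    have : θ / (2 * ((i : ℝ) + 2)) < θ / 2 := by
      apply div_lt_div_of_pos_left hθ (by norm_num)
      have : (0 : ℝ) ≤ i := Nat.cast_nonneg i
      linarith
    simp only [ht]; linarith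
  have htinj : Function.Injective t := fun i j hij => by
    simp only [ht, add_right_inj] at hij
    rw [div_eq_div_iff (by positivity) (by positivity)] at hij
    have := mul_left_cancel₀ hθ.ne' hij
    exact_mod_cast (by linarith : (i : ℝ) = j)
  let W' : ℕ → Option ι → Set Y :=
    fun i u => u.elim {y | h y < t i} fun v => {y | t i < h y} ∩ W i v
  refine ⟨W', ⟨fun i u => ?_, fun i u y hy => ?_, fun i u v y hu hv => ?_⟩,
    fun k y => ⟨?_, fun hy => ?_⟩⟩
  · cases u with
    | none => exact isOpen_lt hh continuous_const
    | some v => exact (isOpen_lt continuous_const hh).inter (hW.isOpen i v)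
  · cases u with
    | none => exact lt_trans hy (hthigh i)
    | some v => exact hW.subset i v hy.2
  · cases u with
    | none =>
      cases v with
      | none => rfl
      | some v => exact (lt_asymm (show h y < t i from hu) hv.1).elim
    | some u =>
      cases v with
      | none => exact (lt_asymm (show h y < t i from hv) hu.1).elim
      | some v => exact congrArg some (hW.eq_of_mem i u v y hu.2 hv.2)
  · have hone : ((Finset.range k).filter fun i => h y = t i).card ≤ 1 :=
      Finset.card_le_one.2 fun i hi j hj =>
        htinj ((Finset.mem_filter.1 hi).2.symm.trans (Finset.mem_filter.1 hj).2)
    refine le_trans (le_trans (Finset.card_le_card ?_) (Finset.card_union_le _ _))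
      (Nat.add_le_add_left hone _)
    intro i hi
    simp only [Finset.mem_filter, Finset.mem_union] at hi ⊢
    rcases lt_trichotomy (h y) (t i) with hlt | heq | hgt
    · exact absurd hlt (hi.2 none)
    · exact Or.inr ⟨hi.1, heq⟩
    · exact Or.inl ⟨hi.1, fun u hu => hi.2 (some u) ⟨hgt, hu⟩⟩
  · refine Finset.card_eq_zero.2 (Finset.filter_eq_empty_iff.2 fun i _ hall => ?_)
    exact hall none (hy.trans (htlow i))

/-! ### Quasitilings -/

/-- The maps `σ s` for `s ∈ S` behave at the point `v` like a free action of `G`. -/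
structure IsGoodPoint {G V : Type*} [Group G] (σ : G → V → V) (S : Finset G) (v : V) : Prop where
  one : σ 1 v = v
  mul : ∀ s ∈ S, ∀ t ∈ S, σ s (σ t v) = σ (s * t) v
  inj : ∀ s ∈ S, ∀ t ∈ S, σ s v = σ t v → s = t

/-- The set `σ(F) v`. -/
noncomputable def tileAt {G V : Type*} (σ : G → V → V) (F : Finset G) (v : V) : Finset V :=
  F.image fun s => σ s v

theorem mem_tileAt {G V : Type*} {σ : G → V → V} {F : Finset G} {v w : V} :
    w ∈ tileAt σ F v ↔ ∃ s ∈ F, σ s v = w := by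
  simp [tileAt]

theorem card_tileAt_le {G V : Type*} (σ : G → V → V) (F : Finset G) (v : V) :
    (tileAt σ F v).card ≤ F.card := Finset.card_image_le

theorem IsGoodPoint.card_tileAt {G V : Type*} [Group G] {σ : G → V → V} {S F : Finset G} {v : V}
    (h : IsGoodPoint σ S v) (hF : F ⊆ S) : (tileAt σ F v).card = F.card :=
  Finset.card_image_of_injOn fun s hs t ht hst => h.inj s (hF hs) t (hF ht) hst

theorem IsGoodPoint.inv_apply {G V : Type*} [Group G] {σ : G → V → V} {S : Finset G} {v : V}
    (h : IsGoodPoint σ S v) {s : G} (hs : s ∈ S) (hs' : s⁻¹ ∈ S) : σ s⁻¹ (σ s v) = v := by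
  rw [h.mul _ hs' _ hs, inv_mul_cancel, h.one]

/-- A center at which a tile of shape `F` almost avoids the given tiles, where the tiles in `T` are
almost `F`-invariant and the tiles in `N` cover little. -/
theorem exists_almost_disjoint_center {G V τ : Type*} [Group G] [Fintype V] {σ : G → V → V}
    {S F : Finset G} {V₀ : Finset V} (hV₀ : ∀ v ∈ V₀, IsGoodPoint σ S v)
    (hFS : F ⊆ S) (hFS' : F⁻¹ ⊆ S) {η κ : ℝ} (hη : 0 < η)
    (T N : Finset τ) (shape : τ → Finset G) (c : τ → V)
    (hS : ∀ t ∈ T, shape t ⊆ S) (hc : ∀ t ∈ T, c t ∈ V₀)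
    (hinv : ∀ t ∈ T, (((F ×ˢ shape t).filter fun p => p.1⁻¹ * p.2 ∉ shape t).card : ℝ) ≤
      κ * (shape t).card)
    (hV₀card : ((V₀ᶜ).card : ℝ) ≤ η / 2 * Fintype.card V)
    (hcov : η * Fintype.card V < (((T.biUnion fun t => tileAt σ (shape t) (c t))ᶜ).card : ℝ))
    (hsmall : κ * ∑ t ∈ T, ((shape t).card : ℝ) + F.card * ∑ t ∈ N, ((shape t).card : ℝ) ≤
      η / 2 * F.card * (η / 2 * Fintype.card V)) :
    ∃ v ∈ V₀, ((F.filter fun s => σ s v ∈ (T.biUnion fun t => tileAt σ (shape t) (c t)) ∪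
      N.biUnion fun t => tileAt σ (shape t) (c t)).card : ℝ) ≤ η / 2 * F.card := by
  set B := T.biUnion fun t => tileAt σ (shape t) (c t) with hB
  set L := N.biUnion fun t => tileAt σ (shape t) (c t) with hL
  by_contra hcon
  push Not at hcon
  have hR : η / 2 * Fintype.card V < ((V₀ \ B).card : ℝ) := by
    have h1 : (Bᶜ).card ≤ (V₀ \ B).card + (V₀ᶜ).card := by
      refine (Finset.card_le_card fun v hv => ?_).trans (Finset.card_union_le _ _)
      by_cases h : v ∈ V₀ <;> simp_all
    have h2 : ((Bᶜ).card : ℝ) ≤ (V₀ \ B).card + (V₀ᶜ).card := by exact_mod_cast h1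
    linarith
  have hRpos : (0 : ℝ) < (V₀ \ B).card := lt_of_le_of_lt (by positivity) hR
  have hRne : (V₀ \ B).Nonempty := Finset.card_pos.1 (by exact_mod_cast hRpos)
  set P₁ := ((V₀ \ B) ×ˢ F).filter fun p => σ p.2 p.1 ∈ B with hP₁
  set P₂ := ((V₀ \ B) ×ˢ F).filter fun p => σ p.2 p.1 ∈ L with hP₂
  have hsum : ∑ v ∈ V₀ \ B, (F.filter fun s => σ s v ∈ B ∪ L).card ≤ P₁.card + P₂.card := by
    rw [← Finset.card_sigma]
    refine le_trans ?_ (Finset.card_union_le _ _)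
    refine Finset.card_le_card_of_injOn (fun p => (p.1, p.2)) (fun p hp => ?_) ?_
    · simp only [Finset.coe_sigma, Set.mem_sigma_iff, Finset.mem_coe, Finset.mem_filter,
        Finset.mem_union] at hp
      simp only [hP₁, hP₂, Finset.mem_coe, Finset.mem_union, Finset.mem_filter,
        Finset.mem_product]
      tauto
    · rintro ⟨v, s⟩ - ⟨w, t⟩ - h
      simpa using h
  have hlow : ∑ v ∈ V₀ \ B, η / 2 * (F.card : ℝ) <
      ∑ v ∈ V₀ \ B, ((F.filter fun s => σ s v ∈ B ∪ L).card : ℝ) :=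
    Finset.sum_lt_sum_of_nonempty hRne fun v hv => hcon v (Finset.mem_sdiff.1 hv).1
  rw [Finset.sum_const, nsmul_eq_mul] at hlow
  have hsum' : ∑ v ∈ V₀ \ B, ((F.filter fun s => σ s v ∈ B ∪ L).card : ℝ) ≤
      P₁.card + P₂.card := by exact_mod_cast hsum
  have hP₂le : (P₂.card : ℝ) ≤ F.card * ∑ t ∈ N, ((shape t).card : ℝ) := by
    have h1 : P₂.card ≤ (F ×ˢ L).card := by
      refine Finset.card_le_card_of_injOn (fun p => (p.2, σ p.2 p.1)) (fun p hp => ?_) ?_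
      · simp only [hP₂, Finset.mem_coe, Finset.mem_filter, Finset.mem_product] at hp ⊢
        tauto
      · rintro ⟨v, s⟩ hv ⟨w, t⟩ hw h
        simp only [hP₂, Finset.mem_coe, Finset.mem_filter, Finset.mem_product,
          Finset.mem_sdiff] at hv hw
        simp only [Prod.mk.injEq] at h
        obtain ⟨rfl, h⟩ := h
        have hs := hFS hv.1.2
        have hs' := hFS' (Finset.inv_mem_inv hv.1.2)
        rw [← (hV₀ v hv.1.1.1).inv_apply hs hs', h, (hV₀ w hw.1.1.1).inv_apply hs hs']
    have h2 : L.card ≤ ∑ t ∈ N, (shape t).card :=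
      Finset.card_biUnion_le.trans (Finset.sum_le_sum fun t _ => card_tileAt_le _ _ _)
    rw [Finset.card_product] at h1
    exact_mod_cast h1.trans (Nat.mul_le_mul_left _ h2)
  have hP₁le : (P₁.card : ℝ) ≤ κ * ∑ t ∈ T, ((shape t).card : ℝ) := by
    have h1 : P₁ ⊆ T.biUnion fun t =>
        ((F ×ˢ shape t).filter fun p => p.1⁻¹ * p.2 ∉ shape t).image
          fun p => (σ (p.1⁻¹ * p.2) (c t), p.1) := by
      rintro ⟨v, s⟩ hv
      simp only [hP₁, Finset.mem_filter, Finset.mem_product, Finset.mem_sdiff] at hv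
      obtain ⟨⟨⟨hv₀, hvB⟩, hs⟩, hsv⟩ := hv
      obtain ⟨t, ht, hsv⟩ := Finset.mem_biUnion.1 hsv
      obtain ⟨u, hu, hsv⟩ := mem_tileAt.1 hsv
      have hs' := hFS' (Finset.inv_mem_inv hs)
      have hv : σ (s⁻¹ * u) (c t) = v := by
        rw [← (hV₀ _ (hc t ht)).mul _ hs' _ (hS t ht hu), hsv,
          (hV₀ v hv₀).inv_apply (hFS hs) hs']
      refine Finset.mem_biUnion.2 ⟨t, ht, Finset.mem_image.2 ⟨(s, u), Finset.mem_filter.2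
        ⟨Finset.mem_product.2 ⟨hs, hu⟩, fun hmem => hvB ?_⟩, by simp [hv]⟩⟩
      exact Finset.mem_biUnion.2 ⟨t, ht, mem_tileAt.2 ⟨_, hmem, hv⟩⟩
    have h2 := (Finset.card_le_card h1).trans
      (Finset.card_biUnion_le.trans (Finset.sum_le_sum fun t _ => Finset.card_image_le))
    have h3 : (P₁.card : ℝ) ≤ ∑ t ∈ T,
        (((F ×ˢ shape t).filter fun p => p.1⁻¹ * p.2 ∉ shape t).card : ℝ) := by
      exact_mod_cast h2
    rw [Finset.mul_sum]
    exact h3.trans (Finset.sum_le_sum hinv)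
  have hfin : ((V₀ \ B).card : ℝ) * (η / 2 * F.card) < η / 2 * F.card * (η / 2 * Fintype.card V) := by
    linarith
  have : η / 2 * F.card * (η / 2 * Fintype.card V) ≤ η / 2 * F.card * ((V₀ \ B).card : ℝ) :=
    mul_le_mul_of_nonneg_left hR.le (by positivity)
  linarith

/-- A pair of tiles of the same shape, one in `V` and one in `V'`. -/
structure TilePair (G V V' : Type*) where
  center : V
  center' : V'
  shape : Finset G
  part : Finset G

/-- A simultaneous quasitiling of `V` and `V'` with shapes in `𝓕` and centers in `V₀` and `V₀'`: the
tiles become disjoint after shrinking each of them to a part of proportion at least `1 - η`. -/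
structure IsQuasitiling {G V V' : Type*} (σ : G → V → V) (σ' : G → V' → V') (V₀ : Finset V)
    (V₀' : Finset V') (η : ℝ) (𝓕 : Finset (Finset G)) (T : Finset (TilePair G V V')) : Prop where
  shape_mem : ∀ t ∈ T, t.shape ∈ 𝓕
  part_subset : ∀ t ∈ T, t.part ⊆ t.shape
  card_part : ∀ t ∈ T, (1 - η) * t.shape.card ≤ (t.part.card : ℝ)
  center_mem : ∀ t ∈ T, t.center ∈ V₀
  center_mem' : ∀ t ∈ T, t.center' ∈ V₀'
  disjoint : ∀ t ∈ T, ∀ u ∈ T, t ≠ u →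
    Disjoint (tileAt σ t.part t.center) (tileAt σ u.part u.center)
  disjoint' : ∀ t ∈ T, ∀ u ∈ T, t ≠ u →
    Disjoint (tileAt σ' t.part t.center') (tileAt σ' u.part u.center')

section

variable {G V V' : Type*} {σ : G → V → V} {σ' : G → V' → V'}
  {V₀ : Finset V} {V₀' : Finset V'} {η : ℝ} {𝓕 : Finset (Finset G)}
  {T : Finset (TilePair G V V')} {S : Finset G}

theorem IsQuasitiling.mono (h : IsQuasitiling σ σ' V₀ V₀' η 𝓕 T) {𝓕' : Finset (Finset G)}
    (h𝓕 : 𝓕 ⊆ 𝓕') : IsQuasitiling σ σ' V₀ V₀' η 𝓕' T :=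
  { h with shape_mem := fun t ht => h𝓕 (h.shape_mem t ht) }

theorem IsQuasitiling.sum_shape_le (h : IsQuasitiling σ σ' V₀ V₀' η 𝓕 T) :
    (1 - η) * ∑ t ∈ T, (t.shape.card : ℝ) ≤ ∑ t ∈ T, (t.part.card : ℝ) := by
  rw [Finset.mul_sum]
  exact Finset.sum_le_sum h.card_part

theorem IsQuasitiling.insert_tile (h : IsQuasitiling σ σ' V₀ V₀' η 𝓕 T) {t₀ : TilePair G V V'}
    (hshape : t₀.shape ∈ 𝓕) (hpart : t₀.part ⊆ t₀.shape)
    (hcard : (1 - η) * t₀.shape.card ≤ (t₀.part.card : ℝ)) (hc : t₀.center ∈ V₀)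
    (hc' : t₀.center' ∈ V₀')
    (hd : ∀ s ∈ t₀.part, σ s t₀.center ∉ T.biUnion fun t => tileAt σ t.shape t.center)
    (hd' : ∀ s ∈ t₀.part, σ' s t₀.center' ∉ T.biUnion fun t => tileAt σ' t.shape t.center') :
    IsQuasitiling σ σ' V₀ V₀' η 𝓕 (insert t₀ T) := by
  have key : ∀ t ∈ T, Disjoint (tileAt σ t₀.part t₀.center) (tileAt σ t.part t.center) := by
    refine fun t ht => Finset.disjoint_left.2 fun v hv hv' => ?_
    obtain ⟨s, hs, rfl⟩ := mem_tileAt.1 hv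
    exact hd s hs (Finset.mem_biUnion.2
      ⟨t, ht, Finset.image_subset_image (h.part_subset t ht) hv'⟩)
  have key' : ∀ t ∈ T, Disjoint (tileAt σ' t₀.part t₀.center') (tileAt σ' t.part t.center') := by
    refine fun t ht => Finset.disjoint_left.2 fun v hv hv' => ?_
    obtain ⟨s, hs, rfl⟩ := mem_tileAt.1 hv
    exact hd' s hs (Finset.mem_biUnion.2
      ⟨t, ht, Finset.image_subset_image (h.part_subset t ht) hv'⟩)
  refine ⟨?_, ?_, ?_, ?_, ?_, ?_, ?_⟩
  · exact Finset.forall_mem_insert _ _ _ |>.2 ⟨hshape, h.shape_mem⟩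
  · exact Finset.forall_mem_insert _ _ _ |>.2 ⟨hpart, h.part_subset⟩
  · exact Finset.forall_mem_insert _ _ _ |>.2 ⟨hcard, h.card_part⟩
  · exact Finset.forall_mem_insert _ _ _ |>.2 ⟨hc, h.center_mem⟩
  · exact Finset.forall_mem_insert _ _ _ |>.2 ⟨hc', h.center_mem'⟩
  · intro t ht u hu htu
    rcases Finset.mem_insert.1 ht with ht | ht <;> rcases Finset.mem_insert.1 hu with hu | hu
    · exact absurd (ht.trans hu.symm) htu
    · exact ht ▸ key u hu
    · exact hu ▸ (key t ht).symm
    · exact h.disjoint t ht u hu htu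
  · intro t ht u hu htu
    rcases Finset.mem_insert.1 ht with ht | ht <;> rcases Finset.mem_insert.1 hu with hu | hu
    · exact absurd (ht.trans hu.symm) htu
    · exact ht ▸ key' u hu
    · exact hu ▸ (key' t ht).symm
    · exact h.disjoint' t ht u hu htu

variable [Group G]

theorem IsQuasitiling.card_biUnion (h : IsQuasitiling σ σ' V₀ V₀' η 𝓕 T)
    (hV₀ : ∀ v ∈ V₀, IsGoodPoint σ S v) (h𝓕 : ∀ F ∈ 𝓕, F ⊆ S) :
    (T.biUnion fun t => tileAt σ t.part t.center).card = ∑ t ∈ T, t.part.card := by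
  rw [Finset.card_biUnion fun t ht u hu htu => h.disjoint t ht u hu htu]
  exact Finset.sum_congr rfl fun t ht => (hV₀ _ (h.center_mem t ht)).card_tileAt
    ((h.part_subset t ht).trans (h𝓕 _ (h.shape_mem t ht)))

theorem IsQuasitiling.card_biUnion' (h : IsQuasitiling σ σ' V₀ V₀' η 𝓕 T)
    (hV₀' : ∀ v ∈ V₀', IsGoodPoint σ' S v) (h𝓕 : ∀ F ∈ 𝓕, F ⊆ S) :
    (T.biUnion fun t => tileAt σ' t.part t.center').card = ∑ t ∈ T, t.part.card := by
  rw [Finset.card_biUnion fun t ht u hu htu => h.disjoint' t ht u hu htu]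
  exact Finset.sum_congr rfl fun t ht => (hV₀' _ (h.center_mem' t ht)).card_tileAt
    ((h.part_subset t ht).trans (h𝓕 _ (h.shape_mem t ht)))

theorem IsQuasitiling.exists_support (h : IsQuasitiling σ σ' V₀ V₀' η 𝓕 T)
    (hV₀ : ∀ v ∈ V₀, IsGoodPoint σ S v) (h𝓕 : ∀ F ∈ 𝓕, F ⊆ S) :
    ∃ A : Finset V, (∀ a, a ∈ A ↔ ∃ t ∈ T, ∃ s ∈ t.part, σ s t.center = a) ∧
      A.card = ∑ t ∈ T, t.part.card :=
  ⟨_, fun a => by simp [mem_tileAt], h.card_biUnion hV₀ h𝓕⟩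

variable [Fintype V] [Fintype V']

theorem IsQuasitiling.sum_le_min (h : IsQuasitiling σ σ' V₀ V₀' η 𝓕 T)
    (hV₀ : ∀ v ∈ V₀, IsGoodPoint σ S v) (hV₀' : ∀ v ∈ V₀', IsGoodPoint σ' S v)
    (h𝓕 : ∀ F ∈ 𝓕, F ⊆ S) :
    ∑ t ∈ T, t.part.card ≤ min (Fintype.card V) (Fintype.card V') :=
  le_min (h.card_biUnion hV₀ h𝓕 ▸ Finset.card_le_univ _)
    (h.card_biUnion' hV₀' h𝓕 ▸ Finset.card_le_univ _)

theorem le_two_mul_of_mul_le {η a b : ℝ} (hη : η ≤ 1 / 2) (ha : 0 ≤ a) (h : (1 - η) * a ≤ b) :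
    a ≤ 2 * b := by
  nlinarith

theorem tile_sum_bound {η m M f a b : ℝ} (hη : 0 < η) (hm : 0 ≤ m) (hf : 1 ≤ f) (ha : a ≤ 2 * m)
    (hb : b ≤ 2 * (η ^ 2 / 16 * m)) (hM : m ≤ M) :
    η ^ 2 / 16 * a + f * b ≤ η / 2 * f * (η / 2 * M) := by
  calc η ^ 2 / 16 * a + f * b ≤ η ^ 2 / 16 * (2 * m) + f * (2 * (η ^ 2 / 16 * m)) := by gcongr
    _ ≤ f * (η ^ 2 / 16 * (2 * m)) + f * (2 * (η ^ 2 / 16 * m)) := by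
      have : 0 ≤ η ^ 2 / 16 * (2 * m) := by positivity
      nlinarith
    _ = η / 2 * f * (η / 2 * m) := by ring
    _ ≤ _ := by gcongr

/-- A quasitiling which covers neither `V` nor `V'` almost completely can be enlarged by a definite
proportion with tiles of a shape `F` for which the previous shapes are almost invariant. -/
theorem IsQuasitiling.exists_enlarge (h : IsQuasitiling σ σ' V₀ V₀' η 𝓕 T)
    (hη : 0 < η) (hη' : η ≤ 1 / 2)
    (hV₀ : ∀ v ∈ V₀, IsGoodPoint σ S v) (hV₀' : ∀ v ∈ V₀', IsGoodPoint σ' S v)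
    (h𝓕 : ∀ F ∈ 𝓕, F ⊆ S) {F : Finset G} (hFne : F.Nonempty) (hFS : F ⊆ S) (hFS' : F⁻¹ ⊆ S)
    (hinv : ∀ E ∈ 𝓕, (((F ×ˢ E).filter fun p => p.1⁻¹ * p.2 ∉ E).card : ℝ) ≤
      η ^ 2 / 16 * E.card)
    (hcard : ((V₀ᶜ).card : ℝ) ≤ η / 2 * Fintype.card V)
    (hcard' : ((V₀'ᶜ).card : ℝ) ≤ η / 2 * Fintype.card V')
    (hcov : η * Fintype.card V <
      (((T.biUnion fun t => tileAt σ t.shape t.center)ᶜ).card : ℝ))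
    (hcov' : η * Fintype.card V' <
      (((T.biUnion fun t => tileAt σ' t.shape t.center')ᶜ).card : ℝ)) :
    ∃ T', IsQuasitiling σ σ' V₀ V₀' η (insert F 𝓕) T' ∧
      ∑ t ∈ T, (t.part.card : ℝ) + η ^ 2 / 16 * min (Fintype.card V : ℝ) (Fintype.card V') ≤
        ∑ t ∈ T', (t.part.card : ℝ) := by
  set m : ℝ := min (Fintype.card V : ℝ) (Fintype.card V') with hm
  have hFpos : (1 : ℝ) ≤ F.card := by exact_mod_cast hFne.card_pos
  have h𝓕' : ∀ E ∈ insert F 𝓕, E ⊆ S := Finset.forall_mem_insert _ _ _ |>.2 ⟨hFS, h𝓕⟩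
  have claim : ∀ n : ℕ, ∃ N : Finset (TilePair G V V'), Disjoint T N ∧
      IsQuasitiling σ σ' V₀ V₀' η (insert F 𝓕) (T ∪ N) ∧
      (n ≤ ∑ t ∈ N, t.part.card ∨ η ^ 2 / 16 * m ≤ ∑ t ∈ N, (t.part.card : ℝ)) := by
    intro n
    induction n with
    | zero => exact ⟨∅, by simp, by simpa using h.mono (Finset.subset_insert _ _), by simp⟩
    | succ n ih =>
      obtain ⟨N, hTN, hN, hn⟩ := ih
      rcases le_or_gt (η ^ 2 / 16 * m) (∑ t ∈ N, (t.part.card : ℝ)) with hle | hlt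
      · exact ⟨N, hTN, hN, Or.inr hle⟩
      replace hn := hn.resolve_right (not_le.2 hlt)
      have hTle : ∑ t ∈ T, (t.part.card : ℝ) ≤ m := by
        have := h.sum_le_min hV₀ hV₀' h𝓕
        rw [hm]
        exact_mod_cast this
      have hTshape : ∑ t ∈ T, (t.shape.card : ℝ) ≤ 2 * m := by
        exact (le_two_mul_of_mul_le hη' (Finset.sum_nonneg fun _ _ => Nat.cast_nonneg _)
          h.sum_shape_le).trans (mul_le_mul_of_nonneg_left hTle zero_le_two)
      have hNshape : ∑ t ∈ N, (t.shape.card : ℝ) ≤ 2 * (η ^ 2 / 16 * m) := by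
        have h1 : (1 - η) * ∑ t ∈ N, (t.shape.card : ℝ) ≤ ∑ t ∈ N, (t.part.card : ℝ) := by
          rw [Finset.mul_sum]
          exact Finset.sum_le_sum fun t ht => hN.card_part t (Finset.mem_union_right _ ht)
        exact (le_two_mul_of_mul_le hη' (Finset.sum_nonneg fun _ _ => Nat.cast_nonneg _)
          h1).trans (mul_le_mul_of_nonneg_left hlt.le zero_le_two)
      have hm0 : 0 ≤ m := le_min (Nat.cast_nonneg _) (Nat.cast_nonneg _)
      have hsmall : ∀ M : ℝ, m ≤ M → η ^ 2 / 16 * ∑ t ∈ T, (t.shape.card : ℝ) +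
          F.card * ∑ t ∈ N, (t.shape.card : ℝ) ≤ η / 2 * F.card * (η / 2 * M) := by
        exact fun M hM => tile_sum_bound hη hm0 hFpos hTshape hNshape hM
      obtain ⟨v, hv, hvF⟩ := exists_almost_disjoint_center hV₀ hFS hFS' hη T N
        TilePair.shape TilePair.center (fun t ht => h𝓕 _ (h.shape_mem t ht)) h.center_mem
        (fun t ht => hinv _ (h.shape_mem t ht)) hcard hcov (hsmall _ (min_le_left _ _))
      obtain ⟨v', hv', hvF'⟩ := exists_almost_disjoint_center hV₀' hFS hFS' hη T N
        TilePair.shape TilePair.center' (fun t ht => h𝓕 _ (h.shape_mem t ht)) h.center_mem'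
        (fun t ht => hinv _ (h.shape_mem t ht)) hcard' hcov' (hsmall _ (min_le_right _ _))
      rw [← Finset.union_biUnion] at hvF hvF'
      set B := (T ∪ N).biUnion fun t => tileAt σ t.shape t.center with hB
      set B' := (T ∪ N).biUnion fun t => tileAt σ' t.shape t.center' with hB'
      set E := F.filter fun s => σ s v ∉ B ∧ σ' s v' ∉ B' with hE
      have hEcard : (1 - η) * F.card ≤ (E.card : ℝ) := by
        have h1 : F.card ≤ E.card + ((F.filter fun s => σ s v ∈ B).card +
            (F.filter fun s => σ' s v' ∈ B').card) := by
          refine le_trans (Finset.card_le_card fun s hs => ?_) ((Finset.card_union_le E _).trans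
            (Nat.add_le_add_left (Finset.card_union_le _ _) _))
          simp only [hE, Finset.mem_union, Finset.mem_filter, hs, true_and]
          tauto
        have h2 : (F.card : ℝ) ≤ E.card + ((F.filter fun s => σ s v ∈ B).card +
            (F.filter fun s => σ' s v' ∈ B').card) := by exact_mod_cast h1
        linarith
      have hEne : E.Nonempty := by
        rw [← Finset.card_pos]
        have : (0 : ℝ) < E.card := lt_of_lt_of_le (by nlinarith) hEcard
        exact_mod_cast this
      have hnew := hN.insert_tile (t₀ := ⟨v, v', F, E⟩) (Finset.mem_insert_self _ _)
        (Finset.filter_subset _ _) hEcard hv hv' (fun s hs => (Finset.mem_filter.1 hs).2.1)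
        (fun s hs => (Finset.mem_filter.1 hs).2.2)
      have hnot : (⟨v, v', F, E⟩ : TilePair G V V') ∉ T ∪ N := by
        intro hmem
        obtain ⟨s, hs⟩ := hEne
        exact (Finset.mem_filter.1 hs).2.1 (Finset.mem_biUnion.2
          ⟨_, hmem, mem_tileAt.2 ⟨s, (Finset.mem_filter.1 hs).1, rfl⟩⟩)
      rw [Finset.mem_union, not_or] at hnot
      refine ⟨insert ⟨v, v', F, E⟩ N, ?_, ?_, Or.inl ?_⟩
      · exact Finset.disjoint_insert_right.2 ⟨hnot.1, hTN⟩
      · rwa [Finset.union_insert]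
      · rw [Finset.sum_insert hnot.2]
        have : 0 < E.card := hEne.card_pos
        simp only
        omega
  obtain ⟨N, hTN, hN, hn⟩ := claim (Fintype.card V + 1)
  refine ⟨T ∪ N, hN, ?_⟩
  rw [Finset.sum_union hTN, add_le_add_iff_left]
  refine hn.resolve_left fun hn => ?_
  have h1 := (hN.sum_le_min hV₀ hV₀' h𝓕').trans (min_le_left _ _)
  rw [Finset.sum_union hTN] at h1
  omega

theorem IsQuasitiling.exists_enlarge_of_sum_lt (h : IsQuasitiling σ σ' V₀ V₀' η 𝓕 T)
    (hη : 0 < η) (hη' : η ≤ 1 / 2)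
    (hV₀ : ∀ v ∈ V₀, IsGoodPoint σ S v) (hV₀' : ∀ v ∈ V₀', IsGoodPoint σ' S v)
    (h𝓕 : ∀ F ∈ 𝓕, F ⊆ S) {F : Finset G} (hFne : F.Nonempty) (hFS : F ⊆ S) (hFS' : F⁻¹ ⊆ S)
    (hinv : ∀ E ∈ 𝓕, (((F ×ˢ E).filter fun p => p.1⁻¹ * p.2 ∉ E).card : ℝ) ≤
      η ^ 2 / 16 * E.card)
    (hcard : ((V₀ᶜ).card : ℝ) ≤ η / 2 * Fintype.card V)
    (hcard' : ((V₀'ᶜ).card : ℝ) ≤ η / 2 * Fintype.card V')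
    (hsum : ∑ t ∈ T, (t.part.card : ℝ) <
      (1 - η) ^ 2 * min (Fintype.card V : ℝ) (Fintype.card V')) :
    ∃ T', IsQuasitiling σ σ' V₀ V₀' η (insert F 𝓕) T' ∧
      ∑ t ∈ T, (t.part.card : ℝ) + η ^ 2 / 16 * min (Fintype.card V : ℝ) (Fintype.card V') ≤
        ∑ t ∈ T', (t.part.card : ℝ) := by
  have hshape := h.sum_shape_le
  have key : ∀ M b : ℝ, min (Fintype.card V : ℝ) (Fintype.card V') ≤ M →
      b ≤ ∑ t ∈ T, (t.shape.card : ℝ) → η * M < M - b := by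
    intro M b hM hb
    by_contra hcon
    have h1 : (1 - η) * M ≤ b := by linarith
    have h2 : (1 - η) ^ 2 * min (Fintype.card V : ℝ) (Fintype.card V') ≤
        (1 - η) * ∑ t ∈ T, (t.shape.card : ℝ) := by
      rw [sq, mul_assoc]
      refine mul_le_mul_of_nonneg_left ?_ (by linarith)
      exact (mul_le_mul_of_nonneg_left hM (by linarith)).trans (h1.trans hb)
    linarith
  refine h.exists_enlarge hη hη' hV₀ hV₀' h𝓕 hFne hFS hFS' hinv hcard hcard' ?_ ?_
  · rw [Finset.card_compl, Nat.cast_sub (Finset.card_le_univ _)]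
    refine key _ _ (min_le_left _ _) ?_
    exact_mod_cast Finset.card_biUnion_le.trans
      (Finset.sum_le_sum fun t _ => card_tileAt_le σ (TilePair.shape t) (TilePair.center t))
  · rw [Finset.card_compl, Nat.cast_sub (Finset.card_le_univ _)]
    refine key _ _ (min_le_right _ _) ?_
    exact_mod_cast Finset.card_biUnion_le.trans
      (Finset.sum_le_sum fun t _ => card_tileAt_le σ' (TilePair.shape t) (TilePair.center' t))

end

/-- A sequence of Følner sets, each of which is almost invariant with respect to the previous
ones. -/
theorem exists_folner_seq {G : Type*} [Group G] (hG : AmenableF G) (K : Finset G) {ε κ : ℝ}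
    (hε : 0 < ε) (hκ : 0 < κ) :
    ∃ Φ : ℕ → Finset G, (∀ n, Φ n ∈ FolnerSets K ε) ∧ ∀ k n, k < n →
      (((Φ k ×ˢ Φ n).filter fun p => p.1⁻¹ * p.2 ∉ Φ n).card : ℝ) ≤ κ * (Φ n).card := by
  refine exists_seq_of_forall_finset_exists (fun F => F ∈ FolnerSets K ε)
    (fun E F => (((E ×ˢ F).filter fun p => p.1⁻¹ * p.2 ∉ F).card : ℝ) ≤ κ * F.card)
    fun 𝓔 _ => ?_
  set A : Finset G := 𝓔.biUnion id with hA
  set ε' : ℝ := min ε (κ / (A.card + 1)) with hε'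
  have hε'pos : 0 < ε' := lt_min hε (by positivity)
  obtain ⟨F, hF, hFK⟩ := hG (K ∪ A⁻¹) ε' hε'pos
  refine ⟨F, ⟨hF, ?_⟩, fun E hE => ?_⟩
  · refine lt_of_le_of_lt ?_ (hFK.trans_le (by gcongr; exact min_le_left _ _))
    exact_mod_cast Finset.card_le_card (Finset.sdiff_subset_sdiff
      (Finset.mul_subset_mul_right Finset.subset_union_left) subset_rfl)
  · have hEA : E ⊆ A := Finset.subset_biUnion_of_mem id hE
    have h1 : ((E ×ˢ F).filter fun p => p.1⁻¹ * p.2 ∉ F).card ≤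
        (E ×ˢ (((K ∪ A⁻¹) * F) \ F)).card := by
      refine Finset.card_le_card_of_injOn (fun p => (p.1, p.1⁻¹ * p.2)) (fun p hp => ?_) ?_
      · simp only [Finset.mem_coe, Finset.mem_filter, Finset.mem_product, Finset.mem_sdiff] at hp ⊢
        exact ⟨hp.1.1, Finset.mul_mem_mul (Finset.mem_union_right _
          (Finset.inv_mem_inv (hEA hp.1.1))) hp.1.2, hp.2⟩
      · rintro ⟨a, b⟩ - ⟨a', b'⟩ - h
        simp only [Prod.mk.injEq] at h
        obtain ⟨rfl, h⟩ := h
        simpa using h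
    have h2 : (E.card : ℝ) ≤ A.card + 1 := by
      have : E.card ≤ A.card := Finset.card_le_card hEA
      exact_mod_cast this.trans (Nat.le_succ _)
    rw [Finset.card_product] at h1
    calc (((E ×ˢ F).filter fun p => p.1⁻¹ * p.2 ∉ F).card : ℝ)
        ≤ E.card * ((((K ∪ A⁻¹) * F) \ F).card : ℝ) := by exact_mod_cast h1
      _ ≤ (A.card + 1) * (κ / (A.card + 1) * F.card) := by
        gcongr
        exact hFK.le.trans (by gcongr; exact min_le_right _ _)
      _ = κ * F.card := by field_simp

/-- **Simultaneous quasitilings.** Finite sets on which an amenable group almost acts freely have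
quasitilings by Følner sets, and any two of them have quasitilings with corresponding tiles. -/
theorem exists_quasitiling {G : Type*} [Group G] (hG : AmenableF G) {η : ℝ} (hη : 0 < η)
    (hη' : η ≤ 1 / 2) (K S₀ : Finset G) {ε : ℝ} (hε : 0 < ε) :
    ∃ (𝓕 : Finset (Finset G)) (S : Finset G), S₀ ⊆ S ∧ (∀ F ∈ 𝓕, F ∈ FolnerSets K ε ∧ F ⊆ S) ∧
      ∀ {V : Type*} {V' : Type*} [Fintype V] [Fintype V'] (σ : G → V → V) (σ' : G → V' → V')
        (V₀ : Finset V) (V₀' : Finset V'), (∀ v ∈ V₀, IsGoodPoint σ S v) →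
        (∀ v ∈ V₀', IsGoodPoint σ' S v) → ((V₀ᶜ).card : ℝ) ≤ η / 2 * Fintype.card V →
        ((V₀'ᶜ).card : ℝ) ≤ η / 2 * Fintype.card V' →
        ∃ T : Finset (TilePair G V V'), IsQuasitiling σ σ' V₀ V₀' η 𝓕 T ∧
          (1 - η) ^ 2 * min (Fintype.card V : ℝ) (Fintype.card V') ≤
            ∑ t ∈ T, (t.part.card : ℝ) := by
  obtain ⟨Φ, hΦ, hΦinv⟩ := exists_folner_seq hG K hε (κ := η ^ 2 / 16) (by positivity)
  obtain ⟨l, hl⟩ := exists_nat_gt (16 / η ^ 2)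
  set S := S₀ ∪ (Finset.range l).biUnion fun n => Φ n ∪ (Φ n)⁻¹ with hS
  have hΦS : ∀ n < l, Φ n ∪ (Φ n)⁻¹ ⊆ S := fun n hn =>
    (Finset.subset_biUnion_of_mem (fun n => Φ n ∪ (Φ n)⁻¹) (Finset.mem_range.2 hn)).trans
      Finset.subset_union_right
  refine ⟨(Finset.range l).image Φ, S, Finset.subset_union_left, ?_, ?_⟩
  · intro F hF
    obtain ⟨n, hn, rfl⟩ := Finset.mem_image.1 hF
    exact ⟨hΦ n, Finset.subset_union_left.trans (hΦS n (Finset.mem_range.1 hn))⟩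
  intro V V' _ _ σ σ' V₀ V₀' hV₀ hV₀' hcard hcard'
  set m : ℝ := min (Fintype.card V : ℝ) (Fintype.card V') with hm
  have hm0 : 0 ≤ m := le_min (Nat.cast_nonneg _) (Nat.cast_nonneg _)
  have h𝓕 : ∀ F ∈ (Finset.range l).image Φ, F ⊆ S := by
    intro F hF
    obtain ⟨n, hn, rfl⟩ := Finset.mem_image.1 hF
    exact Finset.subset_union_left.trans (hΦS n (Finset.mem_range.1 hn))
  have claim : ∀ j ≤ l, ∃ T : Finset (TilePair G V V'),
      IsQuasitiling σ σ' V₀ V₀' η ((Finset.Ico (l - j) l).image Φ) T ∧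
      ((1 - η) ^ 2 * m ≤ ∑ t ∈ T, (t.part.card : ℝ) ∨
        j * (η ^ 2 / 16 * m) ≤ ∑ t ∈ T, (t.part.card : ℝ)) := by
    intro j
    induction j with
    | zero =>
      intro _
      exact ⟨∅, ⟨by simp, by simp, by simp, by simp, by simp, by simp, by simp⟩, Or.inr (by simp)⟩
    | succ j ih =>
      intro hj
      obtain ⟨T, hT, hTcard⟩ := ih (by omega)
      have himage : insert (Φ (l - (j + 1))) ((Finset.Ico (l - j) l).image Φ) =
          (Finset.Ico (l - (j + 1)) l).image Φ := by
        rw [← Finset.image_insert]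
        congr 1
        ext x
        simp only [Finset.mem_insert, Finset.mem_Ico]
        omega
      by_cases hdone : (1 - η) ^ 2 * m ≤ ∑ t ∈ T, (t.part.card : ℝ)
      · exact ⟨T, himage ▸ hT.mono (Finset.subset_insert _ _), Or.inl hdone⟩
      obtain ⟨T', hT', hsum⟩ := hT.exists_enlarge_of_sum_lt hη hη' hV₀ hV₀'
        (fun F hF => h𝓕 F (Finset.image_subset_image (fun x hx => by
          simp only [Finset.mem_Ico, Finset.mem_range] at hx ⊢; omega) hF))
        (F := Φ (l - (j + 1))) (hΦ _).1
        (Finset.subset_union_left.trans (hΦS _ (by omega)))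
        (Finset.subset_union_right.trans (hΦS _ (by omega)))
        (fun E hE => by
          obtain ⟨n, hn, rfl⟩ := Finset.mem_image.1 hE
          exact hΦinv _ _ (by rw [Finset.mem_Ico] at hn; omega)) hcard hcard' (not_le.1 hdone)
      refine ⟨T', himage ▸ hT', Or.inr ?_⟩
      have := hTcard.resolve_left hdone
      push_cast
      linarith
  obtain ⟨T, hT, hTcard⟩ := claim l le_rfl
  rw [Nat.sub_self, ← Finset.range_eq_Ico] at hT
  refine ⟨T, hT, hTcard.elim id fun hle => ?_⟩
  have hmin : ∑ t ∈ T, (t.part.card : ℝ) ≤ m := by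
    have := hT.sum_le_min hV₀ hV₀' h𝓕
    rw [hm]
    exact_mod_cast this
  have hone : 1 < l * (η ^ 2 / 16) := by
    rw [div_lt_iff₀ (by positivity)] at hl
    linarith
  have : m = 0 := by nlinarith
  rw [this, mul_zero]
  exact Finset.sum_nonneg fun _ _ => Nat.cast_nonneg _

/-! ### Sofic approximations and approximately equivariant maps -/

theorem SoficApprox.eventually_pos {G : Type*} [Group G] (Sap : SoficApprox G) :
    ∀ᶠ i in atTop, 0 < Sap.d i :=
  Sap.d_tendsto.eventually_gt_atTop 0

theorem SoficApprox.eventually_card_not_mul_le {G : Type*} [Group G] (Sap : SoficApprox G)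
    (s t : G) {c : ℝ} (hc : 0 < c) :
    ∀ᶠ i in atTop, ((Finset.univ.filter fun a : Fin (Sap.d i) =>
      ¬ Sap.σ i s (Sap.σ i t a) = Sap.σ i (s * t) a).card : ℝ) ≤ c * Sap.d i := by
  filter_upwards [(Sap.approx_mul s t).eventually (lt_mem_nhds (show (1 : ℝ) - c < 1 by linarith)),
    Sap.eventually_pos] with i hi hd
  have hd' : (0 : ℝ) < Sap.d i := by exact_mod_cast hd
  rw [lt_div_iff₀ hd'] at hi
  have h1 := Finset.card_filter_add_card_filter_not (s := (Finset.univ : Finset (Fin (Sap.d i))))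
    (fun a => Sap.σ i s (Sap.σ i t a) = Sap.σ i (s * t) a)
  rw [Finset.card_univ, Fintype.card_fin] at h1
  have h2 : ((Finset.univ.filter fun a : Fin (Sap.d i) =>
      Sap.σ i s (Sap.σ i t a) = Sap.σ i (s * t) a).card : ℝ) +
      ((Finset.univ.filter fun a : Fin (Sap.d i) =>
      ¬ Sap.σ i s (Sap.σ i t a) = Sap.σ i (s * t) a).card : ℝ) = Sap.d i := by exact_mod_cast h1
  linarith

theorem SoficApprox.eventually_card_eq_le {G : Type*} [Group G] (Sap : SoficApprox G)
    {s t : G} (hst : s ≠ t) {c : ℝ} (hc : 0 < c) :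
    ∀ᶠ i in atTop, ((Finset.univ.filter fun a : Fin (Sap.d i) =>
      Sap.σ i s a = Sap.σ i t a).card : ℝ) ≤ c * Sap.d i := by
  filter_upwards [(Sap.approx_sep s t hst).eventually (gt_mem_nhds hc),
    Sap.eventually_pos] with i hi hd
  have hd' : (0 : ℝ) < Sap.d i := by exact_mod_cast hd
  rw [div_lt_iff₀ hd'] at hi
  exact hi.le

/-- In a sofic approximation almost all points are good. -/
theorem SoficApprox.eventually_exists_goodPoints {G : Type*} [Group G] (Sap : SoficApprox G)
    (S : Finset G) {c : ℝ} (hc : 0 < c) :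
    ∀ᶠ i in atTop, ∃ V₀ : Finset (Fin (Sap.d i)),
      (∀ v ∈ V₀, IsGoodPoint (fun s a => Sap.σ i s a) S v) ∧
      ((V₀ᶜ).card : ℝ) ≤ c * Sap.d i := by
  set P := insert 1 S ×ˢ insert 1 S with hP
  set B : ∀ i, G × G → Finset (Fin (Sap.d i)) := fun i p =>
    (Finset.univ.filter fun a => ¬ Sap.σ i p.1 (Sap.σ i p.2 a) = Sap.σ i (p.1 * p.2) a) ∪
      Finset.univ.filter fun a => p.1 ≠ p.2 ∧ Sap.σ i p.1 a = Sap.σ i p.2 a with hB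
  have hPpos : (0 : ℝ) < P.card := by
    have : P.Nonempty := ⟨(1, 1), by simp [hP]⟩
    exact_mod_cast this.card_pos
  have hc' : 0 < c / P.card / 2 := by positivity
  have hev : ∀ p ∈ P, ∀ᶠ i in atTop, ((B i p).card : ℝ) ≤ c / P.card * Sap.d i := by
    rintro p -
    have h2 : ∀ᶠ i in atTop, ((Finset.univ.filter fun a : Fin (Sap.d i) =>
        p.1 ≠ p.2 ∧ Sap.σ i p.1 a = Sap.σ i p.2 a).card : ℝ) ≤ c / P.card / 2 * Sap.d i := by
      by_cases h : p.1 = p.2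
      · refine Eventually.of_forall fun i => ?_
        simp only [h, ne_eq, not_true_eq_false, false_and, Finset.filter_false, Finset.card_empty,
          Nat.cast_zero]
        positivity
      · filter_upwards [Sap.eventually_card_eq_le h hc'] with i hi
        simpa [h] using hi
    filter_upwards [Sap.eventually_card_not_mul_le p.1 p.2 hc', h2] with i h1 h2
    have h3 : ((B i p).card : ℝ) ≤ _ := Nat.cast_le.2 (Finset.card_union_le _ _)
    push_cast at h3
    linarith
  filter_upwards [(Finset.eventually_all P).2 hev] with i hi
  refine ⟨(P.biUnion (B i))ᶜ, fun v hv => ?_, ?_⟩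
  · have hv' : ∀ s ∈ insert 1 S, ∀ t ∈ insert 1 S,
        Sap.σ i s (Sap.σ i t v) = Sap.σ i (s * t) v ∧ (Sap.σ i s v = Sap.σ i t v → s = t) := by
      intro s hs t ht
      simp only [Finset.mem_compl, Finset.mem_biUnion, not_exists, not_and] at hv
      have := hv (s, t) (Finset.mk_mem_product hs ht)
      simp only [hB, Finset.mem_union, Finset.mem_filter, Finset.mem_univ, true_and] at this
      tauto
    refine ⟨?_, fun s hs t ht => (hv' s (Finset.mem_insert_of_mem hs) t
      (Finset.mem_insert_of_mem ht)).1, fun s hs t ht => (hv' s (Finset.mem_insert_of_mem hs) t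
      (Finset.mem_insert_of_mem ht)).2⟩
    have h1 := (hv' 1 (Finset.mem_insert_self _ _) 1 (Finset.mem_insert_self _ _)).1
    rw [mul_one] at h1
    exact (Sap.σ i 1).injective h1
  · rw [compl_compl]
    calc ((P.biUnion (B i)).card : ℝ) ≤ ∑ p ∈ P, ((B i p).card : ℝ) := by
          exact_mod_cast Finset.card_biUnion_le
      _ ≤ ∑ p ∈ P, c / P.card * Sap.d i := Finset.sum_le_sum hi
      _ = c * Sap.d i := by
        rw [Finset.sum_const, nsmul_eq_mul]
        field_simp

/-- A Lebesgue number lemma: a finite open cover has a finite open refinement with uniform room. -/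
theorem exists_cover_thickening {X : Type*} [TopologicalSpace X] [CompactSpace X]
    {ρ : ContPseudoMetric X} (hρ : ρ.IsCompatMetric) {𝒰 : Finset (Set X)}
    (h𝒰 : IsFinOpenCover 𝒰) :
    ∃ θ > 0, ∃ 𝒱 : Finset (Set X), IsFinOpenCover 𝒱 ∧
      ∀ V ∈ 𝒱, ∃ U ∈ 𝒰, ∀ y ∈ V, ∀ z, ρ.d y z < θ → z ∈ U := by
  have hcont : ∀ x, Continuous fun z => ρ.d x z := fun x =>
    ρ.continuous'.comp (Continuous.prodMk_right x)
  have hball : ∀ x, ∃ r > 0, ∃ U ∈ 𝒰, ∀ z, ρ.d x z < 2 * r → z ∈ U := by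
    intro x
    have hx : x ∈ ⋃ U ∈ 𝒰, U := h𝒰.2 ▸ Set.mem_univ x
    obtain ⟨U, hU, hxU⟩ := Set.mem_iUnion₂.1 hx
    rcases (Uᶜ).eq_empty_or_nonempty with he | hne
    · exact ⟨1, one_pos, U, hU, fun z _ => (Set.compl_empty_iff.1 he) ▸ Set.mem_univ z⟩
    · obtain ⟨z₀, hz₀, hmin⟩ := (h𝒰.1 U hU).isClosed_compl.isCompact.exists_isMinOn hne
        (hcont x).continuousOn
      have hpos : 0 < ρ.d x z₀ := lt_of_le_of_ne (ρ.nonneg _ _) fun h0 =>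
        hz₀ (hρ _ _ h0.symm ▸ hxU)
      refine ⟨ρ.d x z₀ / 2, by positivity, U, hU, fun z hz => ?_⟩
      by_contra hzU
      have := hmin hzU
      simp only [Set.mem_ofPred_eq] at this
      linarith
  choose r hr U hU hrU using hball
  obtain ⟨t, ht⟩ := isCompact_univ.elim_finite_subcover (fun x => {y | ρ.d x y < r x})
    (fun x => isOpen_lt (hcont x) continuous_const)
    (fun x _ => Set.mem_iUnion.2 ⟨x, by simpa [ρ.refl] using hr x⟩)
  have hθ : ∀ᶠ θ in 𝓝[>] (0 : ℝ), ∀ x ∈ t, θ < r x :=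
    (Finset.eventually_all t).2 fun x _ => nhdsWithin_le_nhds (gt_mem_nhds (hr x))
  obtain ⟨θ, hθ, hθ0⟩ := (hθ.and self_mem_nhdsWithin).exists
  refine ⟨θ, hθ0, t.image fun x => {y | ρ.d x y < r x}, ⟨fun V hV => ?_, ?_⟩, fun V hV => ?_⟩
  · obtain ⟨x, -, rfl⟩ := Finset.mem_image.1 hV
    exact isOpen_lt (hcont x) continuous_const
  · rw [Finset.set_biUnion_finset_image]
    exact Set.univ_subset_iff.1 ht
  · obtain ⟨x, hx, rfl⟩ := Finset.mem_image.1 hV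
    refine ⟨U x, hU x, fun y hy z hz => hrU x z ?_⟩
    have h1 := ρ.triangle x y z
    have h2 := hθ x hx
    have h3 : ρ.d x y < r x := hy
    linarith

theorem mem_mapSpace_iff {G X : Type*} [Group G] [TopologicalSpace X] [MulAction G X]
    {ρ : ContPseudoMetric X} {F : Finset G} {δ : ℝ} (hδ : 0 ≤ δ) {d : ℕ}
    {σ : G → Equiv.Perm (Fin d)} {φ : Fin d → X} :
    φ ∈ MapSpace ρ F δ σ ↔
      ∀ s ∈ F, ∑ a, (ρ.d (φ (σ s a)) (s • φ a)) ^ 2 ≤ δ ^ 2 * d := by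
  simp only [MapSpace, Set.mem_ofPred_eq, rho2, Real.sqrt_le_left hδ]
  refine forall₂_congr fun s _ => ?_
  rcases Nat.eq_zero_or_pos d with rfl | hd
  · simp [sq_nonneg]
  · have : (0 : ℝ) < d := by exact_mod_cast hd
    rw [one_div, inv_mul_le_iff₀ this, mul_comm]

/-- Chebyshev's inequality for approximately equivariant maps. -/
theorem card_filter_le_of_mem_mapSpace {G X : Type*} [Group G] [TopologicalSpace X] [MulAction G X]
    {ρ : ContPseudoMetric X} {F : Finset G} {δ : ℝ} (hδ : 0 ≤ δ) {d : ℕ}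
    {σ : G → Equiv.Perm (Fin d)} {φ : Fin d → X} (hφ : φ ∈ MapSpace ρ F δ σ) {s : G} (hs : s ∈ F)
    {θ : ℝ} (hθ : 0 < θ) :
    ((Finset.univ.filter fun a => θ ≤ ρ.d (φ (σ s a)) (s • φ a)).card : ℝ) ≤
      δ ^ 2 / θ ^ 2 * d := by
  have h := (mem_mapSpace_iff hδ).1 hφ s hs
  have h1 : ((Finset.univ.filter fun a => θ ≤ ρ.d (φ (σ s a)) (s • φ a)).card : ℝ) * θ ^ 2 ≤
      ∑ a, (ρ.d (φ (σ s a)) (s • φ a)) ^ 2 := by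
    rw [← nsmul_eq_mul]
    refine (Finset.card_nsmul_le_sum _ (fun a => (ρ.d (φ (σ s a)) (s • φ a)) ^ 2) _
      fun a ha => ?_).trans (Finset.sum_le_sum_of_subset_of_nonneg (Finset.subset_univ _)
        fun a _ _ => sq_nonneg _)
    exact pow_le_pow_left₀ hθ.le (Finset.mem_filter.1 ha).2 2
  rw [div_mul_eq_mul_div, le_div_iff₀ (by positivity)]
  exact h1.trans h

theorem mem_coverJoin {G X : Type*} [Group G] [TopologicalSpace X] [MulAction G X]
    {𝒰 : Finset (Set X)} {F : Finset G} {A : Set X} :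
    A ∈ coverJoin 𝒰 F ↔ ∃ f : ∀ s ∈ F, Set X, (∀ s hs, f s hs ∈ 𝒰) ∧
      ⋂ s, ⋂ (h : s ∈ F), (fun x : X => s • x) ⁻¹' f s h = A := by
  simp [coverJoin, Finset.mem_pi]

theorem mem_restrictCover_prodCover {X : Type*} {𝒰 : Finset (Set X)} {d : ℕ}
    {Z : Set (Fin d → X)} {A : Set Z} :
    A ∈ restrictCover (prodCover 𝒰 d) Z ↔ ∃ U : Fin d → Set X, (∀ a, U a ∈ 𝒰) ∧
      {φ : Z | ∀ a, φ.1 a ∈ U a} = A := by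
  simp [restrictCover, prodCover, Fintype.mem_piFinset]

/-- If all but few points of `[d]` are covered by tiles, then the dimension of `𝒰^d` on the
approximately equivariant maps is bounded by the dimensions of the joins along the tiles. -/
theorem coverDMap_le_of_tiles {G X τ : Type*} [Group G] [TopologicalSpace X] [NormalSpace X]
    [MulAction G X] [ContinuousConstSMul G X] [Fintype τ] {ρ : ContPseudoMetric X}
    {𝒰 𝒱 : Finset (Set X)} {θ : ℝ} (hθ : 0 < θ)
    (h𝒱 : ∀ V ∈ 𝒱, ∃ U ∈ 𝒰, ∀ y ∈ V, ∀ z, ρ.d y z < θ → z ∈ U)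
    {d : ℕ} {σ : G → Equiv.Perm (Fin d)} {F : Finset G} {δ : ℝ} (hδ : 0 ≤ δ)
    {shape : τ → Finset G} (hshape : ∀ t, shape t ⊆ F) {c : τ → Fin d} {A : Finset (Fin d)}
    (hA : ∀ a ∈ A, ∃ t, ∃ s ∈ shape t, σ s (c t) = a) {n : τ → ℕ}
    (hn : ∀ t, coverD (coverJoin 𝒱 (shape t)) ≤ (n t : EReal)) {m : ℕ}
    (hm : coverD 𝒰 ≤ (m : EReal)) {b : ℝ}
    (hb : ∑ t, (n t : ℝ) + (m + 1) * (((Aᶜ).card : ℝ) + F.card * (δ ^ 2 / (θ / 2) ^ 2 * d)) ≤ b) :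
    coverDMap 𝒰 ρ F δ σ ≤ (b : EReal) := by
  have hb0 : 0 ≤ b := le_trans (add_nonneg (Finset.sum_nonneg fun _ _ => Nat.cast_nonneg _)
    (by positivity)) hb
  have hfloor : ((⌊b⌋₊ : ℕ) : EReal) ≤ (b : EReal) := by
    rw [show ((⌊b⌋₊ : ℕ) : EReal) = ((⌊b⌋₊ : ℝ) : EReal) by rfl, EReal.coe_le_coe_iff]
    exact Nat.floor_le hb0
  refine le_trans ?_ hfloor
  set N := ⌊b⌋₊ with hN
  have heval : ∀ a : Fin d, Continuous fun φ : MapSpace ρ F δ σ => φ.1 a := fun a =>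
    (continuous_apply a).comp continuous_subtype_val
  choose Wt hWt hWtm using fun t => colorable_of_coverD_le (hn t) (N + 1)
  obtain ⟨W, hW, hWm⟩ := colorable_of_coverD_le hm (N + 1)
  have hdist : ∀ a : Fin d, ∃ h : MapSpace ρ F δ σ → ℝ, Continuous h ∧
      ((a ∉ A ∧ ∀ φ, h φ = θ) ∨ a ∈ A ∧ ∃ t, ∃ s ∈ shape t, σ s (c t) = a ∧
        ∀ φ, h φ = ρ.d (φ.1 a) (s • φ.1 (c t))) := by
    intro a
    by_cases ha : a ∈ A
    · obtain ⟨t, s, hs, hst⟩ := hA a ha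
      refine ⟨fun φ => ρ.d (φ.1 a) (s • φ.1 (c t)), ?_, Or.inr ⟨ha, t, s, hs, hst, fun _ => rfl⟩⟩
      exact ρ.continuous'.comp ((heval a).prodMk ((heval (c t)).const_smul s))
    · exact ⟨fun _ => θ, continuous_const, Or.inl ⟨ha, fun _ => rfl⟩⟩
  choose h hcont hh using hdist
  choose Wa hWa hWam using fun a => (hW.comap (heval a)).exists_option (hcont a) hθ
  have hcol := (IsColoring.pi fun t => (hWt t).comap (heval (c t))).prod (IsColoring.pi hWa)
  refine coverD_le_of_isColoring hcol (n := N) (fun φ => ?_) ?_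
  · have hbad : ((Finset.univ.filter fun a => θ / 2 ≤ h a φ).card : ℝ) ≤
        ((Aᶜ).card : ℝ) + F.card * (δ ^ 2 / (θ / 2) ^ 2 * d) := by
      have hsub : (Finset.univ.filter fun a => θ / 2 ≤ h a φ) ⊆ Aᶜ ∪ F.biUnion fun s =>
          (Finset.univ.filter fun a => θ / 2 ≤ ρ.d (φ.1 (σ s a)) (s • φ.1 a)).image (σ s) := by
        intro a ha
        rcases hh a with ⟨haA, -⟩ | ⟨-, t, s, hs, hst, hd⟩
        · exact Finset.mem_union_left _ (Finset.mem_compl.2 haA)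
        · refine Finset.mem_union_right _ (Finset.mem_biUnion.2 ⟨s, hshape t hs,
            Finset.mem_image.2 ⟨c t, Finset.mem_filter.2 ⟨Finset.mem_univ _, ?_⟩, hst⟩⟩)
          rw [hst, ← hd]
          exact (Finset.mem_filter.1 ha).2
      have h1 := (Finset.card_le_card hsub).trans ((Finset.card_union_le _ _).trans
        (Nat.add_le_add_left (Finset.card_biUnion_le.trans
          (Finset.sum_le_sum fun s _ => Finset.card_image_le)) _))
      have h2 : ((Finset.univ.filter fun a => θ / 2 ≤ h a φ).card : ℝ) ≤ ((Aᶜ).card : ℝ) +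
          ∑ s ∈ F, ((Finset.univ.filter fun a =>
            θ / 2 ≤ ρ.d (φ.1 (σ s a)) (s • φ.1 a)).card : ℝ) := by exact_mod_cast h1
      refine h2.trans (add_le_add_right ?_ _)
      rw [← nsmul_eq_mul]
      exact Finset.sum_le_card_nsmul _ _ _ fun s hs =>
        card_filter_le_of_mem_mapSpace hδ φ.2 hs (half_pos hθ)
    rw [hN, Nat.le_floor_iff hb0]
    refine le_trans ?_ hb
    have h1 : ∑ t, miss (fun i u => (fun φ : MapSpace ρ F δ σ => φ.1 (c t)) ⁻¹' Wt t i u) (N + 1) φ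
        ≤ ∑ t, n t := Finset.sum_le_sum fun t _ => hWtm t (φ.1 (c t))
    have h2 : ∑ a, miss (Wa a) (N + 1) φ ≤
        (Finset.univ.filter fun a => θ / 2 ≤ h a φ).card * (m + 1) := by
      rw [← smul_eq_mul, ← Finset.sum_const, Finset.sum_filter]
      refine Finset.sum_le_sum fun a _ => ?_
      split_ifs with ha
      · exact (hWam a (N + 1) φ).1.trans (Nat.add_le_add_right (hWm (φ.1 a)) 1)
      · exact ((hWam a (N + 1) φ).2 (not_le.1 ha)).le
    have h3 := (miss_prod_le _ _ (N + 1) φ).trans (Nat.add_le_add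
      ((miss_pi_le (fun t i u => (fun φ : MapSpace ρ F δ σ => φ.1 (c t)) ⁻¹' Wt t i u)
        (N + 1) φ).trans h1) ((miss_pi_le Wa (N + 1) φ).trans h2))
    refine (Nat.cast_le.2 h3).trans ?_
    push_cast
    rw [add_le_add_iff_left, mul_comm]
    gcongr
  · rintro ⟨u, w⟩ ⟨φ₀, -, hφ₀⟩
    have hU : ∀ a, ∃ U ∈ 𝒰, ∀ φ : MapSpace ρ F δ σ, (∀ t, φ.1 (c t) ∈ (u t).1) →
        φ ∈ (w a).elim {φ | h a φ < θ} (fun U => (fun φ : MapSpace ρ F δ σ => φ.1 a) ⁻¹' U.1) →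
        φ.1 a ∈ U := by
      intro a
      have hwa := Set.mem_iInter.1 hφ₀ a
      rcases hw : w a with _ | U
      · simp only [hw, Option.elim] at hwa ⊢
        rcases hh a with ⟨-, hd⟩ | ⟨-, t, s, hs, hst, hd⟩
        · have : h a φ₀ < θ := hwa
          exact absurd (hd φ₀) this.ne
        · obtain ⟨f, hf, hfu⟩ := mem_coverJoin.1 (u t).2
          obtain ⟨U, hU, hUV⟩ := h𝒱 _ (hf s hs)
          refine ⟨U, hU, fun φ hφ hφa => hUV (s • φ.1 (c t)) ?_ _ ?_⟩
          · have := hφ t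
            rw [← hfu] at this
            exact Set.mem_iInter₂.1 this s hs
          · rw [ρ.symm, ← hd]
            exact hφa
      · exact ⟨U.1, U.2, fun φ _ hφ => hφ⟩
    choose U hU hUφ using hU
    refine ⟨_, mem_restrictCover_prodCover.2 ⟨U, hU, rfl⟩, ?_⟩
    rintro φ ⟨h1, h2⟩ a
    exact hUφ a φ (fun t => Set.mem_iInter.1 h1 t) (Set.mem_iInter.1 h2 a)

/-- Continuous families of approximately equivariant maps which see the translates by all but few
elements of `F'` bound the dimension of the join along `F'`. -/
theorem coverD_coverJoin_le {G X J : Type*} [Group G] [TopologicalSpace X] [MetrizableSpace X]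
    [MulAction G X] [ContinuousConstSMul G X] [Fintype J] {ρ : ContPseudoMetric X}
    {𝒰 : Finset (Set X)} {d : ℕ} {σ : G → Equiv.Perm (Fin d)} {F : Finset G} {δ : ℝ}
    {φ : J → X → Fin d → X} (hφ : ∀ j, Continuous (φ j)) (hmem : ∀ j x, φ j x ∈ MapSpace ρ F δ σ)
    {F' B : Finset G} (hB : ∀ t ∈ F', t ∉ B → ∃ j a, ∀ x, φ j x a = t • x) {n m : ℕ}
    (hn : coverDMap 𝒰 ρ F δ σ ≤ (n : EReal)) (hm : coverD 𝒰 ≤ (m : EReal)) :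
    coverD (coverJoin 𝒰 F') ≤ ((Fintype.card J * n + B.card * m : ℕ) : EReal) := by
  set N := Fintype.card J * n + B.card * m with hN
  obtain ⟨W, hW, hWm⟩ := colorable_of_coverD_le hn (N + 1)
  obtain ⟨W', hW', hWm'⟩ := colorable_of_coverD_le hm (N + 1)
  have hcont : ∀ j, Continuous fun x => (⟨φ j x, hmem j x⟩ : MapSpace ρ F δ σ) := fun j =>
    (hφ j).subtype_mk _
  have hcol := (IsColoring.pi fun j : J => hW.comap (hcont j)).prod
    (IsColoring.pi fun t : B => hW'.comap (continuous_const_smul (t : G)))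
  refine coverD_le_of_isColoring hcol (n := N) (fun x => ?_) ?_
  · refine (miss_prod_le _ _ (N + 1) x).trans (Nat.add_le_add
      ((miss_pi_le (fun (j : J) i u => (fun x => (⟨φ j x, hmem j x⟩ : MapSpace ρ F δ σ)) ⁻¹' W i u)
        (N + 1) x).trans ?_)
      ((miss_pi_le (fun (t : B) i u => (fun x : X => (t : G) • x) ⁻¹' W' i u) (N + 1) x).trans ?_))
    · rw [← Finset.card_univ, ← smul_eq_mul]
      exact Finset.sum_le_card_nsmul _ _ _ fun j _ => hWm _
    · rw [← Fintype.card_coe, ← Finset.card_univ, ← smul_eq_mul]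
      exact Finset.sum_le_card_nsmul _ _ _ fun t _ => hWm' _
  · rintro ⟨u, w⟩ -
    have hU : ∀ t ∈ F', ∃ U ∈ 𝒰, ∀ x, (∀ j, (⟨φ j x, hmem j x⟩ : MapSpace ρ F δ σ) ∈ (u j).1) →
        (∀ s : B, (s : G) • x ∈ (w s).1) → t • x ∈ U := by
      intro t ht
      by_cases htB : t ∈ B
      · exact ⟨_, (w ⟨t, htB⟩).2, fun x _ hx => hx ⟨t, htB⟩⟩
      · obtain ⟨j, a, hja⟩ := hB t ht htB
        obtain ⟨U, hU, hUu⟩ := mem_restrictCover_prodCover.1 (u j).2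
        refine ⟨U a, hU a, fun x hx _ => ?_⟩
        have := hx j
        rw [← hUu] at this
        exact hja x ▸ this a
    choose U hU hUx using hU
    refine ⟨_, mem_coverJoin.2 ⟨U, hU, rfl⟩, ?_⟩
    rintro x ⟨h1, h2⟩
    exact Set.mem_iInter₂.2 fun t ht => hUx t ht x (fun j => Set.mem_iInter.1 h1 j)
      (fun s => Set.mem_iInter.1 h2 s)

/-! ### Comparison of the two mean dimensions -/

theorem isFinOpenCover_coverJoin {G X : Type*} [Group G] [TopologicalSpace X] [MulAction G X]
    [ContinuousConstSMul G X] {𝒰 : Finset (Set X)} (h : IsFinOpenCover 𝒰) (F : Finset G) :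
    IsFinOpenCover (coverJoin 𝒰 F) := by
  refine ⟨fun A hA => ?_, Set.eq_univ_of_forall fun x => ?_⟩
  · obtain ⟨f, hf, rfl⟩ := mem_coverJoin.1 hA
    have : IsOpen (⋂ s : F, (fun x : X => (s : G) • x) ⁻¹' f s s.2) := isOpen_iInter_of_finite
      fun s => (h.1 _ (hf s s.2)).preimage (continuous_const_smul (s : G))
    rwa [Set.iInter_subtype] at this
  · have hx : ∀ s ∈ F, ∃ U ∈ 𝒰, s • x ∈ U := fun s _ => by
      have hs : s • x ∈ ⋃ U ∈ 𝒰, U := h.2 ▸ Set.mem_univ _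
      simpa using hs
    choose f hf hfx using hx
    exact Set.mem_iUnion₂.2 ⟨_, mem_coverJoin.2 ⟨f, hf, rfl⟩, Set.mem_iInter₂.2 hfx⟩

theorem isFinOpenCover_restrictCover_prodCover {X : Type*} [TopologicalSpace X]
    {𝒰 : Finset (Set X)} (h : IsFinOpenCover 𝒰) {d : ℕ} (Z : Set (Fin d → X)) :
    IsFinOpenCover (restrictCover (prodCover 𝒰 d) Z) := by
  refine ⟨fun A hA => ?_, Set.eq_univ_of_forall fun φ => ?_⟩
  · obtain ⟨U, hU, rfl⟩ := mem_restrictCover_prodCover.1 hA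
    have : IsOpen (⋂ a, (fun φ : Z => φ.1 a) ⁻¹' U a) := isOpen_iInter_of_finite fun a =>
      (h.1 _ (hU a)).preimage ((continuous_apply a).comp continuous_subtype_val)
    convert this using 1
    ext φ
    simp
  · have hx : ∀ a, ∃ U ∈ 𝒰, φ.1 a ∈ U := fun a => by
      have hs : φ.1 a ∈ ⋃ U ∈ 𝒰, U := h.2 ▸ Set.mem_univ _
      simpa using hs
    choose U hU hUa using hx
    exact Set.mem_iUnion₂.2 ⟨_, mem_restrictCover_prodCover.2 ⟨U, hU, rfl⟩, hUa⟩

theorem mul_natCast_inv_le_coe_iff {x : EReal} {n : ℕ} (hn : 0 < n) {c : ℝ} :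
    x * (((n : ℝ) : EReal))⁻¹ ≤ c ↔ x ≤ ((c * n : ℝ) : EReal) := by
  have hn' : (0 : ℝ) < n := by exact_mod_cast hn
  rw [← div_eq_mul_inv, EReal.div_le_iff_le_mul (by exact_mod_cast hn')
    (EReal.coe_ne_top _), mul_comm c, EReal.coe_mul]

theorem natCast_mul_natCast_inv (m n : ℕ) :
    (m : EReal) * (((n : ℝ) : EReal))⁻¹ = ((m / n : ℝ) : EReal) := by
  rw [div_eq_mul_inv, EReal.coe_mul, EReal.coe_inv]
  rfl

/-- The sofic mean dimension of a cover is bounded by the mean dimension of any cover which refines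
it with uniform room. -/
theorem DSigmaU_le_mdimCoverIS {G : Type*} [Group G] (hG : AmenableF G) (Sap : SoficApprox G)
    {X : Type*} [TopologicalSpace X] [NormalSpace X] [Nonempty X] [MulAction G X]
    [ContinuousConstSMul G X] {ρ : ContPseudoMetric X} {𝒰 𝒱 : Finset (Set X)}
    (h𝒰 : IsFinOpenCover 𝒰) (h𝒱 : IsFinOpenCover 𝒱) {θ : ℝ} (hθ : 0 < θ)
    (hUV : ∀ V ∈ 𝒱, ∃ U ∈ 𝒰, ∀ y ∈ V, ∀ z, ρ.d y z < θ → z ∈ U) :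
    DSigmaU Sap 𝒰 ρ ≤ mdimCoverIS (G := G) 𝒱 := by
  refine le_iInf fun K => le_iInf fun ε => ?_
  obtain ⟨ε, hε⟩ := ε
  refine EReal.le_of_forall_lt_iff_le.1 fun c hc => ?_
  obtain ⟨c', hc', hcc'⟩ := EReal.lt_iff_exists_real_btwn.1 hc
  rw [EReal.coe_lt_coe_iff] at hcc'
  choose n hn using fun F : Finset G => coverD_eq_natCast (isFinOpenCover_coverJoin h𝒱 F)
  have hbound : ∀ F ∈ FolnerSets K ε, (n F : ℝ) ≤ c' * F.card := by
    intro F hF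
    have h1 : coverD (coverJoin 𝒱 F) * (((F.card : ℝ) : EReal))⁻¹ ≤ c' :=
      (le_iSup₂ (f := fun F (_ : F ∈ FolnerSets K ε) =>
        coverD (coverJoin 𝒱 F) * (((F.card : ℝ) : EReal))⁻¹) F hF).trans hc'.le
    rw [mul_natCast_inv_le_coe_iff hF.1.card_pos, hn F] at h1
    exact EReal.coe_le_coe_iff.1 h1
  have hc'0 : 0 ≤ c' := by
    obtain ⟨F, hF⟩ := hG K ε hε
    have h1 := (Nat.cast_nonneg (n F)).trans (hbound F hF)
    have h2 : (0 : ℝ) < F.card := by exact_mod_cast hF.1.card_pos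
    exact nonneg_of_mul_nonneg_left h1 h2
  obtain ⟨m, hm⟩ := coverD_eq_natCast h𝒰
  obtain ⟨η, hη0, hη2, hη⟩ : ∃ η : ℝ, 0 < η ∧ η ≤ 1 / 2 ∧
      η * (2 * c' + 3 * (m + 1)) ≤ c - c' := by
    have hpos : 0 < 2 * c' + 3 * ((m : ℝ) + 1) := by positivity
    refine ⟨min (1 / 2) ((c - c') / (2 * c' + 3 * (m + 1))),
      lt_min (by norm_num) (div_pos (by linarith) hpos), min_le_left _ _, ?_⟩
    rw [← le_div_iff₀ hpos]
    exact min_le_right _ _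
  obtain ⟨𝓕, S, hS₀, h𝓕, htile⟩ := exists_quasitiling.{_, 0, 0} hG hη0 hη2 K {1} hε
  have hSne : S.Nonempty := ⟨1, hS₀ (Finset.mem_singleton_self 1)⟩
  have hScard : (0 : ℝ) < S.card := by exact_mod_cast hSne.card_pos
  set δ : ℝ := θ / 2 * √(η / S.card) with hδ
  have hδ0 : 0 < δ := by positivity
  have hδS : S.card * (δ ^ 2 / (θ / 2) ^ 2) = η := by
    rw [hδ, mul_pow, Real.sq_sqrt (by positivity)]
    field_simp
  refine (iInf_le _ ⟨S, hSne⟩).trans ((iInf_le _ ⟨δ, hδ0⟩).trans ?_)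
  refine limsup_le_of_le (h := ?_)
  filter_upwards [Sap.eventually_pos, Sap.eventually_exists_goodPoints S (half_pos hη0)] with i hd hV₀
  obtain ⟨V₀, hV₀, hV₀card⟩ := hV₀
  rw [mul_natCast_inv_le_coe_iff hd]
  obtain ⟨T, hT, hTcard⟩ := htile _ _ V₀ V₀ hV₀ hV₀ (by simpa [Finset.card_compl] using hV₀card)
    (by simpa [Finset.card_compl] using hV₀card)
  rw [min_self, Fintype.card_fin] at hTcard
  have h𝓕S : ∀ F ∈ 𝓕, F ⊆ S := fun F hF => (h𝓕 F hF).2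
  have hle := hT.sum_le_min hV₀ hV₀ h𝓕S
  rw [min_self, Fintype.card_fin] at hle
  have hle' : ∑ t ∈ T, (t.part.card : ℝ) ≤ Sap.d i := by exact_mod_cast hle
  have hd' : (0 : ℝ) < Sap.d i := by exact_mod_cast hd
  obtain ⟨A, hA, hAcard⟩ := hT.exists_support hV₀ h𝓕S
  refine coverDMap_le_of_tiles (τ := T) hθ hUV hδ0.le (shape := fun t => t.1.shape)
    (fun t => h𝓕S _ (hT.shape_mem t t.2)) (c := fun t => t.1.center)
    (A := A) ?_ (n := fun t => n t.1.shape) (fun t => (hn _).le) hm.le ?_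
  · intro a ha
    obtain ⟨t, ht, s, hs, hsa⟩ := (hA a).1 ha
    exact ⟨⟨t, ht⟩, s, hT.part_subset t ht hs, hsa⟩
  · rw [Finset.card_compl, hAcard, Fintype.card_fin, Nat.cast_sub hle,
      Nat.cast_sum]
    have h1 : ∑ t : T, (n t.1.shape : ℝ) ≤ c' * ∑ t ∈ T, (t.shape.card : ℝ) := by
      rw [Finset.sum_coe_sort T fun t => (n t.shape : ℝ), Finset.mul_sum]
      exact Finset.sum_le_sum fun t ht => hbound _ (h𝓕 _ (hT.shape_mem t ht)).1
    have h2 : ∑ t ∈ T, (t.shape.card : ℝ) ≤ (1 + 2 * η) * Sap.d i := by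
      have h3 := hT.sum_shape_le
      have h4 : (0 : ℝ) ≤ ∑ t ∈ T, (t.shape.card : ℝ) := Finset.sum_nonneg fun _ _ => Nat.cast_nonneg _
      generalize ∑ t ∈ T, (t.shape.card : ℝ) = x at h3 h4
      have h5 : (1 - η) * x ≤ Sap.d i := h3.trans hle'
      have h6 := mul_le_mul_of_nonneg_left h5 (show 0 ≤ 1 + 2 * η by linarith)
      have h7 : x ≤ (1 + 2 * η) * ((1 - η) * x) := by
        have : 0 ≤ η * (1 - 2 * η) * x := by
          have : 0 ≤ 1 - 2 * η := by linarith
          positivity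
        linarith
      linarith
    have h3 : (Sap.d i : ℝ) - ∑ t ∈ T, (t.part.card : ℝ) + S.card * (δ ^ 2 / (θ / 2) ^ 2 * Sap.d i)
        ≤ 3 * η * Sap.d i := by
      rw [← mul_assoc, hδS]
      have : 0 ≤ η ^ 2 * Sap.d i := by positivity
      linarith
    calc _ ≤ c' * ((1 + 2 * η) * Sap.d i) + (m + 1) * (3 * η * Sap.d i) := by
          gcongr
          exact h1.trans (by gcongr)
      _ = (c' + η * (2 * c' + 3 * (m + 1))) * Sap.d i := by ring
      _ ≤ c * Sap.d i := by gcongr; linarith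

/-- Most elements of a large part of a Følner set stay in that part under translation. -/
theorem card_sub_le_card_core {G : Type*} [Group G] {F E P : Finset G} {ε η : ℝ}
    (hE : E ∈ FolnerSets F ε) (hPE : P ⊆ E) (hP : (1 - η) * E.card ≤ (P.card : ℝ)) :
    (P.card : ℝ) - F.card * (η + ε) * E.card ≤
      ((P.filter fun s => ∀ f ∈ F, f * s ∈ P).card : ℝ) := by
  set D := (E \ P) ∪ (F * E) \ E with hD
  have hDcard : (D.card : ℝ) ≤ (η + ε) * E.card := by
    have h1 : (D.card : ℝ) ≤ (E \ P).card + ((F * E) \ E).card := by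
      exact_mod_cast Finset.card_union_le _ _
    have h2 : ((E \ P).card : ℝ) + P.card = E.card := by
      exact_mod_cast Finset.card_sdiff_add_card_eq_card hPE
    have h3 := hE.2
    linarith
  have hsub : P ⊆ (P.filter fun s => ∀ f ∈ F, f * s ∈ P) ∪
      F.biUnion fun f => D.image fun x => f⁻¹ * x := by
    intro s hs
    by_cases h : ∀ f ∈ F, f * s ∈ P
    · exact Finset.mem_union_left _ (Finset.mem_filter.2 ⟨hs, h⟩)
    · push Not at h
      obtain ⟨f, hf, hfs⟩ := h
      refine Finset.mem_union_right _ (Finset.mem_biUnion.2 ⟨f, hf, Finset.mem_image.2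
        ⟨f * s, ?_, by group⟩⟩)
      by_cases hfE : f * s ∈ E
      · exact Finset.mem_union_left _ (Finset.mem_sdiff.2 ⟨hfE, hfs⟩)
      · exact Finset.mem_union_right _ (Finset.mem_sdiff.2
          ⟨Finset.mul_mem_mul hf (hPE hs), hfE⟩)
  have h1 := (Finset.card_le_card hsub).trans ((Finset.card_union_le _ _).trans
    (Nat.add_le_add_left (Finset.card_biUnion_le.trans
      (Finset.sum_le_card_nsmul F _ D.card fun f _ => Finset.card_image_le)) _))
  have h2 : (P.card : ℝ) ≤ ((P.filter fun s => ∀ f ∈ F, f * s ∈ P).card : ℝ) +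
      F.card * D.card := by
    rw [smul_eq_mul] at h1
    exact_mod_cast h1
  have h3 : (F.card : ℝ) * D.card ≤ F.card * ((η + ε) * E.card) := by gcongr
  linarith

/-- A simultaneous quasitiling of `V` and of a subset of `G` gives a labelling of `V` by elements of
`G` which is equivariant at most points. -/
theorem IsQuasitiling.exists_labelling {G V V' : Type*} [Group G] [Fintype V] [Fintype V']
    {σ : G → V → V} {σ' : G → V' → V'} {V₀ : Finset V} {V₀' : Finset V'} {η ε : ℝ}
    {𝓕 : Finset (Finset G)} {T : Finset (TilePair G V V')} {S F : Finset G}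
    (h : IsQuasitiling σ σ' V₀ V₀' η 𝓕 T) (hV₀ : ∀ v ∈ V₀, IsGoodPoint σ S v)
    (hV₀' : ∀ v ∈ V₀', IsGoodPoint σ' S v) (h𝓕 : ∀ E ∈ 𝓕, E ∈ FolnerSets F ε ∧ E ⊆ S)
    (hFS : F ⊆ S) {ι : V' → G} (hι : Function.Injective ι)
    (hισ : ∀ s ∈ S, ∀ v ∈ V₀', ι (σ' s v) = s * ι v) :
    ∃ (g : V → G) (A N : Finset V), A.card = ∑ t ∈ T, t.part.card ∧
      (∀ v ∈ A, ∀ w ∈ A, g v = g w → v = w) ∧ (∀ v ∈ A, ∃ w, ι w = g v) ∧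
      (∀ v ∈ N, ∀ f ∈ F, g (σ f v) = f * g v) ∧
      ∑ t ∈ T, (t.part.card : ℝ) - F.card * (η + ε) * ∑ t ∈ T, (t.shape.card : ℝ) ≤ N.card := by
  have h𝓕S : ∀ E ∈ 𝓕, E ⊆ S := fun E hE => (h𝓕 E hE).2
  have hpart : ∀ t ∈ T, t.part ⊆ S := fun t ht =>
    (h.part_subset t ht).trans (h𝓕S _ (h.shape_mem t ht))
  have huniq : ∀ t ∈ T, ∀ u ∈ T, ∀ s ∈ t.part, ∀ r ∈ u.part,
      σ s t.center = σ r u.center → t = u ∧ s = r := by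
    intro t ht u hu s hs r hr hsr
    have htu : t = u := by
      by_contra hne
      exact Finset.disjoint_left.1 (h.disjoint t ht u hu hne) (mem_tileAt.2 ⟨s, hs, rfl⟩)
        (mem_tileAt.2 ⟨r, hr, hsr.symm⟩)
    subst htu
    exact ⟨rfl, (hV₀ _ (h.center_mem t ht)).inj s (hpart t ht hs) r (hpart t ht hr) hsr⟩
  have huniq' : ∀ t ∈ T, ∀ u ∈ T, ∀ s ∈ t.part, ∀ r ∈ u.part,
      σ' s t.center' = σ' r u.center' → t = u ∧ s = r := by
    intro t ht u hu s hs r hr hsr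
    have htu : t = u := by
      by_contra hne
      exact Finset.disjoint_left.1 (h.disjoint' t ht u hu hne) (mem_tileAt.2 ⟨s, hs, rfl⟩)
        (mem_tileAt.2 ⟨r, hr, hsr.symm⟩)
    subst htu
    exact ⟨rfl, (hV₀' _ (h.center_mem' t ht)).inj s (hpart t ht hs) r (hpart t ht hr) hsr⟩
  obtain ⟨g, hg⟩ : ∃ g : V → G, ∀ t ∈ T, ∀ s ∈ t.part, g (σ s t.center) = s * ι t.center' := by
    have hex : ∀ v, ∃ x : G, ∀ t ∈ T, ∀ s ∈ t.part, σ s t.center = v → x = s * ι t.center' := by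
      intro v
      by_cases hv : ∃ t ∈ T, ∃ s ∈ t.part, σ s t.center = v
      · obtain ⟨t, ht, s, hs, rfl⟩ := hv
        refine ⟨s * ι t.center', fun u hu r hr hru => ?_⟩
        obtain ⟨rfl, rfl⟩ := huniq u hu t ht r hr s hs hru
        rfl
      · exact ⟨1, fun t ht s hs hst => absurd ⟨t, ht, s, hs, hst⟩ hv⟩
    choose g hg using hex
    exact ⟨g, fun t ht s hs => hg _ t ht s hs rfl⟩
  have hgι : ∀ t ∈ T, ∀ s ∈ t.part, ι (σ' s t.center') = g (σ s t.center) := fun t ht s hs => by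
    rw [hg t ht s hs, hισ s (hpart t ht hs) _ (h.center_mem' t ht)]
  obtain ⟨A, hA, hAcard⟩ := h.exists_support hV₀ h𝓕S
  set core : TilePair G V V' → Finset G := fun t =>
    t.part.filter fun s => ∀ f ∈ F, f * s ∈ t.part with hcore
  have hcore_sub : ∀ t, core t ⊆ t.part := fun t => Finset.filter_subset _ _
  refine ⟨g, A, T.biUnion fun t => tileAt σ (core t) t.center, hAcard, ?_, ?_, ?_, ?_⟩
  · intro v hv w hw hvw
    obtain ⟨t, ht, s, hs, rfl⟩ := (hA v).1 hv
    obtain ⟨u, hu, r, hr, rfl⟩ := (hA w).1 hw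
    rw [← hgι t ht s hs, ← hgι u hu r hr] at hvw
    obtain ⟨rfl, rfl⟩ := huniq' t ht u hu s hs r hr (hι hvw)
    rfl
  · intro v hv
    obtain ⟨t, ht, s, hs, rfl⟩ := (hA v).1 hv
    exact ⟨_, hgι t ht s hs⟩
  · intro v hv f hf
    obtain ⟨t, ht, htv⟩ := Finset.mem_biUnion.1 hv
    obtain ⟨s, hs, rfl⟩ := mem_tileAt.1 htv
    have hs' := hcore_sub t hs
    rw [(hV₀ _ (h.center_mem t ht)).mul f (hFS hf) s (hpart t ht hs'), hg t ht s hs',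
      hg t ht (f * s) ((Finset.mem_filter.1 hs).2 f hf), mul_assoc]
  · have hcard : (T.biUnion fun t => tileAt σ (core t) t.center).card =
        ∑ t ∈ T, (core t).card := by
      have hdisj : ∀ t ∈ T, ∀ u ∈ T, t ≠ u →
          Disjoint (tileAt σ (core t) t.center) (tileAt σ (core u) u.center) :=
        fun t ht u hu htu => (h.disjoint t ht u hu htu).mono
          (Finset.image_subset_image (hcore_sub t)) (Finset.image_subset_image (hcore_sub u))
      rw [Finset.card_biUnion hdisj]
      exact Finset.sum_congr rfl fun t ht => (hV₀ _ (h.center_mem t ht)).card_tileAt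
        ((hcore_sub t).trans (hpart t ht))
    rw [hcard, Nat.cast_sum, Finset.mul_sum, ← Finset.sum_sub_distrib]
    exact Finset.sum_le_sum fun t ht => card_sub_le_card_core (h𝓕 _ (h.shape_mem t ht)).1
      (h.part_subset t ht) (h.card_part t ht)

/-- Left translation on a sufficiently invariant finite set is almost a free action. -/
theorem exists_goodPoints_of_mem_folnerSets {G : Type*} [Group G] {S K F' : Finset G} {c ε : ℝ}
    (hK : S ∪ S * S ⊆ K) (hε : (S ∪ S * S).card * ε ≤ c)
    (hF' : F' ∈ FolnerSets K ε) :
    ∃ (σ' : G → F' → F') (V₀' : Finset F'), (∀ v ∈ V₀', IsGoodPoint σ' S v) ∧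
      (∀ s ∈ S, ∀ v ∈ V₀', (σ' s v : G) = s * v) ∧ ((V₀'ᶜ).card : ℝ) ≤ c * F'.card := by
  set L := S ∪ S * S with hL
  have hSL : S ⊆ L := Finset.subset_union_left
  set σ' : G → F' → F' := fun s v => if h : s * v ∈ F' then ⟨s * v, h⟩ else v with hσ'
  have hσ'_apply : ∀ s (v : F'), s * (v : G) ∈ F' → (σ' s v : G) = s * v := fun s v h => by
    simp [hσ', h]
  have hmem : ∀ v ∈ (Finset.univ.filter fun v : F' => ∀ u ∈ L, u * v ∈ F'), ∀ u ∈ L,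
      u * (v : G) ∈ F' := fun v hv => (Finset.mem_filter.1 hv).2
  refine ⟨σ', Finset.univ.filter fun v : F' => ∀ u ∈ L, u * v ∈ F', fun v hv => ?_,
    fun s hs v hv => hσ'_apply s v (hmem v hv s (hSL hs)), ?_⟩
  · have hs1 : ∀ s ∈ S, (σ' s v : G) = s * v := fun s hs => hσ'_apply s v (hmem v hv s (hSL hs))
    refine ⟨Subtype.ext ?_, fun s hs t ht => Subtype.ext ?_, fun s hs t ht hst => ?_⟩
    · rw [hσ'_apply 1 v (by simp), one_mul]
    · have h1 : s * t * (v : G) ∈ F' := hmem v hv _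
        (Finset.mem_union_right _ (Finset.mul_mem_mul hs ht))
      rw [hσ'_apply (s * t) v h1, hσ'_apply s _ (by rwa [hs1 t ht, ← mul_assoc]), hs1 t ht,
        mul_assoc]
    · have := congrArg Subtype.val hst
      rw [hs1 s hs, hs1 t ht] at this
      exact mul_right_cancel this
  · have h1 : ((Finset.univ.filter fun v : F' => ∀ u ∈ L, u * v ∈ F')ᶜ).card ≤
        (L.biUnion fun u => ((K * F') \ F').image fun x => u⁻¹ * x).card := by
      refine Finset.card_le_card_of_injOn Subtype.val (fun v hv => ?_) Subtype.val_injective.injOn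
      simp only [Finset.coe_compl, Finset.coe_filter, Finset.mem_univ, true_and, Set.mem_compl_iff,
        Set.mem_ofPred_eq, not_forall] at hv
      obtain ⟨u, hu, huv⟩ := hv
      exact Finset.mem_coe.2 (Finset.mem_biUnion.2 ⟨u, hu, Finset.mem_image.2 ⟨u * v,
        Finset.mem_sdiff.2 ⟨Finset.mul_mem_mul (hK hu) v.2, huv⟩, by group⟩⟩)
    have h2 := h1.trans (Finset.card_biUnion_le.trans (Finset.sum_le_card_nsmul L _
      ((K * F') \ F').card fun u _ => Finset.card_image_le))
    rw [smul_eq_mul] at h2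
    calc _ ≤ (L.card : ℝ) * ((K * F') \ F').card := by exact_mod_cast h2
      _ ≤ L.card * (ε * F'.card) := by
        gcongr
        exact hF'.2.le
      _ = L.card * ε * F'.card := by ring
      _ ≤ c * F'.card := by gcongr

theorem card_le_two_mul_of_mem_folnerSets {G : Type*} [Group G] {K F : Finset G} {ε : ℝ}
    (hε : ε ≤ 1) (hF : F ∈ FolnerSets K ε) : K.card ≤ 2 * F.card := by
  have h1 : K.card ≤ (K * F).card := Finset.card_le_card_mul_right hF.1
  have h2 : (K * F).card ≤ ((K * F) \ F).card + F.card := Finset.card_le_card_sdiff_add_card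
  have h3 : ((K * F) \ F).card ≤ F.card := by
    have : (((K * F) \ F).card : ℝ) ≤ F.card :=
      hF.2.le.trans (mul_le_of_le_one_left (Nat.cast_nonneg _) hε)
    exact_mod_cast this
  omega

theorem IsGoodPoint.prodMk {G V Q : Type*} [Group G] {σ : G → V → V} {S : Finset G} {v : V}
    (h : IsGoodPoint σ S v) (q : Q) :
    IsGoodPoint (fun s (w : V × Q) => (σ s w.1, w.2)) S (v, q) where
  one := by simp [h.one]
  mul s hs t ht := by simp [h.mul s hs t ht]
  inj s hs t ht hst := h.inj s hs t ht (Prod.ext_iff.1 hst).1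

theorem card_compl_product_univ_le {V Q : Type*} [Fintype V] [Fintype Q] {V₀ : Finset V} {c : ℝ}
    (h : (Fintype.card V : ℝ) - V₀.card ≤ c * Fintype.card V) :
    (((V₀ ×ˢ (Finset.univ : Finset Q))ᶜ).card : ℝ) ≤ c * Fintype.card (V × Q) := by
  have h1 : (V₀ ×ˢ (Finset.univ : Finset Q))ᶜ.card + (V₀ ×ˢ (Finset.univ : Finset Q)).card =
      Fintype.card (V × Q) := Finset.card_compl_add_card _
  rw [Finset.card_product, Finset.card_univ] at h1
  have h2 : (((V₀ ×ˢ (Finset.univ : Finset Q))ᶜ).card : ℝ) + V₀.card * Fintype.card Q =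
      Fintype.card V * Fintype.card Q := by
    rw [Fintype.card_prod] at h1
    exact_mod_cast h1
  have h3 := mul_le_mul_of_nonneg_right h (Nat.cast_nonneg (α := ℝ) (Fintype.card Q))
  rw [Fintype.card_prod, Nat.cast_mul]
  linarith

/-- Many copies of a good sofic model can be matched with a sufficiently invariant finite set. -/
theorem SoficApprox.eventually_exists_labelling {G : Type*} [Group G] [Infinite G]
    (hG : AmenableF G) (Sap : SoficApprox G) (F : Finset G) {η : ℝ} (hη : 0 < η)
    (hη' : η ≤ 1 / 2) :
    ∀ᶠ i in atTop, ∃ (K : Finset G) (ε : ℝ), 0 < ε ∧ ∀ F' ∈ FolnerSets K ε,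
      ∃ (q : ℕ) (g : Fin (Sap.d i) × Fin q → G) (A N : Finset (Fin (Sap.d i) × Fin q)),
        Sap.d i * q ≤ F'.card ∧ (1 - η) * F'.card ≤ (Sap.d i * q : ℝ) ∧
        (1 - 2 * η) * (Sap.d i * q) ≤ (A.card : ℝ) ∧ (∀ v ∈ A, ∀ w ∈ A, g v = g w → v = w) ∧
        (∀ v ∈ A, g v ∈ F') ∧
        (∀ v ∈ N, ∀ f ∈ F, g (Sap.σ i f v.1, v.2) = f * g v) ∧
        (1 - (2 + 4 * F.card) * η) * (Sap.d i * q) ≤ (N.card : ℝ) := by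
  obtain ⟨𝓕, S, hFS, h𝓕, htile⟩ := exists_quasitiling hG hη hη' F F hη
  filter_upwards [Sap.eventually_pos, Sap.eventually_exists_goodPoints S (half_pos hη)] with i hd hV₀
  obtain ⟨V₀, hV₀, hV₀card⟩ := hV₀
  have hd' : (0 : ℝ) < Sap.d i := by exact_mod_cast hd
  obtain ⟨M, hM⟩ := exists_nat_ge (2 * Sap.d i / η)
  obtain ⟨L, -, hL⟩ := (Set.infinite_univ (α := G)).exists_subset_card_eq M
  have hS1 : (0 : ℝ) < (S ∪ S * S).card + 1 := by positivity
  refine ⟨(S ∪ S * S) ∪ L, min 1 (η / 2 / ((S ∪ S * S).card + 1)),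
    lt_min one_pos (by positivity), fun F' hF' => ?_⟩
  have hεS : ((S ∪ S * S).card : ℝ) * min 1 (η / 2 / ((S ∪ S * S).card + 1)) ≤ η / 2 :=
    calc _ ≤ ((S ∪ S * S).card + 1 : ℝ) * (η / 2 / ((S ∪ S * S).card + 1)) := by
          gcongr
          · linarith
          · exact min_le_right _ _
      _ = η / 2 := by field_simp
  obtain ⟨σ', V₀', hV₀', hισ, hV₀'card⟩ := exists_goodPoints_of_mem_folnerSets
    Finset.subset_union_left hεS hF'
  have hF'card : Sap.d i ≤ η * F'.card := by
    have h1 := card_le_two_mul_of_mem_folnerSets (min_le_left _ _) hF'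
    have h2 : M ≤ 2 * F'.card :=
      hL ▸ (Finset.card_le_card Finset.subset_union_right).trans h1
    have h3 : (M : ℝ) ≤ 2 * F'.card := by exact_mod_cast h2
    have h4 := hM.trans h3
    rw [div_le_iff₀ hη] at h4
    linarith
  set q := F'.card / Sap.d i with hq
  have hqle : Sap.d i * q ≤ F'.card := Nat.mul_div_le _ _
  have hqge : (1 - η) * F'.card ≤ (Sap.d i * q : ℝ) := by
    have h1 : F'.card < Sap.d i * q + Sap.d i := by
      rw [hq]
      exact Nat.lt_mul_div_succ _ hd
    have h2 : (F'.card : ℝ) < Sap.d i * q + Sap.d i := by exact_mod_cast h1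
    linarith
  have hV₁ : ∀ v ∈ V₀ ×ˢ (Finset.univ : Finset (Fin q)),
      IsGoodPoint (fun s (w : Fin (Sap.d i) × Fin q) => (Sap.σ i s w.1, w.2)) S v :=
    fun v hv => (hV₀ v.1 (Finset.mem_product.1 hv).1).prodMk v.2
  have hV₁card := card_compl_product_univ_le (Q := Fin q) (V₀ := V₀) (c := η / 2) (by
    have h1 : (V₀ᶜ).card + V₀.card = Fintype.card (Fin (Sap.d i)) := Finset.card_compl_add_card _
    rw [Fintype.card_fin] at h1 ⊢
    have h2 : ((V₀ᶜ).card : ℝ) + V₀.card = Sap.d i := by exact_mod_cast h1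
    linarith)
  obtain ⟨T, hT, hTcard⟩ := htile _ σ' _ V₀' hV₁ hV₀' (by convert hV₁card)
    (by rw [Fintype.card_coe]; convert hV₀'card)
  have hVcard : (Fintype.card (Fin (Sap.d i) × Fin q) : ℝ) = Sap.d i * q := by simp
  have hmin : min (Fintype.card (Fin (Sap.d i) × Fin q) : ℝ) (Fintype.card F') = Sap.d i * q := by
    rw [hVcard, Fintype.card_coe, min_eq_left]
    exact_mod_cast hqle
  rw [hmin] at hTcard
  obtain ⟨g, A, N, hA, hAinj, hAF', hN, hNcard⟩ := hT.exists_labelling hV₁ hV₀' h𝓕 hFS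
    Subtype.val_injective hισ
  have hAcard : (1 - 2 * η) * (Sap.d i * q) ≤ ∑ t ∈ T, (t.part.card : ℝ) := by
    refine le_trans ?_ hTcard
    gcongr
    nlinarith
  refine ⟨q, g, A, N, hqle, hqge, ?_, hAinj, fun v hv => ?_, hN, ?_⟩
  · rw [hA, Nat.cast_sum]
    exact hAcard
  · obtain ⟨w, hw⟩ := hAF' v hv
    exact hw ▸ w.2
  · refine le_trans ?_ hNcard
    have h1 : ∑ t ∈ T, (t.shape.card : ℝ) ≤ 2 * (Sap.d i * q) := by
      have h2 := hT.sum_le_min hV₁ hV₀' fun E hE => (h𝓕 E hE).2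
      have h3 : ∑ t ∈ T, (t.part.card : ℝ) ≤ Sap.d i * q := by
        rw [← hmin]
        exact_mod_cast h2
      exact (le_two_mul_of_mul_le hη' (Finset.sum_nonneg fun _ _ => Nat.cast_nonneg _)
        hT.sum_shape_le).trans (by linarith)
    have h2 : (F.card : ℝ) * (η + η) * ∑ t ∈ T, (t.shape.card : ℝ) ≤
        F.card * (η + η) * (2 * (Sap.d i * q)) := by gcongr
    linarith

/-- A subset of a product of almost full measure has large slices over most of the base. -/
theorem card_compl_filter_slice_le {d q : ℕ} (N : Finset (Fin d × Fin q)) {κ c : ℝ} (hc : 0 < c)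
    (hd : 0 < d) (hN : (1 - κ) * (d * q) ≤ (N.card : ℝ)) :
    ((Finset.univ.filter fun j : Fin q =>
      ¬ ((Finset.univ.filter fun a : Fin d => (a, j) ∉ N).card : ℝ) ≤ c * d).card : ℝ) ≤
        κ / c * q := by
  have hd' : (0 : ℝ) < d := by exact_mod_cast hd
  set P := Finset.univ.filter fun j : Fin q =>
      ¬ ((Finset.univ.filter fun a : Fin d => (a, j) ∉ N).card : ℝ) ≤ c * d with hP
  have h1 : ∑ j ∈ P, (Finset.univ.filter fun a : Fin d => (a, j) ∉ N).card + N.card ≤ d * q := by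
    have h2 : ∑ j ∈ P, (Finset.univ.filter fun a : Fin d => (a, j) ∉ N).card ≤
        (Finset.univ.filter fun v => v ∉ N).card := by
      rw [← Finset.card_sigma]
      refine Finset.card_le_card_of_injOn (fun v => (v.2, v.1)) (fun v hv => ?_) ?_
      · simp only [Finset.coe_sigma, Set.mem_sigma_iff, Finset.mem_coe, Finset.mem_filter] at hv
        simpa using hv.2
      · rintro ⟨v, s⟩ - ⟨w, t⟩ - h
        simp only [Prod.mk.injEq] at h
        obtain ⟨rfl, rfl⟩ := h
        rfl
    have h3 := Finset.card_filter_add_card_filter_not (s := Finset.univ) fun v => v ∈ N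
    have h4 : (Finset.univ.filter fun v => v ∈ N) = N := by simp
    rw [h4, Finset.card_univ, Fintype.card_prod, Fintype.card_fin, Fintype.card_fin] at h3
    omega
  have h2 : (P.card : ℝ) * (c * d) ≤
      ∑ j ∈ P, ((Finset.univ.filter fun a : Fin d => (a, j) ∉ N).card : ℝ) := by
    rw [← nsmul_eq_mul]
    exact Finset.card_nsmul_le_sum _ _ _ fun j hj => (not_le.1 (Finset.mem_filter.1 hj).2).le
  have h3 : ∑ j ∈ P, ((Finset.univ.filter fun a : Fin d => (a, j) ∉ N).card : ℝ) + N.card ≤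
      d * q := by exact_mod_cast h1
  have h4 : (P.card : ℝ) * c * d ≤ κ * q * d := by linarith
  have h5 := le_of_mul_le_mul_right h4 hd'
  rw [div_mul_eq_mul_div, le_div_iff₀ hc]
  exact h5

theorem ContPseudoMetric.exists_sq_le {X : Type*} [TopologicalSpace X] [CompactSpace X]
    (ρ : ContPseudoMetric X) : ∃ D : ℝ, 0 < D ∧ ∀ x y, ρ.d x y ^ 2 ≤ D := by
  obtain ⟨C, hC⟩ := (isCompact_univ (X := X × X)).exists_bound_of_continuousOn
    (f := fun p => ρ.d p.1 p.2 ^ 2) (ρ.continuous'.pow 2).continuousOn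
  refine ⟨max C 1, lt_max_of_lt_right one_pos, fun x y => ?_⟩
  exact (le_abs_self _).trans ((hC (x, y) trivial).trans (le_max_left _ _))

/-- A labelling by group elements which is equivariant at most points gives approximately
equivariant maps. -/
theorem smul_mem_mapSpace {G X : Type*} [Group G] [TopologicalSpace X] [MulAction G X]
    {ρ : ContPseudoMetric X} {F : Finset G} {δ D : ℝ} (hδ : 0 ≤ δ) (hD : 0 < D)
    (hρ : ∀ x y, ρ.d x y ^ 2 ≤ D) {d : ℕ} {σ : G → Equiv.Perm (Fin d)} {g : Fin d → G}
    {N : Finset (Fin d)} (hN : ∀ a ∈ N, ∀ s ∈ F, g (σ s a) = s * g a)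
    (hcard : ((Finset.univ.filter fun a => a ∉ N).card : ℝ) ≤ δ ^ 2 / D * d) (x : X) :
    (fun a => g a • x) ∈ MapSpace ρ F δ σ := by
  refine (mem_mapSpace_iff hδ).2 fun s hs => ?_
  calc ∑ a, ρ.d (g (σ s a) • x) (s • g a • x) ^ 2 ≤ ∑ a, if a ∉ N then D else 0 := by
        refine Finset.sum_le_sum fun a _ => ?_
        split_ifs with h
        · rw [hN a h s hs, mul_smul, ρ.refl]
          norm_num
        · exact hρ _ _
    _ = (Finset.univ.filter fun a => a ∉ N).card * D := by
        rw [← Finset.sum_filter, Finset.sum_const, nsmul_eq_mul]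
    _ ≤ δ ^ 2 / D * d * D := by gcongr
    _ = δ ^ 2 * d := by field_simp

/-- Good sofic models carry families of approximately equivariant maps which see almost all
translates by elements of a sufficiently invariant finite set. -/
theorem SoficApprox.eventually_exists_families {G : Type*} [Group G] [Infinite G]
    (hG : AmenableF G) (Sap : SoficApprox G) {X : Type*} [TopologicalSpace X] [CompactSpace X]
    [MulAction G X] [ContinuousConstSMul G X] (ρ : ContPseudoMetric X) (F : Finset G) {δ e : ℝ}
    (hδ : 0 < δ) (he : 0 < e) :
    ∀ᶠ i in atTop, ∃ (K : Finset G) (ε : ℝ), 0 < ε ∧ ∀ F' ∈ FolnerSets K ε,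
      ∃ (q : ℕ) (J : Finset (Fin q)) (φ : J → X → Fin (Sap.d i) → X) (B : Finset G),
        Sap.d i * q ≤ F'.card ∧ (∀ j, Continuous (φ j)) ∧
        (∀ j x, φ j x ∈ MapSpace ρ F δ (Sap.σ i)) ∧ (B.card : ℝ) ≤ e * F'.card ∧
        ∀ t ∈ F', t ∉ B → ∃ j a, ∀ x, φ j x a = t • x := by
  obtain ⟨D, hD, hρ⟩ := ρ.exists_sq_le
  set c := δ ^ 2 / D with hc
  have hc0 : 0 < c := by positivity
  obtain ⟨η, hη0, hη2, hη⟩ : ∃ η : ℝ, 0 < η ∧ η ≤ 1 / 2 ∧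
      η * (3 + (2 + 4 * F.card) / c) ≤ e := by
    have hpos : 0 < 3 + (2 + 4 * (F.card : ℝ)) / c := by positivity
    refine ⟨min (1 / 2) (e / (3 + (2 + 4 * F.card) / c)), lt_min (by norm_num) (div_pos he hpos),
      min_le_left _ _, ?_⟩
    rw [← le_div_iff₀ hpos]
    exact min_le_right _ _
  filter_upwards [Sap.eventually_pos, Sap.eventually_exists_labelling hG F hη0 hη2] with i hd hi
  obtain ⟨K, ε, hε, hK⟩ := hi
  refine ⟨K, ε, hε, fun F' hF' => ?_⟩
  obtain ⟨q, g, A, N, hqle, hqge, hAcard, hAinj, hAF', hN, hNcard⟩ := hK F' hF'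
  set J : Finset (Fin q) := Finset.univ.filter fun j =>
    ((Finset.univ.filter fun a => (a, j) ∉ N).card : ℝ) ≤ c * Sap.d i with hJ
  set Jc : Finset (Fin q) := Finset.univ.filter fun j =>
    ¬ ((Finset.univ.filter fun a => (a, j) ∉ N).card : ℝ) ≤ c * Sap.d i with hJc
  have hJcard : (Jc.card : ℝ) ≤ (2 + 4 * F.card) * η / c * q :=
    card_compl_filter_slice_le N hc0 hd hNcard
  set A' := A.filter fun v => v.2 ∈ J with hA'
  refine ⟨q, J, fun j x a => g (a, j) • x, F' \ A'.image g, hqle, fun j => ?_, fun j x => ?_, ?_,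
    fun t ht htB => ?_⟩
  · exact continuous_pi fun a => continuous_const_smul _
  · refine smul_mem_mapSpace (g := fun a => g (a, j)) hδ.le hD hρ
      (N := Finset.univ.filter fun a => (a, j.1) ∈ N)
      (fun a ha s hs => hN _ (Finset.mem_filter.1 ha).2 s hs) ?_ x
    have := (Finset.mem_filter.1 j.2).2
    simpa using this
  · have h1 : (F' \ A'.image g).card + A'.card = F'.card := by
      have h2 : (A'.image g).card = A'.card := Finset.card_image_of_injOn fun v hv w hw =>
        hAinj v (Finset.mem_filter.1 hv).1 w (Finset.mem_filter.1 hw).1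
      rw [← h2]
      refine Finset.card_sdiff_add_card_eq_card fun t ht => ?_
      obtain ⟨v, hv, rfl⟩ := Finset.mem_image.1 ht
      exact hAF' v (Finset.mem_filter.1 hv).1
    have h2 : A.card ≤ A'.card + Sap.d i * Jc.card := by
      have h3 : A ⊆ A' ∪ Finset.univ ×ˢ Jc := by
        intro v hv
        by_cases hvJ : v.2 ∈ J
        · exact Finset.mem_union_left _ (Finset.mem_filter.2 ⟨hv, hvJ⟩)
        · refine Finset.mem_union_right _ (Finset.mem_product.2 ⟨Finset.mem_univ _, ?_⟩)
          exact Finset.mem_filter.2 ⟨Finset.mem_univ _, fun h =>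
            hvJ (Finset.mem_filter.2 ⟨Finset.mem_univ _, h⟩)⟩
      refine (Finset.card_le_card h3).trans ((Finset.card_union_le _ _).trans ?_)
      rw [Finset.card_product, Finset.card_univ, Fintype.card_fin]
    have h1' : ((F' \ A'.image g).card : ℝ) + A'.card = F'.card := by exact_mod_cast h1
    have h2' : (A.card : ℝ) ≤ A'.card + Sap.d i * Jc.card := by exact_mod_cast h2
    have h3 : (Sap.d i * q : ℝ) ≤ F'.card := by exact_mod_cast hqle
    have h4 : (Sap.d i : ℝ) * Jc.card ≤ Sap.d i * ((2 + 4 * F.card) * η / c * q) := by gcongr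
    have h5 : (2 * η + (2 + 4 * F.card) * η / c) * (Sap.d i * q : ℝ) ≤
        (2 * η + (2 + 4 * F.card) * η / c) * F'.card := by gcongr
    have h6 : η * (3 + (2 + 4 * F.card) / c) * F'.card ≤ e * F'.card := by gcongr
    have h7 : η * (3 + (2 + 4 * (F.card : ℝ)) / c) = 3 * η + (2 + 4 * F.card) * η / c := by ring
    rw [h7] at h6
    linarith
  · have : t ∈ A'.image g := by
      by_contra h
      exact htB (Finset.mem_sdiff.2 ⟨ht, h⟩)
    obtain ⟨v, hv, rfl⟩ := Finset.mem_image.1 this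
    exact ⟨⟨v.2, (Finset.mem_filter.1 hv).2⟩, v.1, fun x => rfl⟩

/-- The mean dimension of a cover is bounded by its sofic mean dimension. -/
theorem mdimCoverIS_le_DSigmaU {G : Type*} [Group G] [Infinite G] (hG : AmenableF G)
    (Sap : SoficApprox G) {X : Type*} [TopologicalSpace X] [CompactSpace X] [MetrizableSpace X]
    [Nonempty X] [MulAction G X] [ContinuousConstSMul G X] (ρ : ContPseudoMetric X)
    {𝒰 : Finset (Set X)} (h𝒰 : IsFinOpenCover 𝒰) :
    mdimCoverIS (G := G) 𝒰 ≤ DSigmaU Sap 𝒰 ρ := by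
  refine le_iInf fun ⟨F, _⟩ => le_iInf fun ⟨δ, hδ⟩ => ?_
  refine EReal.ge_of_forall_gt_iff_ge.1 fun z hz => ?_
  obtain ⟨z', hz', hzz'⟩ := EReal.lt_iff_exists_real_btwn.1 hz
  rw [EReal.coe_lt_coe_iff] at hz'
  obtain ⟨m, hm⟩ := coverD_eq_natCast h𝒰
  obtain ⟨e, he0, he1, he⟩ : ∃ e : ℝ, 0 < e ∧ e < 1 ∧ e * m ≤ z' - z := by
    have hpos : (0 : ℝ) < m + 1 := by positivity
    have hzpos : 0 < z' - z := by linarith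
    refine ⟨min (1 / 2) ((z' - z) / (m + 1)), lt_min (by norm_num) (div_pos hzpos hpos),
      (min_le_left _ _).trans_lt (by norm_num), ?_⟩
    calc min (1 / 2) ((z' - z) / (m + 1)) * m ≤ (z' - z) / (m + 1) * (m + 1) := by
          gcongr
          · exact min_le_right _ _
          · linarith
      _ = z' - z := by field_simp
  refine le_limsup_of_frequently_le (Eventually.frequently ?_)
  filter_upwards [Sap.eventually_pos, Sap.eventually_exists_families hG ρ F hδ he0] with i hd hi
  obtain ⟨K, ε, hε, hK⟩ := hi
  have hd' : (0 : ℝ) < Sap.d i := by exact_mod_cast hd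
  have hne : Nonempty (MapSpace ρ F δ (Sap.σ i) : Set (Fin (Sap.d i) → X)) := by
    obtain ⟨F', hF'⟩ := hG K ε hε
    obtain ⟨q, J, φ, B, -, -, hmem, hBcard, hB⟩ := hK F' hF'
    have hpos : (0 : ℝ) < F'.card := by exact_mod_cast hF'.1.card_pos
    have hlt : (B.card : ℝ) < F'.card := hBcard.trans_lt (mul_lt_of_lt_one_left hpos he1)
    obtain ⟨t, ht, htB⟩ := Finset.exists_mem_notMem_of_card_lt_card (by exact_mod_cast hlt)
    obtain ⟨j, -⟩ := hB t ht htB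
    exact ⟨⟨_, hmem j (Classical.arbitrary X)⟩⟩
  obtain ⟨n, hn⟩ := coverD_eq_natCast
    (isFinOpenCover_restrictCover_prodCover h𝒰 (MapSpace ρ F δ (Sap.σ i)))
  have hbound : mdimCoverIS (G := G) 𝒰 ≤ ((n / Sap.d i + e * m : ℝ) : EReal) := by
    refine (iInf_le _ K).trans ((iInf_le _ ⟨ε, hε⟩).trans (iSup₂_le fun F' hF' => ?_))
    obtain ⟨q, J, φ, B, hqle, hφ, hmem, hBcard, hB⟩ := hK F' hF'
    rw [mul_natCast_inv_le_coe_iff hF'.1.card_pos]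
    refine (coverD_coverJoin_le hφ hmem hB hn.le hm.le).trans (EReal.coe_le_coe_iff.2 ?_)
    rw [Fintype.card_coe]
    push_cast
    have h1 : (J.card : ℝ) ≤ q := by
      exact_mod_cast (Finset.card_le_univ J).trans_eq (Fintype.card_fin q)
    have h2 : (Sap.d i * q : ℝ) ≤ F'.card := by exact_mod_cast hqle
    have h3 : (q : ℝ) ≤ F'.card / Sap.d i := by
      rw [le_div_iff₀ hd']
      linarith
    calc (J.card * n + B.card * m : ℝ) ≤ F'.card / Sap.d i * n + e * F'.card * m := by
          gcongr
          exact h1.trans h3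
      _ = (n / Sap.d i + e * m) * F'.card := by ring
  have h1 := EReal.coe_lt_coe_iff.1 (hzz'.trans_le hbound)
  rw [coverDMap, hn, natCast_mul_natCast_inv, EReal.coe_le_coe_iff]
  linarith

theorem DSigmaU_eq_bot {G X : Type*} [Group G] [TopologicalSpace X] [MulAction G X] [IsEmpty X]
    (Sap : SoficApprox G) (𝒰 : Finset (Set X)) (ρ : ContPseudoMetric X) :
    DSigmaU Sap 𝒰 ρ = ⊥ := by
  refine le_bot_iff.1 ((iInf_le _ ⟨{1}, Finset.singleton_nonempty 1⟩).trans
    ((iInf_le _ ⟨1, one_pos⟩).trans (limsup_le_of_le (h := ?_))))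
  filter_upwards [Sap.eventually_pos] with i hd
  have : IsEmpty (MapSpace ρ {1} 1 (Sap.σ i) : Set (Fin (Sap.d i) → X)) :=
    ⟨fun φ => isEmptyElim (φ.1 ⟨0, hd⟩)⟩
  rw [coverDMap, coverD_eq_bot, ← div_eq_mul_inv, EReal.bot_div_of_pos_ne_top
    (by exact_mod_cast hd) (EReal.coe_ne_top _)]

theorem mdimCoverIS_eq_bot {G X : Type*} [Group G] [TopologicalSpace X] [MulAction G X] [IsEmpty X]
    (𝒰 : Finset (Set X)) : mdimCoverIS (G := G) 𝒰 = ⊥ := by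
  refine le_bot_iff.1 ((iInf_le _ ∅).trans ((iInf_le _ ⟨1, one_pos⟩).trans
    (iSup₂_le fun F hF => ?_)))
  rw [coverD_eq_bot, ← div_eq_mul_inv, EReal.bot_div_of_pos_ne_top
    (by exact_mod_cast hF.1.card_pos) (EReal.coe_ne_top _)]

/-- For a continuous action of a countably infinite amenable group on a compact
metrizable space, the sofic mean topological dimension coincides with the
Gromov–Lindenstrauss–Weiss mean topological dimension. -/
theorem mdimSigma_eq_mdim {G : Type*} [Group G] [Countable G] [Infinite G]
    (hG : AmenableF G) (Sap : SoficApprox G)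
    {X : Type*} [TopologicalSpace X] [CompactSpace X] [MetrizableSpace X]
    [MulAction G X] [ContinuousConstSMul G X]
    (ρ : ContPseudoMetric X) (hρ : ρ.IsCompatMetric) :
    mdimSigma Sap ρ = mdimIS G X := by
  rcases isEmpty_or_nonempty X with hX | hX
  · simp only [mdimSigma, mdimIS, DSigmaU_eq_bot, mdimCoverIS_eq_bot]
  · refine le_antisymm (iSup₂_le fun 𝒰 h𝒰 => ?_)
      (iSup₂_mono fun 𝒰 h𝒰 => mdimCoverIS_le_DSigmaU hG Sap ρ h𝒰)
    obtain ⟨θ, hθ, 𝒱, h𝒱, hUV⟩ := exists_cover_thickening hρ h𝒰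
    exact (DSigmaU_le_mdimCoverIS hG Sap h𝒰 h𝒱 hθ hUV).trans
      (le_iSup₂ (f := fun 𝒱 (_ : 𝒱 ∈ {𝒱 : Finset (Set X) | IsFinOpenCover 𝒱}) =>
        mdimCoverIS (G := G) 𝒱) 𝒱 h𝒱)

end SoficMD
end

section
/- Let a countably infinite amenable group G act continuously on a compact metrizable space X, and let Σ be a sofic approximation sequence for G. Then for every finite open cover 𝒰 of X one has D_Σ(𝒰) ≥ mdim(𝒰); in particular mdim_Σ(X) ≥ mdim(X). -/
open Filter Topology TopologicalSpace
open scoped ENat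
open scoped Classical Pointwise

open Filter Topology TopologicalSpace
open scoped ENat
open scoped Classical Pointwise

namespace SoficMD

/-- Among all permutations `π`, the proportion of those whose minimum over `S` is attained in
`D ⊆ S` is at most `|D| / |S|`. -/
theorem card_perm_argmin_mul_le {n : ℕ} (S D : Finset (Fin n)) (hD : D ⊆ S) :
    S.card * (Finset.univ.filter fun π : Equiv.Perm (Fin n) =>
      ∃ x ∈ D, ∀ y ∈ S, π x ≤ π y).card ≤ D.card * Fintype.card (Equiv.Perm (Fin n)) := by
  set N : Fin n → Finset (Equiv.Perm (Fin n)) := fun x =>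
    Finset.univ.filter fun π => ∀ y ∈ S, π x ≤ π y with hN
  have card_le : ∀ x ∈ S, ∀ z ∈ S, (N x).card ≤ (N z).card := by
    intro x hx z hz
    refine Finset.card_le_card_of_injOn (fun π => (Equiv.swap x z).trans π) ?_ ?_
    · intro π hπ
      simp only [hN, Finset.coe_filter, Finset.mem_univ, true_and, Set.mem_ofPred_eq] at hπ ⊢
      intro y hy
      simp only [Equiv.trans_apply, Equiv.swap_apply_right]
      apply hπ
      rcases eq_or_ne y x with rfl | h1
      · simpa using hz
      rcases eq_or_ne y z with rfl | h2
      · simpa using hx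
      rwa [Equiv.swap_apply_of_ne_of_ne h1 h2]
    · intro π _ π' _ h
      ext y
      have := congrArg (fun e : Equiv.Perm (Fin n) => e (Equiv.swap x z y)) h
      simpa using congrArg Fin.val this
  have sum_le : ∑ x ∈ S, (N x).card ≤ Fintype.card (Equiv.Perm (Fin n)) := by
    rw [← Finset.card_biUnion]
    · exact Finset.card_le_univ _
    · intro x hx z hz hxz
      refine Finset.disjoint_left.2 fun π h1 h2 => hxz ?_
      simp only [hN, Finset.mem_filter, Finset.mem_univ, true_and] at h1 h2
      exact π.injective (le_antisymm (h1 z hz) (h2 x hx))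
  have mul_le : ∀ x ∈ S, S.card * (N x).card ≤ Fintype.card (Equiv.Perm (Fin n)) := by
    intro x hx
    refine le_trans ?_ sum_le
    rw [← smul_eq_mul]
    exact Finset.card_nsmul_le_sum _ _ _ fun z hz => card_le x hx z hz
  have sub : (Finset.univ.filter fun π : Equiv.Perm (Fin n) =>
      ∃ x ∈ D, ∀ y ∈ S, π x ≤ π y) ⊆ D.biUnion N := by
    intro π hπ
    simpa [hN] using hπ
  calc _ ≤ S.card * ∑ x ∈ D, (N x).card :=
        Nat.mul_le_mul_left _ ((Finset.card_le_card sub).trans Finset.card_biUnion_le)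
    _ = ∑ x ∈ D, S.card * (N x).card := Finset.mul_sum _ _ _
    _ ≤ _ := by
      rw [← smul_eq_mul]
      exact Finset.sum_le_card_nsmul _ _ _ fun x hx => mul_le x (hD hx)

/-- In an infinite group there are arbitrarily many pairwise disjoint right translates of a
finite set. -/
theorem exists_disjoint_translates {G : Type*} [Group G] [Infinite G] (T : Finset G) (d : ℕ) :
    ∃ g : Fin d → G, ∀ c c', ∀ t ∈ T, ∀ u ∈ T, t * g c = u * g c' → c = c' := by
  obtain ⟨g, -, hg⟩ := exists_seq_of_forall_finset_exists (fun _ : G => True)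
    (fun x y => ∀ t ∈ T, ∀ u ∈ T, t * x ≠ u * y) (by
      intro s _
      obtain ⟨y, hy⟩ := Infinite.exists_notMem_finset (T⁻¹ * (T * s))
      refine ⟨y, trivial, fun x hx t ht u hu h => hy ?_⟩
      rw [Finset.mem_mul]
      exact ⟨u⁻¹, Finset.inv_mem_inv hu, t * x, Finset.mul_mem_mul ht hx, by rw [h]; group⟩)
  refine ⟨fun c => g c, fun c c' t ht u hu h => ?_⟩
  rcases lt_trichotomy (c : ℕ) c' with hc | hc | hc
  · exact absurd h (hg _ _ hc t ht u hu)
  · exact Fin.ext hc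
  · exact absurd h.symm (hg _ _ hc u hu t ht)

/-- If `σ` is multiplicative and free off a set `B` with respect to `E` and a Følner set `T`,
then `[d]` embeds in `G` by a map that is `E`-equivariant at most points. -/
theorem exists_injective_almost_equivariant {G : Type*} [Group G] [Infinite G] {d : ℕ}
    (σ : G → Equiv.Perm (Fin d)) (E T : Finset G) (hT : T.Nonempty) (B : Finset (Fin d)) (ε : ℝ)
    (hmul : ∀ c ∉ B, ∀ s ∈ E, ∀ t ∈ T, σ s (σ t c) = σ (s * t) c)
    (hsep : ∀ c ∉ B, ∀ u ∈ T ∪ E * T, ∀ v ∈ T ∪ E * T, σ u c = σ v c → u = v)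
    (hfol : (((E * T) \ T).card : ℝ) ≤ ε * T.card) :
    ∃ h : Fin d → G, Function.Injective h ∧
      ∑ s ∈ E, ((Finset.univ.filter fun a => h (σ s a) ≠ s * h a).card : ℝ) ≤
        E.card * (2 * ε * d + 2 * (T.card * B.card)) := by
  obtain ⟨g, hg⟩ := exists_disjoint_translates T d
  have hmin : ∀ (π : Equiv.Perm (Fin d)) (a : Fin d), ∃ t ∈ T, ∀ u ∈ T,
      π ((σ t).symm a) ≤ π ((σ u).symm a) := fun π a =>
    Finset.exists_min_image T (fun t => π ((σ t).symm a)) hT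
  choose τ hτT hτ using hmin
  set h : Equiv.Perm (Fin d) → Fin d → G := fun π a => τ π a * g ((σ (τ π a)).symm a) with hh
  have hinj : ∀ π, Function.Injective (h π) := by
    intro π a b hab
    have hc := hg _ _ _ (hτT π a) _ (hτT π b) hab
    have ht : τ π a = τ π b := by
      simp only [hh] at hab
      rw [hc] at hab
      exact mul_right_cancel hab
    rw [ht] at hc
    exact (σ (τ π b)).symm.injective hc
  have hε : 0 ≤ ε := by
    have : (0 : ℝ) < T.card := by exact_mod_cast hT.card_pos
    have h0 : (0 : ℝ) ≤ ((E * T) \ T).card := by positivity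
    by_contra hneg
    nlinarith
  set A : Fin d → Finset (Fin d) := fun a => T.image fun t => (σ t).symm a with hA
  set Bd : Finset (Fin d) := (T ×ˢ B).image fun p => σ p.1 p.2 with hBd
  have hBdcard : Bd.card ≤ T.card * B.card := by
    rw [← Finset.card_product]
    exact Finset.card_image_le
  have hgood : ∀ a ∉ Bd, ∀ t ∈ T, (σ t).symm a ∉ B := by
    intro a ha t ht hB
    exact ha (Finset.mem_image.2 ⟨(t, (σ t).symm a), Finset.mem_product.2 ⟨ht, hB⟩, by simp⟩)
  have hAcard : ∀ a ∉ Bd, (A a).card = T.card := by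
    intro a ha
    refine Finset.card_image_of_injOn fun t ht u hu htu => ?_
    refine hsep _ (hgood a ha t ht) t (Finset.mem_union_left _ ht) u
      (Finset.mem_union_left _ hu) ?_
    rw [Equiv.apply_symm_apply, htu, Equiv.apply_symm_apply]
  set bad : G → Fin d → Finset (Equiv.Perm (Fin d)) := fun s a =>
    Finset.univ.filter fun π => h π (σ s a) ≠ s * h π a with hbad
  set M : ℝ := ((Fintype.card (Equiv.Perm (Fin d)) : ℕ) : ℝ) with hM
  have key : ∀ s ∈ E, ∀ a, a ∉ Bd → σ s a ∉ Bd → ((bad s a).card : ℝ) ≤ 2 * ε * M := by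
    intro s hs a ha hsa
    set S := A a ∪ A (σ s a) with hS
    set D := S \ (A a ∩ A (σ s a)) with hD
    have hsub : bad s a ⊆ Finset.univ.filter fun π : Equiv.Perm (Fin d) =>
        ∃ x ∈ D, ∀ y ∈ S, π x ≤ π y := by
      intro π hπ
      simp only [hbad, Finset.mem_filter, Finset.mem_univ, true_and] at hπ ⊢
      by_contra hno
      apply hπ
      have hSne : S.Nonempty :=
        (hT.image (fun t => (σ t).symm a)).mono Finset.subset_union_left
      obtain ⟨x, hxS, hx⟩ := Finset.exists_min_image S π hSne
      have hxI : x ∈ A a ∩ A (σ s a) := by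
        by_contra hxI
        exact hno ⟨x, Finset.mem_sdiff.2 ⟨hxS, hxI⟩, hx⟩
      rw [Finset.mem_inter] at hxI
      have argmin_eq : ∀ b, A b ⊆ S → x ∈ A b → (σ (τ π b)).symm b = x := by
        intro b hb hxb
        obtain ⟨u, hu, rfl⟩ := Finset.mem_image.1 hxb
        exact π.injective (le_antisymm (hτ π b u hu)
          (hx _ (hb (Finset.mem_image_of_mem _ (hτT π b)))))
      have e1 := argmin_eq a Finset.subset_union_left hxI.1
      have e2 := argmin_eq (σ s a) Finset.subset_union_right hxI.2
      have hxB : x ∉ B := e1 ▸ hgood a ha _ (hτT π a)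
      have f1 : σ (τ π a) x = a := by rw [← e1, Equiv.apply_symm_apply]
      have f2 : σ (τ π (σ s a)) x = σ s a := by rw [← e2, Equiv.apply_symm_apply]
      have ht : τ π (σ s a) = s * τ π a := by
        refine hsep x hxB _ (Finset.mem_union_left _ (hτT π _)) _
          (Finset.mem_union_right _ (Finset.mul_mem_mul hs (hτT π a))) ?_
        rw [f2, ← hmul x hxB s hs _ (hτT π a), f1]
      simp only [hh]
      rw [e1, e2, ht, mul_assoc]
    have hdiff : (A a \ A (σ s a)).card ≤ ((E * T) \ T).card := by
      have : A a \ A (σ s a) ⊆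
          ((E * T) \ T).image fun u => (σ u).symm (σ s a) := by
        intro x hx
        obtain ⟨hx1, hx2⟩ := Finset.mem_sdiff.1 hx
        obtain ⟨t, ht, rfl⟩ := Finset.mem_image.1 hx1
        have hx : (σ (s * t)).symm (σ s a) = (σ t).symm a := by
          rw [Equiv.symm_apply_eq, ← hmul _ (hgood a ha t ht) s hs t ht,
            Equiv.apply_symm_apply]
        refine Finset.mem_image.2 ⟨s * t, Finset.mem_sdiff.2
          ⟨Finset.mul_mem_mul hs ht, fun hst => hx2 ?_⟩, hx⟩
        exact Finset.mem_image.2 ⟨s * t, hst, hx⟩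
      exact (Finset.card_le_card this).trans Finset.card_image_le
    have hDcard : D.card ≤ 2 * ((E * T) \ T).card := by
      have hDe : D ⊆ (A a \ A (σ s a)) ∪ (A (σ s a) \ A a) := by
        intro x hx
        simp only [hD, hS, Finset.mem_sdiff, Finset.mem_union, Finset.mem_inter] at hx ⊢
        tauto
      have h2 : (A (σ s a) \ A a).card = (A a \ A (σ s a)).card :=
        Finset.card_sdiff_comm (by rw [hAcard a ha, hAcard _ hsa])
      have := (Finset.card_le_card hDe).trans (Finset.card_union_le _ _)
      omega
    have hScard : T.card ≤ S.card :=
      (hAcard a ha).symm.le.trans (Finset.card_le_card Finset.subset_union_left)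
    have hcount := card_perm_argmin_mul_le S D Finset.sdiff_subset
    have h3 : T.card * (bad s a).card ≤
        2 * ((E * T) \ T).card * Fintype.card (Equiv.Perm (Fin d)) :=
      (Nat.mul_le_mul hScard (Finset.card_le_card hsub)).trans
        (hcount.trans (Nat.mul_le_mul_right _ hDcard))
    have h4 : (T.card : ℝ) * (bad s a).card ≤ 2 * ((E * T) \ T).card * M := by
      rw [hM]; exact_mod_cast h3
    have hTpos : (0 : ℝ) < T.card := by exact_mod_cast hT.card_pos
    have hM0 : 0 ≤ M := by positivity
    refine le_of_mul_le_mul_left ?_ hTpos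
    nlinarith [mul_le_mul_of_nonneg_right hfol hM0]
  have hsum : ∀ s ∈ E, ∑ a, ((bad s a).card : ℝ) ≤
      (2 * ε * d + 2 * (T.card * B.card)) * M := by
    intro s hs
    have hpt : ∀ a, ((bad s a).card : ℝ) ≤
        2 * ε * M + ((if a ∈ Bd then M else 0) + (if σ s a ∈ Bd then M else 0)) := by
      intro a
      have hle : ((bad s a).card : ℝ) ≤ M := by
        rw [hM]; exact_mod_cast Finset.card_le_univ _
      have hM0 : 0 ≤ M := by positivity
      have h0 : 0 ≤ 2 * ε * M := by positivity
      by_cases h1 : a ∈ Bd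
      · rw [if_pos h1]; split_ifs <;> linarith
      by_cases h2 : σ s a ∈ Bd
      · rw [if_pos h2, if_neg h1]; linarith
      · rw [if_neg h1, if_neg h2]; linarith [key s hs a h1 h2]
    have hs1 : ∑ a, (if a ∈ Bd then M else 0) = Bd.card * M := by
      simp
    have hs2 : ∑ a, (if σ s a ∈ Bd then M else 0) = Bd.card * M := by
      rw [← hs1]
      exact Equiv.sum_comp (σ s) fun a => if a ∈ Bd then M else 0
    have hBdr : (Bd.card : ℝ) ≤ T.card * B.card := by exact_mod_cast hBdcard
    have hM0 : 0 ≤ M := by positivity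
    calc _ ≤ ∑ a, (2 * ε * M + ((if a ∈ Bd then M else 0) + (if σ s a ∈ Bd then M else 0))) :=
          Finset.sum_le_sum fun a _ => hpt a
      _ = d * (2 * ε * M) + (Bd.card * M + Bd.card * M) := by
          rw [Finset.sum_add_distrib, Finset.sum_add_distrib, hs1, hs2]; simp
      _ ≤ _ := by nlinarith [mul_le_mul_of_nonneg_right hBdr hM0]
  obtain ⟨π, -, hπ⟩ := Finset.exists_le_of_sum_le
    (s := (Finset.univ : Finset (Equiv.Perm (Fin d))))
    (f := fun π => ∑ s ∈ E, ((Finset.univ.filter fun a => h π (σ s a) ≠ s * h π a).card : ℝ))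
    (g := fun _ => E.card * (2 * ε * d + 2 * (T.card * B.card))) Finset.univ_nonempty (by
      rw [Finset.sum_comm]
      have swap : ∀ s, ∑ π, ((Finset.univ.filter fun a =>
          h π (σ s a) ≠ s * h π a).card : ℝ) = ∑ a, ((bad s a).card : ℝ) := by
        intro s
        have := Finset.sum_card_bipartiteAbove_eq_sum_card_bipartiteBelow
          (s := (Finset.univ : Finset (Equiv.Perm (Fin d)))) (t := (Finset.univ : Finset (Fin d)))
          (fun π a => h π (σ s a) ≠ s * h π a)
        simp only [Finset.bipartiteAbove, Finset.bipartiteBelow] at this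
        exact_mod_cast this
      calc _ = ∑ s ∈ E, ∑ a, ((bad s a).card : ℝ) := Finset.sum_congr rfl fun s _ => swap s
        _ ≤ E.card • ((2 * ε * d + 2 * (T.card * B.card)) * M) :=
          Finset.sum_le_card_nsmul _ _ _ hsum
        _ = _ := by
          rw [Finset.sum_const, Finset.card_univ, nsmul_eq_mul, nsmul_eq_mul, ← hM]; ring)
  exact ⟨h π, hinj π, hπ⟩

/-- The points at which `σ` fails to be multiplicative on `E × T` or free on `T ∪ E T`. -/
noncomputable def badPoints {G : Type*} [Group G] {d : ℕ} (σ : G → Equiv.Perm (Fin d))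
    (E T : Finset G) : Finset (Fin d) :=
  ((E ×ˢ T).biUnion fun p => Finset.univ.filter fun c => ¬ σ p.1 (σ p.2 c) = σ (p.1 * p.2) c) ∪
    (T ∪ E * T).offDiag.biUnion fun p => Finset.univ.filter fun c => σ p.1 c = σ p.2 c

theorem tendsto_card_badPoints {G : Type*} [Group G] (Sap : SoficApprox G) (E T : Finset G) :
    Tendsto (fun i => ((badPoints (Sap.σ i) E T).card : ℝ) / Sap.d i) atTop (𝓝 0) := by
  have hub : Tendsto (fun i =>
      ∑ p ∈ E ×ˢ T, (1 - ((Finset.univ.filter fun c : Fin (Sap.d i) =>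
        Sap.σ i p.1 (Sap.σ i p.2 c) = Sap.σ i (p.1 * p.2) c).card : ℝ) / Sap.d i) +
      ∑ p ∈ (T ∪ E * T).offDiag, ((Finset.univ.filter fun c : Fin (Sap.d i) =>
        Sap.σ i p.1 c = Sap.σ i p.2 c).card : ℝ) / Sap.d i) atTop (𝓝 0) := by
    have h1 := tendsto_finsetSum (E ×ˢ T) fun p _ =>
      (tendsto_const_nhds (x := (1 : ℝ))).sub (Sap.approx_mul p.1 p.2)
    have h2 := tendsto_finsetSum (T ∪ E * T).offDiag fun p hp =>
      Sap.approx_sep p.1 p.2 (Finset.mem_offDiag.1 hp).2.2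
    simpa using h1.add h2
  refine tendsto_of_tendsto_of_tendsto_of_le_of_le' tendsto_const_nhds hub
    (Eventually.of_forall fun i => by positivity) ?_
  filter_upwards [Sap.d_tendsto.eventually_gt_atTop 0] with i hi
  have hd : (0 : ℝ) < Sap.d i := by exact_mod_cast hi
  have hcard : ((badPoints (Sap.σ i) E T).card : ℝ) ≤
      ∑ p ∈ E ×ˢ T, ((Finset.univ.filter fun c : Fin (Sap.d i) =>
        ¬ Sap.σ i p.1 (Sap.σ i p.2 c) = Sap.σ i (p.1 * p.2) c).card : ℝ) +
      ∑ p ∈ (T ∪ E * T).offDiag, ((Finset.univ.filter fun c : Fin (Sap.d i) =>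
        Sap.σ i p.1 c = Sap.σ i p.2 c).card : ℝ) := by
    exact_mod_cast (Finset.card_union_le _ _).trans
      (add_le_add Finset.card_biUnion_le Finset.card_biUnion_le)
  refine (div_le_div_of_nonneg_right hcard hd.le).trans (le_of_eq ?_)
  rw [add_div, Finset.sum_div, Finset.sum_div]
  congr 1
  refine Finset.sum_congr rfl fun p _ => ?_
  have := Finset.card_filter_add_card_filter_not (s := (Finset.univ : Finset (Fin (Sap.d i))))
    (fun c => Sap.σ i p.1 (Sap.σ i p.2 c) = Sap.σ i (p.1 * p.2) c)
  rw [Finset.card_univ, Fintype.card_fin] at this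
  have hr : (((Finset.univ.filter fun c : Fin (Sap.d i) =>
      Sap.σ i p.1 (Sap.σ i p.2 c) = Sap.σ i (p.1 * p.2) c).card : ℝ) +
      (Finset.univ.filter fun c : Fin (Sap.d i) =>
        ¬ Sap.σ i p.1 (Sap.σ i p.2 c) = Sap.σ i (p.1 * p.2) c).card) = Sap.d i := by
    exact_mod_cast this
  rw [eq_sub_iff_add_eq, ← add_div, add_comm, hr, div_self hd.ne']

/-- A sofic approximation of an infinite amenable group eventually embeds in the group by
almost equivariant maps. -/
theorem eventually_exists_injective_almost_equivariant {G : Type*} [Group G] [Infinite G]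
    (hG : AmenableF G) (Sap : SoficApprox G) (E : Finset G) {η : ℝ} (hη : 0 < η) :
    ∀ᶠ i in atTop, 0 < Sap.d i ∧ ∃ h : Fin (Sap.d i) → G, Function.Injective h ∧
      ∑ s ∈ E, ((Finset.univ.filter fun a => h (Sap.σ i s a) ≠ s * h a).card : ℝ) ≤
        η * Sap.d i := by
  set ε : ℝ := η / (4 * (E.card + 1)) with hε
  have hε0 : 0 < ε := by positivity
  obtain ⟨T, hT, hTE⟩ := hG E ε hε0
  have hTpos : (0 : ℝ) < T.card := by exact_mod_cast hT.card_pos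
  have hlt := (tendsto_card_badPoints Sap E T).eventually_lt_const
    (show 0 < ε / T.card by positivity)
  filter_upwards [hlt, Sap.d_tendsto.eventually_gt_atTop 0] with i hi hd
  refine ⟨hd, ?_⟩
  have hd' : (0 : ℝ) < Sap.d i := by exact_mod_cast hd
  obtain ⟨h, hinj, hsum⟩ := exists_injective_almost_equivariant (Sap.σ i) E T hT
    (badPoints (Sap.σ i) E T) ε
    (by
      intro c hc s hs t ht
      by_contra hne
      exact hc (Finset.mem_union_left _ (Finset.mem_biUnion.2
        ⟨(s, t), Finset.mem_product.2 ⟨hs, ht⟩, by simpa using hne⟩)))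
    (by
      intro c hc u hu v hv huv
      by_contra hne
      exact hc (Finset.mem_union_right _ (Finset.mem_biUnion.2
        ⟨(u, v), Finset.mem_offDiag.2 ⟨hu, hv, hne⟩, by simpa using huv⟩)))
    hTE.le
  refine ⟨h, hinj, hsum.trans ?_⟩
  have hB : (T.card : ℝ) * (badPoints (Sap.σ i) E T).card ≤ ε * Sap.d i := by
    rw [div_lt_div_iff₀ hd' hTpos] at hi
    linarith
  have hE : (E.card : ℝ) * (4 * ε) ≤ η := by
    rw [hε]
    have : (0 : ℝ) < E.card + 1 := by positivity
    field_simp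
    nlinarith
  calc _ ≤ (E.card : ℝ) * (4 * ε * Sap.d i) := by gcongr; linarith
    _ = (E.card : ℝ) * (4 * ε) * Sap.d i := by ring
    _ ≤ _ := by gcongr

/-- An injective map whose equivariance defect on `K` is small has a Følner image. -/
theorem image_mem_folnerSets {G : Type*} [Group G] {d : ℕ} (hd : 0 < d)
    (σ : G → Equiv.Perm (Fin d)) (K : Finset G) {ε : ℝ} (h : Fin d → G)
    (hinj : Function.Injective h)
    (hK : ∑ s ∈ K, ((Finset.univ.filter fun a => h (σ s a) ≠ s * h a).card : ℝ) < ε * d) :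
    Finset.univ.image h ∈ FolnerSets K ε := by
  have : Nonempty (Fin d) := ⟨⟨0, hd⟩⟩
  refine ⟨Finset.univ_nonempty.image h, ?_⟩
  rw [Finset.card_image_of_injective _ hinj, Finset.card_univ, Fintype.card_fin]
  refine lt_of_le_of_lt ?_ hK
  have hsub : (K * Finset.univ.image h) \ Finset.univ.image h ⊆
      K.biUnion fun s => (Finset.univ.filter fun a => h (σ s a) ≠ s * h a).image
        fun a => s * h a := by
    intro x hx
    obtain ⟨hx1, hx2⟩ := Finset.mem_sdiff.1 hx
    obtain ⟨s, hs, y, hy, rfl⟩ := Finset.mem_mul.1 hx1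
    obtain ⟨a, -, rfl⟩ := Finset.mem_image.1 hy
    refine Finset.mem_biUnion.2 ⟨s, hs, Finset.mem_image.2 ⟨a, ?_, rfl⟩⟩
    refine Finset.mem_filter.2 ⟨Finset.mem_univ _, fun heq => hx2 ?_⟩
    exact heq ▸ Finset.mem_image_of_mem h (Finset.mem_univ _)
  exact_mod_cast (Finset.card_le_card hsub).trans (Finset.card_biUnion_le.trans
    (Finset.sum_le_sum fun s _ => Finset.card_image_le))

/-- Pulling a cover back along a continuous map does not increase `D`. -/
theorem coverD_le_of_continuous {Y Z : Type*} [TopologicalSpace Y] [TopologicalSpace Z]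
    (Φ : Y → Z) (hΦ : Continuous Φ) (𝒰 : Finset (Set Y)) (𝒲 : Finset (Set Z))
    (href : ∀ W ∈ 𝒲, ∃ U ∈ 𝒰, Φ ⁻¹' W ⊆ U) : coverD 𝒰 ≤ coverD 𝒲 := by
  refine le_iInf₂ fun 𝒱 h𝒱 => ?_
  obtain ⟨⟨hopen, hcov⟩, hr⟩ := h𝒱
  refine iInf₂_le_of_le (𝒱.image fun V => Φ ⁻¹' V) ⟨⟨?_, ?_⟩, ?_⟩ ?_
  · intro V hV
    obtain ⟨V', hV', rfl⟩ := Finset.mem_image.1 hV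
    exact (hopen V' hV').preimage hΦ
  · refine Set.eq_univ_of_forall fun y => ?_
    have hy : Φ y ∈ ⋃ V ∈ 𝒱, V := hcov ▸ Set.mem_univ _
    simp only [Set.mem_iUnion] at hy ⊢
    obtain ⟨V, hV, hyV⟩ := hy
    exact ⟨Φ ⁻¹' V, Finset.mem_image_of_mem _ hV, hyV⟩
  · intro V hV
    obtain ⟨V', hV', rfl⟩ := Finset.mem_image.1 hV
    obtain ⟨W, hW, hVW⟩ := hr V' hV'
    obtain ⟨U, hU, hWU⟩ := href W hW
    exact ⟨U, hU, (Set.preimage_mono hVW).trans hWU⟩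
  · refine EReal.sub_le_sub (iSup_le fun y => ?_) le_rfl
    refine le_trans ?_ (le_iSup (fun z : Z =>
      (((𝒱.filter fun U => z ∈ U).card : ℝ) : EReal)) (Φ y))
    have hsub : ((𝒱.image fun V => Φ ⁻¹' V).filter fun U => y ∈ U) ⊆
        (𝒱.filter fun U => Φ y ∈ U).image fun V => Φ ⁻¹' V := by
      intro V hV
      obtain ⟨hV1, hV2⟩ := Finset.mem_filter.1 hV
      obtain ⟨V', hV', rfl⟩ := Finset.mem_image.1 hV1
      exact Finset.mem_image_of_mem _ (Finset.mem_filter.2 ⟨hV', hV2⟩)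
    exact_mod_cast (Finset.card_le_card hsub).trans Finset.card_image_le

/-- The orbit map `x ↦ (h a • x)_a` compares `𝒰^H`, `H` the image of `h`, with `𝒰^d` on any set
of maps containing its range. -/
theorem coverD_coverJoin_le_s5 {G X : Type*} [Group G] [TopologicalSpace X] [MulAction G X]
    [ContinuousConstSMul G X] {d : ℕ} (𝒰 : Finset (Set X)) (h : Fin d → G)
    (Z : Set (Fin d → X))
    (hZ : ∀ x : X, (fun a => h a • x) ∈ Z) :
    coverD (coverJoin 𝒰 (Finset.univ.image h)) ≤ coverD (restrictCover (prodCover 𝒰 d) Z) := by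
  refine coverD_le_of_continuous (fun x => (⟨fun a => h a • x, hZ x⟩ : Z))
    (Continuous.subtype_mk (continuous_pi fun a => continuous_const_smul (h a)) _) _ _ ?_
  intro W hW
  obtain ⟨W', hW', rfl⟩ := Finset.mem_image.1 hW
  obtain ⟨U, hU, rfl⟩ := Finset.mem_image.1 hW'
  rw [Fintype.mem_piFinset] at hU
  have hpre : ∀ s ∈ Finset.univ.image h, ∃ a, h a = s := fun s hs => by simpa using hs
  refine ⟨_, Finset.mem_image_of_mem _
    (Finset.mem_pi.2 fun s hs => hU (hpre s hs).choose), ?_⟩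
  intro x hx
  simp only [Set.mem_iInter, Set.mem_preimage]
  intro s hs
  have := hx (hpre s hs).choose
  simpa only [(hpre s hs).choose_spec] using this

/-- A continuous pseudometric on a compact space is bounded. -/
theorem ContPseudoMetric.exists_bound {X : Type*} [TopologicalSpace X] [CompactSpace X]
    (ρ : ContPseudoMetric X) : ∃ M : ℝ, 0 < M ∧ ∀ x y, ρ.d x y ≤ M := by
  obtain ⟨M, hM⟩ := (isCompact_range ρ.continuous').bddAbove
  exact ⟨max M 1, by positivity, fun x y =>
    (hM (Set.mem_range_self (x, y))).trans (le_max_left _ _)⟩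

/-- Orbit maps along an almost equivariant `h` lie in the space of approximately equivariant
maps. -/
theorem orbit_mem_mapSpace {G X : Type*} [Group G] [TopologicalSpace X] [MulAction G X]
    {d : ℕ} (hd : 0 < d) (ρ : ContPseudoMetric X) {M : ℝ} (hM : ∀ x y, ρ.d x y ≤ M)
    (F : Finset G) {δ η : ℝ} (hδ : 0 ≤ δ) (hη : η * M ^ 2 ≤ δ ^ 2)
    (σ : G → Equiv.Perm (Fin d)) (h : Fin d → G)
    (hF : ∀ s ∈ F, ((Finset.univ.filter fun a => h (σ s a) ≠ s * h a).card : ℝ) ≤ η * d)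
    (x : X) : (fun a => h a • x) ∈ MapSpace ρ F δ σ := by
  intro s hs
  have hd' : (0 : ℝ) < d := by exact_mod_cast hd
  refine Real.sqrt_le_iff.2 ⟨hδ, ?_⟩
  have hpt : ∀ a, ρ.d (h (σ s a) • x) (s • h a • x) ^ 2 ≤
      if h (σ s a) ≠ s * h a then M ^ 2 else 0 := by
    intro a
    split_ifs with hne
    · exact pow_le_pow_left₀ (ρ.nonneg _ _) (hM _ _) 2
    · rw [not_not.1 hne, mul_smul, ρ.refl]; simp
  have hsum : ∑ a, ρ.d (h (σ s a) • x) (s • h a • x) ^ 2 ≤ η * d * M ^ 2 := by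
    refine (Finset.sum_le_sum fun a _ => hpt a).trans ?_
    rw [← Finset.sum_filter, Finset.sum_const, nsmul_eq_mul]
    exact mul_le_mul_of_nonneg_right (hF s hs) (sq_nonneg M)
  calc _ ≤ 1 / (d : ℝ) * (η * d * M ^ 2) := by gcongr
    _ = η * M ^ 2 := by field_simp
    _ ≤ _ := hη

theorem mdimCoverSI_le_DSigmaU {G : Type*} [Group G] [Infinite G]
    (hG : AmenableF G) (Sap : SoficApprox G)
    {X : Type*} [TopologicalSpace X] [CompactSpace X]
    [MulAction G X] [ContinuousConstSMul G X]
    (ρ : ContPseudoMetric X) (𝒰 : Finset (Set X)) :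
    mdimCoverSI (G := G) 𝒰 ≤ DSigmaU Sap 𝒰 ρ := by
  refine iSup_le fun K => iSup_le fun ⟨ε, hε⟩ => le_iInf fun ⟨F, _⟩ => le_iInf fun ⟨δ, hδ⟩ => ?_
  obtain ⟨M, hM0, hM⟩ := ρ.exists_bound
  set η : ℝ := min (ε / 2) (δ ^ 2 / M ^ 2) with hη
  have hη0 : 0 < η := by positivity
  refine le_limsup_of_frequently_le (Eventually.frequently ?_)
  filter_upwards [eventually_exists_injective_almost_equivariant hG Sap (F ∪ K) hη0]
    with i ⟨hd, h, hinj, hsum⟩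
  have hd' : (0 : ℝ) < Sap.d i := by exact_mod_cast hd
  have hK : Finset.univ.image h ∈ FolnerSets K ε := by
    refine image_mem_folnerSets hd (Sap.σ i) K h hinj ?_
    refine lt_of_le_of_lt ((Finset.sum_le_sum_of_subset_of_nonneg Finset.subset_union_right
      fun _ _ _ => by positivity).trans hsum) ?_
    have : η < ε := (min_le_left _ _).trans_lt (by linarith)
    gcongr
  have hmem : ∀ x : X, (fun a => h a • x) ∈ MapSpace ρ F δ (Sap.σ i) := by
    refine orbit_mem_mapSpace hd ρ hM F hδ.le (η := η) ?_ (Sap.σ i) h fun s hs => ?_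
    · rw [← le_div_iff₀ (by positivity)]
      exact min_le_right _ _
    · exact (Finset.single_le_sum (f := fun s => ((Finset.univ.filter fun a =>
        h (Sap.σ i s a) ≠ s * h a).card : ℝ)) (fun _ _ => by positivity)
        (Finset.mem_union_left K hs)).trans hsum
  refine (iInf₂_le _ hK).trans ?_
  rw [Finset.card_image_of_injective _ hinj, Finset.card_univ, Fintype.card_fin]
  exact mul_le_mul_of_nonneg_right (coverD_coverJoin_le_s5 𝒰 h _ hmem)
    (EReal.inv_nonneg_of_nonneg (by exact_mod_cast hd'.le))

/-- For a continuous action of a countably infinite amenable group on a compact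
metrizable space, `D_Σ(𝒰) ≥ mdim(𝒰)` for every finite open cover `𝒰`; in particular
`mdim_Σ(X) ≥ mdim(X)`. -/
theorem DSigma_ge_mdimCover {G : Type*} [Group G] [Countable G] [Infinite G]
    (hG : AmenableF G) (Sap : SoficApprox G)
    {X : Type*} [TopologicalSpace X] [CompactSpace X] [MetrizableSpace X]
    [MulAction G X] [ContinuousConstSMul G X]
    (ρ : ContPseudoMetric X) (hρ : ρ.IsCompatMetric) :
    (∀ 𝒰 : Finset (Set X), IsFinOpenCover 𝒰 → mdimCoverSI (G := G) 𝒰 ≤ DSigmaU Sap 𝒰 ρ) ∧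
      mdimSI G X ≤ mdimSigma Sap ρ :=
  ⟨fun 𝒰 _ => mdimCoverSI_le_DSigmaU hG Sap ρ 𝒰,
    iSup₂_mono fun 𝒰 _ => mdimCoverSI_le_DSigmaU hG Sap ρ 𝒰⟩

end SoficMD
end
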